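/- Right multiplication by a^Λ(x_1) τ_1 ⋯ τ_n on R(β+α_i) induces a well-defined map P : K_1 → K_0, the identity map of R(β+α_i)e(β,α_i) induces a well-defined surjection π : K_0 → F^Λ, both P and π are homomorphisms of (R(β+α_i), R^Λ(β) ⊗_k k[t_i])-bimodules, and the sequence 0 → K_1 →^P K_0 →^π F^Λ → 0 is exact, i.e. P is injective and the kernel of π equals the image of P. -/

import Mathlib

/- ## Scaffold: Khovanov–Lauda–Rouquier algebras -/

open scoped TensorProduct

/-- A symmetrizable Cartan datum together with the structure constants of the
family of polynomials `Q`. -/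
structure CartanDatum (k : Type) [Field k] (I : Type) [Fintype I] [DecidableEq I] : Type where
  a : I → I → ℤ
  d : I → ℤ
  t : I → I → ℕ → ℕ → k
  a_diag : ∀ i, a i i = 2
  a_nonpos : ∀ i j, i ≠ j → a i j ≤ 0
  a_zero_iff : ∀ i j, a i j = 0 ↔ a j i = 0
  d_pos : ∀ i, 0 < d i
  symmetrize : ∀ i j, d i * a i j = d j * a j i
  t_symm : ∀ i j p q, t i j p q = t j i q p
  t_lead : ∀ i j, i ≠ j → t i j (-(a i j)).toNat 0 ≠ 0

namespace KLR

variable {k : Type} [Field k] {I : Type} [Fintype I] [DecidableEq I]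

/-- The symmetric bilinear form `(α_i, α_j) = d_i a_{ij}`. -/
def B (C : CartanDatum k I) (i j : I) : ℤ := C.d i * C.a i j

/-- Generators of the KLR algebra `R(n)`. -/
inductive Gen (I : Type) (n : ℕ) : Type
  | e (ν : Fin n → I) : Gen I n
  | x (a : Fin n) : Gen I n
  | tau (l : ℕ) (h : l + 1 < n) : Gen I n

variable (k) in
/-- The free algebra on the generators. -/
abbrev FA (I : Type) (n : ℕ) : Type := FreeAlgebra k (Gen I n)

variable (k) in
def ge {n : ℕ} (ν : Fin n → I) : FA k I n := FreeAlgebra.ι k (Gen.e ν)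

variable (k) in
def gx {n : ℕ} (a : Fin n) : FA k I n := FreeAlgebra.ι k (Gen.x a)

variable (k) in
def gt {n : ℕ} (l : ℕ) (h : l + 1 < n) : FA k I n := FreeAlgebra.ι k (Gen.tau l h)

/-- The polynomial `Q_{ij}(u,v)` evaluated on two elements of an algebra. -/
def Qel (C : CartanDatum k I) {A : Type} [Ring A] [Algebra k A] (i j : I) (u v : A) : A :=
  if i = j then 0 else
    ∑ p ∈ Finset.range ((-(C.a i j)).toNat + 1), ∑ q ∈ Finset.range ((-(C.a j i)).toNat + 1),
      if C.d i * (p : ℤ) + C.d j * (q : ℤ) = -(C.d i * C.a i j) then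
        C.t i j p q • (u ^ p * v ^ q) else 0

/-- The divided difference `(Q_{ij}(u,v) - Q_{ij}(w,v))/(u - w)` evaluated on elements. -/
def Qdiff (C : CartanDatum k I) {A : Type} [Ring A] [Algebra k A] (i j : I) (u v w : A) : A :=
  if i = j then 0 else
    ∑ p ∈ Finset.range ((-(C.a i j)).toNat + 1), ∑ q ∈ Finset.range ((-(C.a j i)).toNat + 1),
      if C.d i * (p : ℤ) + C.d j * (q : ℤ) = -(C.d i * C.a i j) then
        C.t i j p q • ((∑ c ∈ Finset.range p, u ^ c * w ^ (p - 1 - c)) * v ^ q) else 0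

/-- The defining relations of the KLR algebra `R(n)`. -/
inductive Rel (C : CartanDatum k I) (n : ℕ) : FA k I n → FA k I n → Prop
  | ee : ∀ ν ν' : Fin n → I, Rel C n (ge k ν * ge k ν') (if ν = ν' then ge k ν else 0)
  | esum : Rel C n (∑ ν : Fin n → I, ge k ν) 1
  | xx : ∀ a b : Fin n, Rel C n (gx k a * gx k b) (gx k b * gx k a)
  | xe : ∀ (a : Fin n) (ν : Fin n → I), Rel C n (gx k a * ge k ν) (ge k ν * gx k a)
  | taue : ∀ (l : ℕ) (h : l + 1 < n) (ν : Fin n → I),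
      Rel C n (gt k l h * ge k ν)
        (ge k (ν ∘ Equiv.swap (⟨l, Nat.lt_of_succ_lt h⟩ : Fin n) ⟨l + 1, h⟩) * gt k l h)
  | tautau : ∀ (l : ℕ) (h : l + 1 < n) (l' : ℕ) (h' : l' + 1 < n),
      (l + 1 < l' ∨ l' + 1 < l) →
      Rel C n (gt k l h * gt k l' h') (gt k l' h' * gt k l h)
  | tausq : ∀ (l : ℕ) (h : l + 1 < n) (ν : Fin n → I),
      Rel C n (gt k l h ^ 2 * ge k ν)
        (Qel C (ν ⟨l, Nat.lt_of_succ_lt h⟩) (ν ⟨l + 1, h⟩)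
          (gx k ⟨l, Nat.lt_of_succ_lt h⟩) (gx k ⟨l + 1, h⟩) * ge k ν)
  | taux : ∀ (l : ℕ) (h : l + 1 < n) (m : Fin n) (ν : Fin n → I),
      Rel C n ((gt k l h * gx k m
          - gx k (Equiv.swap (⟨l, Nat.lt_of_succ_lt h⟩ : Fin n) ⟨l + 1, h⟩ m) * gt k l h) * ge k ν)
        (if m = ⟨l, Nat.lt_of_succ_lt h⟩ ∧ ν ⟨l, Nat.lt_of_succ_lt h⟩ = ν ⟨l + 1, h⟩ then
            -(ge k ν)
          else if m = (⟨l + 1, h⟩ : Fin n) ∧ ν ⟨l, Nat.lt_of_succ_lt h⟩ = ν ⟨l + 1, h⟩ then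
            ge k ν
          else 0)
  | braid : ∀ (l : ℕ) (h2 : l + 2 < n) (ν : Fin n → I),
      Rel C n ((gt k (l + 1) h2 * gt k l (Nat.lt_of_succ_lt h2) * gt k (l + 1) h2
          - gt k l (Nat.lt_of_succ_lt h2) * gt k (l + 1) h2 * gt k l (Nat.lt_of_succ_lt h2))
          * ge k ν)
        (if ν ⟨l, Nat.lt_of_succ_lt (Nat.lt_of_succ_lt h2)⟩ = ν ⟨l + 2, h2⟩ then
            Qdiff C (ν ⟨l, Nat.lt_of_succ_lt (Nat.lt_of_succ_lt h2)⟩)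
              (ν ⟨l + 1, Nat.lt_of_succ_lt h2⟩)
              (gx k ⟨l, Nat.lt_of_succ_lt (Nat.lt_of_succ_lt h2)⟩)
              (gx k ⟨l + 1, Nat.lt_of_succ_lt h2⟩)
              (gx k ⟨l + 2, h2⟩) * ge k ν
          else 0)

/-- The Khovanov–Lauda–Rouquier algebra `R(n)`. -/
abbrev Alg (C : CartanDatum k I) (n : ℕ) : Type := RingQuot (Rel C n)

variable (C : CartanDatum k I)

/-- The generator `e(ν)` of `R(n)`. -/
noncomputable def Ee {n : ℕ} (ν : Fin n → I) : Alg C n :=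
  RingQuot.mkAlgHom k (Rel C n) (ge k ν)

/-- The generator `x_a` of `R(n)`. -/
noncomputable def Xx {n : ℕ} (a : Fin n) : Alg C n :=
  RingQuot.mkAlgHom k (Rel C n) (gx k a)

/-- The generator `τ_l` of `R(n)`. -/
noncomputable def Tt {n : ℕ} (l : ℕ) (h : l + 1 < n) : Alg C n :=
  RingQuot.mkAlgHom k (Rel C n) (gt k l h)

variable (I) in
/-- The height of `β = Σ k_i α_i`. -/
def ht (β : I → ℕ) : ℕ := ∑ i, β i

/-- The content of a sequence `ν`. -/
def content {m : ℕ} (ν : Fin m → I) : I → ℕ :=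
  fun i => (Finset.univ.filter (fun a => ν a = i)).card

/-- The set `I^β` of sequences of length `m` with content `β`. -/
def seqs (β : I → ℕ) (m : ℕ) : Finset (Fin m → I) :=
  Finset.univ.filter (fun ν => content ν = β)

/-- The central idempotent `e(β)` in `R(n)`. -/
noncomputable def eIdem (n : ℕ) (β : I → ℕ) : Alg C n := ∑ ν ∈ seqs β n, Ee C ν

/-- `β + α_i`. -/
def addA (β : I → ℕ) (i : I) : I → ℕ := fun j => β j + if j = i then 1 else 0

/-- The idempotent `e(β, α_i)` of `R(n+1)` (sum over `ν ∈ I^{β+α_i}` with `ν_{n+1} = i`). -/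
noncomputable def eR (n : ℕ) (β : I → ℕ) (i : I) : Alg C (n + 1) :=
  ∑ ν ∈ (seqs (addA β i) (n + 1)).filter (fun ν => ν (Fin.last n) = i), Ee C ν

/-- The idempotent `e(α_i, β)` of `R(n+1)` (sum over `ν ∈ I^{β+α_i}` with `ν_1 = i`). -/
noncomputable def eL (n : ℕ) (β : I → ℕ) (i : I) : Alg C (n + 1) :=
  ∑ ν ∈ (seqs (addA β i) (n + 1)).filter (fun ν => ν 0 = i), Ee C ν

/-- The idempotent `e(β - α_i, α_i)` of `R(n)`: sum over `ν ∈ I^β` with last entry `i`;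
this is `0` when the coefficient of `α_i` in `β` is `0` or `n = 0`. -/
noncomputable def eD (n : ℕ) (β : I → ℕ) (i : I) : Alg C n :=
  ∑ ν ∈ (seqs β n).filter (fun ν => if h : 0 < n then ν ⟨n - 1, Nat.sub_lt h one_pos⟩ = i
      else False), Ee C ν

/-- The relations defining `R(β) = R(n)e(β)` (a unital ring with unit the image of
`e(β)`): the KLR relations together with the relation `e(β) = 1`. -/
inductive URel (n : ℕ) (β : I → ℕ) : FA k I n → FA k I n → Prop
  | base : ∀ {x y : FA k I n}, Rel C n x y → URel n β x y
  | unit : URel n β (∑ ν ∈ seqs β n, ge k ν) 1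

/-- The algebra `R(β)`, realized as the quotient of `R(n)` identifying `e(β)` with `1`. -/
abbrev bAlg (n : ℕ) (β : I → ℕ) : Type := RingQuot (URel C n β)

/-- The canonical projection `R(n) → R(β)`. -/
noncomputable def toB {n : ℕ} {β : I → ℕ} : Alg C n →ₐ[k] bAlg C n β :=
  RingQuot.liftAlgHom (S := k)
    ⟨RingQuot.mkAlgHom k (URel C n β),
      fun _ _ h => RingQuot.mkAlgHom_rel k (URel.base h)⟩

/-- The element `a^Λ(x_1)` at the level of the free algebra. -/
noncomputable def aLamF (Λ : I → ℕ) (n : ℕ) (β : I → ℕ) : FA k I n :=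
  if h : 0 < n then
    ∑ ν ∈ seqs β n, (gx k (⟨0, h⟩ : Fin n)) ^ (Λ (ν ⟨0, h⟩)) * ge k ν
  else 0

/-- The element `a^Λ(x_1)` of `R(β)`. -/
noncomputable def aLam (Λ : I → ℕ) (n : ℕ) (β : I → ℕ) : bAlg C n β :=
  RingQuot.mkAlgHom k (URel C n β) (aLamF Λ n β)

/-- The relations defining the cyclotomic quotient `R^Λ(β)`. -/
inductive CRel (Λ : I → ℕ) (n : ℕ) (β : I → ℕ) : FA k I n → FA k I n → Prop
  | base : ∀ {x y : FA k I n}, Rel C n x y → CRel Λ n β x y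
  | unit : CRel Λ n β (∑ ν ∈ seqs β n, ge k ν) 1
  | cyc : CRel Λ n β (aLamF Λ n β) 0

/-- The cyclotomic KLR algebra `R^Λ(β)`. -/
abbrev cAlg (Λ : I → ℕ) (n : ℕ) (β : I → ℕ) : Type := RingQuot (CRel C Λ n β)

/-- The canonical projection `R(β) → R^Λ(β)`. -/
noncomputable def toC {Λ : I → ℕ} {n : ℕ} {β : I → ℕ} : bAlg C n β →ₐ[k] cAlg C Λ n β :=
  RingQuot.liftAlgHom (S := k)
    ⟨RingQuot.mkAlgHom k (CRel C Λ n β),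
      fun _ _ h => by
        cases h with
        | base hb => exact RingQuot.mkAlgHom_rel k (CRel.base hb)
        | unit => exact RingQuot.mkAlgHom_rel k CRel.unit⟩

/-- The canonical projection `R(n) → R^Λ(β)`. -/
noncomputable def toCB (Λ : I → ℕ) {n : ℕ} {β : I → ℕ} : Alg C n →ₐ[k] cAlg C Λ n β :=
  (toC C).comp (toB C)

end KLR
namespace KLR

variable {k : Type} [Field k] {I : Type} [Fintype I] [DecidableEq I] (C : CartanDatum k I)

section Homs

/-- Characterization of the non-unital algebra homomorphism `R(n) → R(n+1)` adding `i`
on the right: `e(ν) ↦ e(ν∗(i))`, `x_a ↦ x_a e(…,α_i)`, `τ_l ↦ τ_l e(…,α_i)`,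
where the relevant idempotent is supplied as `e`. -/
def IsUpR {n : ℕ} (i : I) (e : Alg C (n + 1)) (φ : Alg C n →ₙₐ[k] Alg C (n + 1)) : Prop :=
  (∀ ν : Fin n → I, φ (Ee C ν) = Ee C (Fin.snoc ν i)) ∧
  (∀ a : Fin n, φ (Xx C a) = Xx C a.castSucc * e) ∧
  (∀ (l : ℕ) (h : l + 1 < n), φ (Tt C l h) = Tt C l (Nat.lt_succ_of_lt h) * e)

/-- Characterization of the non-unital algebra homomorphism `R(n) → R(n+1)` adding `i`
on the left: `e(ν) ↦ e((i)∗ν)`, `x_a ↦ x_{a+1} e(α_i,…)`, `τ_l ↦ τ_{l+1} e(α_i,…)`. -/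
def IsUpL {n : ℕ} (i : I) (e : Alg C (n + 1)) (φ : Alg C n →ₙₐ[k] Alg C (n + 1)) : Prop :=
  (∀ ν : Fin n → I, φ (Ee C ν) = Ee C (Fin.cons i ν)) ∧
  (∀ a : Fin n, φ (Xx C a) = Xx C a.succ * e) ∧
  (∀ (l : ℕ) (h : l + 1 < n), φ (Tt C l h) = Tt C (l + 1) (Nat.succ_lt_succ h) * e)

/-- Characterization of the non-unital homomorphism `R(β) → R(β+α_i)` (right version). -/
def IsUpRb {n : ℕ} {β γ' : I → ℕ} (i : I)
    (φ : bAlg C n β →ₙₐ[k] bAlg C (n + 1) γ') : Prop :=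
  (∀ ν : Fin n → I, φ (toB C (Ee C ν)) = toB C (Ee C (Fin.snoc ν i))) ∧
  (∀ a : Fin n, φ (toB C (Xx C a)) = toB C (Xx C a.castSucc * eR C n β i)) ∧
  (∀ (l : ℕ) (h : l + 1 < n),
    φ (toB C (Tt C l h)) = toB C (Tt C l (Nat.lt_succ_of_lt h) * eR C n β i))

/-- Characterization of the non-unital homomorphism `R(β) → R(β+α_i)` (left version). -/
def IsUpLb {n : ℕ} {β γ' : I → ℕ} (i : I)
    (φ : bAlg C n β →ₙₐ[k] bAlg C (n + 1) γ') : Prop :=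
  (∀ ν : Fin n → I, φ (toB C (Ee C ν)) = toB C (Ee C (Fin.cons i ν))) ∧
  (∀ a : Fin n, φ (toB C (Xx C a)) = toB C (Xx C a.succ * eL C n β i)) ∧
  (∀ (l : ℕ) (h : l + 1 < n),
    φ (toB C (Tt C l h)) = toB C (Tt C (l + 1) (Nat.succ_lt_succ h) * eL C n β i))

/-- Characterization of the non-unital homomorphism `R^Λ(β) → R^Λ(β+α_i)` (right version). -/
def IsUpRc (Λ : I → ℕ) {n : ℕ} {β γ' : I → ℕ} (i : I)
    (φ : cAlg C Λ n β →ₙₐ[k] cAlg C Λ (n + 1) γ') : Prop :=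
  (∀ ν : Fin n → I, φ (toCB C Λ (Ee C ν)) = toCB C Λ (Ee C (Fin.snoc ν i))) ∧
  (∀ a : Fin n, φ (toCB C Λ (Xx C a)) = toCB C Λ (Xx C a.castSucc * eR C n β i)) ∧
  (∀ (l : ℕ) (h : l + 1 < n),
    φ (toCB C Λ (Tt C l h)) = toCB C Λ (Tt C l (Nat.lt_succ_of_lt h) * eR C n β i))

end Homs

section Tensor

open scoped TensorProduct

variable (S B M : Type) [Ring S] [Algebra k S] [Ring B] [Algebra k B]
  [AddCommGroup M] [Module k M] [Module S M] [IsScalarTower k S M]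

variable (k) in
/-- The relation submodule defining the balanced tensor product `B ⊗_S M` where `S`
acts on `B` on the right through the (non-unital) homomorphism `φ : S → B`. -/
def TRel (φ : S →ₙₐ[k] B) : Submodule B (B ⊗[k] M) :=
  Submodule.span B {z | ∃ (b : B) (r : S) (m : M), z = (b * φ r) ⊗ₜ[k] m - b ⊗ₜ[k] (r • m)}

variable (k) in
/-- The balanced tensor product `B ⊗_S M` (over the homomorphism `φ : S → B`). -/
abbrev OT (φ : S →ₙₐ[k] B) : Type := (B ⊗[k] M) ⧸ TRel k S B M φ

variable (k) in
/-- The canonical projection onto the balanced tensor product. -/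
def OTmk (φ : S →ₙₐ[k] B) (z : B ⊗[k] M) : OT k S B M φ := Submodule.Quotient.mk z

end Tensor

section ESub

variable (A : Type) [Ring A] [Algebra k A] (N : Type) [AddCommGroup N] [Module k N]
  [Module A N] [IsScalarTower k A N]

variable (k) in
/-- Multiplication by `e` as a `k`-linear endomorphism of an `A`-module. -/
def eMap (e : A) : N →ₗ[k] N where
  toFun x := e • x
  map_add' x y := smul_add e x y
  map_smul' c x := by
    simp only [RingHom.id_apply]
    rw [← algebraMap_smul A c x, ← mul_smul, ← Algebra.commutes, mul_smul, algebraMap_smul]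

variable (k) in
/-- The `k`-submodule `eN` of an `A`-module `N`. -/
def eSub (e : A) : Submodule k N := LinearMap.range (eMap k A N e)

end ESub

section Grading

variable {A M : Type}

variable (k) in
/-- `𝒜` is an algebra grading of `A`. -/
def IsAlgGrading [Ring A] [Algebra k A] (𝒜 : ℤ → Submodule k A) : Prop :=
  (1 : A) ∈ 𝒜 0 ∧ (∀ {c₁ c₂ : ℤ} {a b : A}, a ∈ 𝒜 c₁ → b ∈ 𝒜 c₂ → a * b ∈ 𝒜 (c₁ + c₂)) ∧
    DirectSum.IsInternal 𝒜

variable (k) in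
/-- `gr` is a grading of the `A`-module `M` compatible with the algebra grading `𝒜`. -/
def IsModGrading [Ring A] [Algebra k A] [AddCommGroup M] [Module k M] [Module A M]
    (𝒜 : ℤ → Submodule k A) (gr : ℤ → Submodule k M) : Prop :=
  DirectSum.IsInternal gr ∧
    ∀ {c m : ℤ} {a : A} {x : M}, a ∈ 𝒜 c → x ∈ gr m → a • x ∈ gr (c + m)

end Grading

section KLRGrading

/-- The canonical grading property for `R(n)`-type quotients: images of `e(ν)` have degree 0,
`x_a e(ν)` has degree `(α_{ν_a}, α_{ν_a})`, and `τ_l e(ν)` has degree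
`-(α_{ν_l}, α_{ν_{l+1}})`.  Here `p : R(n) → A` is the canonical projection onto the
quotient under consideration. -/
def IsKLRGrading {n : ℕ} {A : Type} [Ring A] [Algebra k A] (p : Alg C n →ₐ[k] A)
    (𝒜 : ℤ → Submodule k A) : Prop :=
  IsAlgGrading k 𝒜 ∧
  (∀ ν : Fin n → I, p (Ee C ν) ∈ 𝒜 0) ∧
  (∀ (a : Fin n) (ν : Fin n → I), p (Xx C a * Ee C ν) ∈ 𝒜 (B C (ν a) (ν a))) ∧
  (∀ (l : ℕ) (h : l + 1 < n) (ν : Fin n → I),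
    p (Tt C l h * Ee C ν) ∈ 𝒜 (-(B C (ν ⟨l, Nat.lt_of_succ_lt h⟩) (ν ⟨l + 1, h⟩))))

end KLRGrading

end KLR
namespace KLR

open scoped TensorProduct

variable {k : Type} [Field k] {I : Type} [Fintype I] [DecidableEq I] (C : CartanDatum k I)

section IndGrading

variable (S B M : Type) [Ring S] [Algebra k S] [Ring B] [Algebra k B]
  [AddCommGroup M] [Module k M] [Module S M] [IsScalarTower k S M]

variable (k) in
/-- The induced grading on the balanced tensor product `B ⊗_S M`. -/
def otGr (φ : S →ₙₐ[k] B) (𝒜 : ℤ → Submodule k B) (gr : ℤ → Submodule k M)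
    (c : ℤ) : Submodule k (OT k S B M φ) :=
  Submodule.span k {z | ∃ (c₁ c₂ : ℤ) (b : B) (m : M),
    c₁ + c₂ = c ∧ b ∈ 𝒜 c₁ ∧ m ∈ gr c₂ ∧ z = OTmk k S B M φ (b ⊗ₜ[k] m)}

end IndGrading

section ESubGrading

variable (A N : Type) [Ring A] [Algebra k A] [AddCommGroup N] [Module k N]
  [Module A N] [IsScalarTower k A N]

variable (k) in
/-- The induced grading on the submodule `eN ⊆ N`. -/
def eSubGr (e : A) (gr : ℤ → Submodule k N) (c : ℤ) : Submodule k ↥(eSub k A N e) :=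
  (gr c).comap (eSub k A N e).subtype

end ESubGrading

section Instances

variable (n : ℕ) (β : I → ℕ) (Λ : I → ℕ)

noncomputable instance : Module (bAlg C n β) (cAlg C Λ n β) :=
  Module.compHom _ (toC C (Λ := Λ) (n := n) (β := β)).toRingHom

instance : IsScalarTower k (bAlg C n β) (cAlg C Λ n β) := by
  constructor
  intro c s m
  show (toC C (c • s)) * m = c • (toC C s * m)
  rw [map_smul, Algebra.smul_mul_assoc]

end Instances


end KLR
namespace KLR

open scoped TensorProduct

variable {k : Type} [Field k] {I : Type} [Fintype I] [DecidableEq I] (C : CartanDatum k I)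

/-- `⟨h_i, β⟩ = Σ_j k_j a_{ij}`. -/
def pairH (i : I) (β : I → ℕ) : ℤ := ∑ j, (β j : ℤ) * C.a i j

/-- `(α_i, β) = Σ_j k_j (α_i, α_j)`. -/
def pairB (i : I) (β : I → ℕ) : ℤ := ∑ j, (β j : ℤ) * B C i j

/-- The ordered product `τ_1 τ_2 ⋯ τ_n` in `R(β+α_i)`-type quotients. -/
noncomputable def tauProd (n : ℕ) (γ : I → ℕ) : bAlg C (n + 1) γ :=
  (List.ofFn (fun l : Fin n => toB C (Tt C l.val (Nat.succ_lt_succ l.isLt)))).prod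

/-- The right ideal `Ae` as a `k`-submodule. -/
noncomputable def rId {A : Type} [Ring A] [Algebra k A] (e : A) : Submodule k A :=
  LinearMap.range (LinearMap.mulRight k e)

/-- The left ideal `eA` as a `k`-submodule. -/
noncomputable def lId {A : Type} [Ring A] [Algebra k A] (e : A) : Submodule k A :=
  LinearMap.range (LinearMap.mulLeft k e)

variable (k) in
/-- Characterization of the module structure on `eN` over `S'` acting through
the (non-unital) homomorphism `φ : S' → A`. -/
def IsEAction {A N S' : Type} [Ring A] [Algebra k A] [AddCommGroup N] [Module k N]
    [Module A N] [IsScalarTower k A N] [Ring S'] [Algebra k S']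
    (e : A) (φ : S' →ₙₐ[k] A) (inst : Module S' ↥(eSub k A N e)) : Prop :=
  letI := inst
  ∀ (r : S') (x : ↥(eSub k A N e)), ((r • x : ↥(eSub k A N e)) : N) = φ r • (x : N)

end KLR

namespace KLR

variable {k : Type} [Field k] {I : Type} [Fintype I] [DecidableEq I] (C : CartanDatum k I)

/-- The image of `e(β,α_i)` in `R(β+α_i)`. -/
noncomputable def eRb (n : ℕ) (β : I → ℕ) (i : I) : bAlg C (n + 1) (addA β i) :=
  toB C (eR C n β i)

/-- The image of `e(α_i,β)` in `R(β+α_i)`. -/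
noncomputable def eLb (n : ℕ) (β : I → ℕ) (i : I) : bAlg C (n + 1) (addA β i) :=
  toB C (eL C n β i)

/-- The image of `e(β-α_i,α_i)` in `R(β)`. -/
noncomputable def eDb (n : ℕ) (β : I → ℕ) (i : I) : bAlg C n β :=
  toB C (eD C n β i)

/-- The image of `e(β,α_i)` in `R^Λ(β+α_i)`. -/
noncomputable def eRc (Λ : I → ℕ) (n : ℕ) (β : I → ℕ) (i : I) :
    cAlg C Λ (n + 1) (addA β i) :=
  toCB C Λ (eR C n β i)

/-- The image of `e(β-α_i,α_i)` in `R^Λ(β)`. -/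
noncomputable def eDc (Λ : I → ℕ) (n : ℕ) (β : I → ℕ) (i : I) : cAlg C Λ n β :=
  toCB C Λ (eD C n β i)

end KLR

namespace KLR

open scoped TensorProduct

variable {k : Type} [Field k] {I : Type} [Fintype I] [DecidableEq I] (C : CartanDatum k I)

variable (Λ : I → ℕ) (n : ℕ) (β : I → ℕ) (i : I)

/-- `K₀` (for `φ = φ₀` the right-adding homomorphism), resp. `K₁` (for `φ = φ₁` the
left-adding homomorphism): the balanced tensor product
`R(β+α_i) ⊗_{R(β)} R^Λ(β)` over `φ`. -/
noncomputable abbrev KK (φ : bAlg C n β →ₙₐ[k] bAlg C (n + 1) (addA β i)) : Type :=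
  OT k (bAlg C n β) (bAlg C (n + 1) (addA β i)) (cAlg C Λ n β) φ

/-- The class of a pure tensor in `KK`. -/
noncomputable abbrev KKmk (φ : bAlg C n β →ₙₐ[k] bAlg C (n + 1) (addA β i))
    (b : bAlg C (n + 1) (addA β i)) (m : cAlg C Λ n β) : KK C Λ n β i φ :=
  OTmk k (bAlg C n β) (bAlg C (n + 1) (addA β i)) (cAlg C Λ n β) φ (b ⊗ₜ[k] m)

/-- The element `a^Λ(x_1) τ_1 ⋯ τ_n` of `R(β+α_i)`. -/
noncomputable def ccElt : bAlg C (n + 1) (addA β i) :=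
  aLam C Λ (n + 1) (addA β i) * tauProd C n (addA β i)

end KLR


namespace KLR

section Relations

variable {k : Type} [Field k] {I : Type} [Fintype I] [DecidableEq I] (C : CartanDatum k I)

theorem map_Qel {A B : Type} [Ring A] [Algebra k A] [Ring B] [Algebra k B] (f : A →ₐ[k] B)
    (i j : I) (u v : A) : f (Qel C i j u v) = Qel C i j (f u) (f v) := by
  unfold Qel
  split_ifs
  · simp
  · simp only [map_sum]
    refine Finset.sum_congr rfl fun p _ => Finset.sum_congr rfl fun q _ => ?_
    split_ifs <;> simp

theorem map_Qdiff {A B : Type} [Ring A] [Algebra k A] [Ring B] [Algebra k B] (f : A →ₐ[k] B)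
    (i j : I) (u v w : A) : f (Qdiff C i j u v w) = Qdiff C i j (f u) (f v) (f w) := by
  unfold Qdiff
  split_ifs
  · simp
  · simp only [map_sum]
    refine Finset.sum_congr rfl fun p _ => Finset.sum_congr rfl fun q _ => ?_
    split_ifs <;> simp

theorem Ee_mul {n : ℕ} (ν ν' : Fin n → I) :
    Ee C ν * Ee C ν' = if ν = ν' then Ee C ν else 0 := by
  have h := RingQuot.mkAlgHom_rel k (Rel.ee (C := C) ν ν')
  rw [map_mul] at h
  unfold Ee
  rw [h]
  split_ifs <;> simp

theorem sum_Ee {n : ℕ} : ∑ ν : Fin n → I, Ee C ν = 1 := by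
  have h := RingQuot.mkAlgHom_rel k (Rel.esum (C := C) (n := n))
  simpa [Ee] using h

theorem Xx_comm {n : ℕ} (a b : Fin n) : Xx C a * Xx C b = Xx C b * Xx C a := by
  have h := RingQuot.mkAlgHom_rel k (Rel.xx (C := C) a b)
  simpa [Xx] using h

theorem Xx_Ee {n : ℕ} (a : Fin n) (ν : Fin n → I) : Xx C a * Ee C ν = Ee C ν * Xx C a := by
  have h := RingQuot.mkAlgHom_rel k (Rel.xe (C := C) a ν)
  simpa [Xx, Ee] using h

theorem Tt_Ee {n : ℕ} (l : ℕ) (h : l + 1 < n) (ν : Fin n → I) :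
    Tt C l h * Ee C ν =
      Ee C (ν ∘ Equiv.swap (⟨l, Nat.lt_of_succ_lt h⟩ : Fin n) ⟨l + 1, h⟩) * Tt C l h := by
  have h := RingQuot.mkAlgHom_rel k (Rel.taue (C := C) l h ν)
  simpa [Tt, Ee] using h

theorem Tt_Tt {n : ℕ} (l : ℕ) (h : l + 1 < n) (l' : ℕ) (h' : l' + 1 < n)
    (hl : l + 1 < l' ∨ l' + 1 < l) : Tt C l h * Tt C l' h' = Tt C l' h' * Tt C l h := by
  have h := RingQuot.mkAlgHom_rel k (Rel.tautau (C := C) l h l' h' hl)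
  simpa [Tt] using h

theorem Tt_sq {n : ℕ} (l : ℕ) (h : l + 1 < n) (ν : Fin n → I) :
    Tt C l h * Tt C l h * Ee C ν = Qel C (ν ⟨l, Nat.lt_of_succ_lt h⟩) (ν ⟨l + 1, h⟩)
      (Xx C ⟨l, Nat.lt_of_succ_lt h⟩) (Xx C ⟨l + 1, h⟩) * Ee C ν := by
  have h := RingQuot.mkAlgHom_rel k (Rel.tausq (C := C) l h ν)
  simpa [Tt, Ee, Xx, map_Qel, pow_two] using h

theorem Tt_Xx {n : ℕ} (l : ℕ) (h : l + 1 < n) (m : Fin n) (ν : Fin n → I) :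
    (Tt C l h * Xx C m
      - Xx C (Equiv.swap (⟨l, Nat.lt_of_succ_lt h⟩ : Fin n) ⟨l + 1, h⟩ m) * Tt C l h) * Ee C ν =
    if m = ⟨l, Nat.lt_of_succ_lt h⟩ ∧ ν ⟨l, Nat.lt_of_succ_lt h⟩ = ν ⟨l + 1, h⟩ then
            -(Ee C ν)
          else if m = (⟨l + 1, h⟩ : Fin n) ∧ ν ⟨l, Nat.lt_of_succ_lt h⟩ = ν ⟨l + 1, h⟩ then
            Ee C ν
          else 0 := by
  have h := RingQuot.mkAlgHom_rel k (Rel.taux (C := C) l h m ν)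
  rw [apply_ite (RingQuot.mkAlgHom k (Rel C n)), apply_ite (RingQuot.mkAlgHom k (Rel C n))] at h
  simpa [Tt, Ee, Xx] using h

theorem Tt_braid {n : ℕ} (l : ℕ) (h2 : l + 2 < n) (ν : Fin n → I) :
    (Tt C (l + 1) h2 * Tt C l (Nat.lt_of_succ_lt h2) * Tt C (l + 1) h2
          - Tt C l (Nat.lt_of_succ_lt h2) * Tt C (l + 1) h2 * Tt C l (Nat.lt_of_succ_lt h2))
          * Ee C ν =
        if ν ⟨l, Nat.lt_of_succ_lt (Nat.lt_of_succ_lt h2)⟩ = ν ⟨l + 2, h2⟩ then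
            Qdiff C (ν ⟨l, Nat.lt_of_succ_lt (Nat.lt_of_succ_lt h2)⟩)
              (ν ⟨l + 1, Nat.lt_of_succ_lt h2⟩)
              (Xx C ⟨l, Nat.lt_of_succ_lt (Nat.lt_of_succ_lt h2)⟩)
              (Xx C ⟨l + 1, Nat.lt_of_succ_lt h2⟩)
              (Xx C ⟨l + 2, h2⟩) * Ee C ν
          else 0 := by
  have h := RingQuot.mkAlgHom_rel k (Rel.braid (C := C) l h2 ν)
  rw [apply_ite (RingQuot.mkAlgHom k (Rel C n))] at h
  simpa [Tt, Ee, Xx, map_Qdiff] using h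

end Relations

section Span

variable {A V : Type*} [Ring A] [AddCommGroup V] [Module A V]

/-- The product `T_{a-1} ⋯ T_0`. -/
def wProd (T : ℕ → A) : ℕ → A
  | 0 => 1
  | a + 1 => T a * wProd T a

/-- The sum of the subgroups `T_{b-1} ⋯ T_0 G` for `b < a`. -/
def wSub (T : ℕ → A) (G : AddSubgroup V) : ℕ → AddSubgroup V
  | 0 => ⊥
  | a + 1 => wSub T G a ⊔ G.map (DistribSMul.toAddMonoidHom V (wProd T a))

/-- The weak form of the KLR relations used for the spanning argument. -/
structure WeakKLR (n : ℕ) (T : ℕ → A) (Pol : Set A) (G : AddSubgroup V) : Prop where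
  comm : ∀ l m, l < n → m < n → l + 1 < m → T l * T m = T m * T l
  pol : ∀ l, l < n → ∀ p ∈ Pol, ∃ p' ∈ Pol, ∃ p'' ∈ Pol, p * T l = T l * p' + p''
  sq : ∀ l, l < n → T l * T l ∈ Pol
  braid : ∀ l, l + 1 < n → ∃ p ∈ Pol, T l * T (l + 1) * T l = T (l + 1) * T l * T (l + 1) + p
  gpol : ∀ p ∈ Pol, ∀ g ∈ G, p • g ∈ G
  gT : ∀ l, 1 ≤ l → l < n → ∀ g ∈ G, T l • g ∈ G

variable {n : ℕ} {T : ℕ → A} {Pol : Set A} {G : AddSubgroup V}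

theorem mem_wSub {a b : ℕ} (h : b < a) {g : V} (hg : g ∈ G) : wProd T b • g ∈ wSub T G a := by
  induction a with
  | zero => omega
  | succ a ih =>
    rcases Nat.lt_succ_iff_lt_or_eq.1 h with h | h
    · exact (le_sup_left : wSub T G a ≤ _) (ih h)
    · subst h
      exact (le_sup_right : _ ≤ wSub T G (b + 1)) ⟨g, hg, rfl⟩

theorem wSub_le {a : ℕ} {H : AddSubgroup V} (h : ∀ b, b < a → ∀ g ∈ G, wProd T b • g ∈ H) :
    wSub T G a ≤ H := by
  induction a with
  | zero => exact bot_le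
  | succ a ih =>
    refine sup_le (ih fun b hb => h b (by omega)) ?_
    rintro _ ⟨g, hg, rfl⟩
    exact h a (by omega) g hg

theorem wSub_mono {a b : ℕ} (h : a ≤ b) : wSub T G a ≤ wSub T G b :=
  wSub_le fun _ hc _ hg => mem_wSub (lt_of_lt_of_le hc h) hg

theorem wSub_smul {a : ℕ} {H : AddSubgroup V} (s : A)
    (h : ∀ b, b < a → ∀ g ∈ G, s • wProd T b • g ∈ H) {v : V} (hv : v ∈ wSub T G a) :
    s • v ∈ H :=
  (wSub_le (H := H.comap (DistribSMul.toAddMonoidHom V s)) h) hv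

theorem WeakKLR.wProd_comm (W : WeakKLR n T Pol G) {a l : ℕ} (ha : a < l) (hl : l < n) :
    T l * wProd T a = wProd T a * T l := by
  induction a with
  | zero => simp [wProd]
  | succ a ih =>
    simp only [wProd]
    rw [← mul_assoc, ← W.comm a l (by omega) hl ha, mul_assoc, ih (by omega), mul_assoc]

theorem WeakKLR.far (W : WeakKLR n T Pol G) {a l : ℕ} (ha : a ≤ l) (hl : l < n) {v : V}
    (hv : v ∈ wSub T G a) : T l • v ∈ wSub T G a := by
  refine wSub_smul _ (fun b hb g hg => ?_) hv
  rw [← mul_smul, W.wProd_comm (by omega) hl, mul_smul]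
  exact mem_wSub hb (W.gT l (by omega) hl g hg)

theorem WeakKLR.step (W : WeakKLR n T Pol G) {a : ℕ} (ha : a < n) {v : V}
    (hv : v ∈ wSub T G (a + 1)) : T a • v ∈ wSub T G (a + 2) := by
  refine wSub_smul _ (fun b hb g hg => ?_) hv
  rcases Nat.lt_succ_iff_lt_or_eq.1 hb with h | h
  · exact wSub_mono (by omega) (W.far le_rfl ha (mem_wSub h hg))
  · subst h
    rw [← mul_smul]
    exact mem_wSub (T := T) (b := b + 1) (by omega) hg

theorem WeakKLR.pol_w (W : WeakKLR n T Pol G) {a : ℕ} (ha : a ≤ n) {p : A} (hp : p ∈ Pol)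
    {g : V} (hg : g ∈ G) : p • wProd T a • g ∈ wSub T G (a + 1) := by
  induction a generalizing p with
  | zero =>
    have := mem_wSub (T := T) (a := 1) (b := 0) (by omega) (W.gpol p hp g hg)
    simpa [wProd] using this
  | succ a ih =>
    obtain ⟨p', hp', p'', hp'', he⟩ := W.pol a (by omega) p hp
    have : p • wProd T (a + 1) • g = T a • p' • wProd T a • g + p'' • wProd T a • g := by
      simp only [wProd, ← mul_smul, ← add_smul, ← mul_assoc, he, add_mul]
    rw [this]
    exact add_mem (W.step (by omega) (ih (by omega) hp'))
      (wSub_mono (by omega) (ih (by omega) hp''))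

theorem WeakKLR.pol_stable (W : WeakKLR n T Pol G) {a : ℕ} (ha : a ≤ n + 1) {p : A}
    (hp : p ∈ Pol) {v : V} (hv : v ∈ wSub T G a) : p • v ∈ wSub T G a :=
  wSub_smul _ (fun _ hb _ hg => wSub_mono (by omega) (W.pol_w (by omega) hp hg)) hv

theorem WeakKLR.shift (W : WeakKLR n T Pol G) {a l : ℕ} (hl : l + 2 ≤ a) (ha : a ≤ n)
    {g : V} (hg : g ∈ G) :
    T l • wProd T a • g - wProd T a • T (l + 1) • g ∈ wSub T G (l + 1) := by
  induction a, hl using Nat.le_induction with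
  | base =>
    obtain ⟨p, hp, he⟩ := W.braid l (by omega)
    have h1 : T l * wProd T (l + 2) = wProd T (l + 2) * T (l + 1) + p * wProd T l := by
      simp only [wProd]
      rw [← mul_assoc, ← mul_assoc, he, add_mul, mul_assoc _ _ (wProd T l),
        W.wProd_comm (by omega) (by omega)]
      simp only [mul_assoc]
    rw [← mul_smul, ← mul_smul, h1, add_smul, add_sub_cancel_left, mul_smul]
    exact W.pol_w (by omega) hp hg
  | succ a hla ih =>
    have h1 := W.far (a := l + 1) (l := a) (by omega) (by omega) (ih (by omega))
    convert h1 using 1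
    simp only [wProd, smul_sub, ← mul_smul, ← mul_assoc]
    rw [W.comm l a (by omega) (by omega) (by omega)]

theorem WeakKLR.stable (W : WeakKLR n T Pol G) {l : ℕ} (hl : l < n) {v : V}
    (hv : v ∈ wSub T G (n + 1)) : T l • v ∈ wSub T G (n + 1) := by
  refine wSub_smul _ (fun b hb g hg => ?_) hv
  rcases lt_trichotomy b l with h | h | h
  · exact wSub_mono (by omega) (W.far (a := b + 1) (by omega) hl (mem_wSub (by omega) hg))
  · exact wSub_mono (by omega) (h ▸ W.step (by omega) (mem_wSub (by omega) hg) :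
      T l • wProd T b • g ∈ wSub T G (b + 2))
  · rcases Nat.lt_or_ge b (l + 2) with h' | h'
    · obtain rfl : b = l + 1 := by omega
      have : T l • wProd T (l + 1) • g = (T l * T l) • wProd T l • g := by
        simp only [wProd, ← mul_smul, mul_assoc]
      rw [this]
      exact wSub_mono (by omega) (W.pol_w (by omega) (W.sq l hl) hg)
    · have h1 := W.shift h' (by omega) hg
      have h2 := mem_wSub (T := T) hb (W.gT (l + 1) (by omega) (by omega) g hg)
      have h3 := add_mem (wSub_mono (by omega : l + 1 ≤ n + 1) h1) h2
      simpa using h3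

theorem WeakKLR.shiftX (W : WeakKLR n T Pol G) (X : ℕ → A)
    (hX : ∀ l, l < n → ∀ b, b ≤ n →
      ∃ p ∈ Pol, X b * T l = T l * X (Equiv.swap l (l + 1) b) + p)
    {a : ℕ} (ha : a ≤ n) {b : ℕ} (hb : b ≤ n) {g : V} (hg : g ∈ G) :
    X b • wProd T a • g
      - wProd T a • X (if b < a then b + 1 else if b = a then 0 else b) • g ∈ wSub T G a := by
  induction a generalizing b with
  | zero =>
    have : (if b < 0 then b + 1 else if b = 0 then 0 else b) = b := by
      split_ifs <;> omega
    rw [this]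
    simp [wProd, wSub]
  | succ a ih =>
    obtain ⟨p, hp, he⟩ := hX a (by omega) b hb
    have hs : Equiv.swap a (a + 1) b ≤ n := by
      rw [Equiv.swap_apply_def]; split_ifs <;> omega
    have h1 := W.far (l := a) le_rfl (by omega) (ih (by omega) hs)
    have h2 := W.pol_w (a := a) (by omega) hp hg
    have h3 := add_mem (wSub_mono (by omega : a ≤ a + 1) h1) h2
    have hidx : (if Equiv.swap a (a + 1) b < a then Equiv.swap a (a + 1) b + 1
        else if Equiv.swap a (a + 1) b = a then 0 else Equiv.swap a (a + 1) b)
        = (if b < a + 1 then b + 1 else if b = a + 1 then 0 else b) := by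
      rw [Equiv.swap_apply_def]; split_ifs <;> omega
    rw [hidx] at h3
    convert h3 using 1
    simp only [wProd, smul_sub, ← mul_smul, ← mul_assoc, he, add_mul, add_smul]
    abel

end Span

end KLR


namespace KLR

section Base

/-- Weak KLR relations, without reference to a module. -/
structure WeakBase {A : Type*} [Ring A] (n : ℕ) (T X : ℕ → A) (Pol : Set A) : Prop where
  comm : ∀ l m, l < n → m < n → l + 1 < m → T l * T m = T m * T l
  pol : ∀ l, l < n → ∀ p ∈ Pol, ∃ p' ∈ Pol, ∃ p'' ∈ Pol, p * T l = T l * p' + p''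
  sq : ∀ l, l < n → T l * T l ∈ Pol
  braid : ∀ l, l + 1 < n → ∃ p ∈ Pol, T l * T (l + 1) * T l = T (l + 1) * T l * T (l + 1) + p
  neg : ∀ p ∈ Pol, -p ∈ Pol
  hX : ∀ l, l < n → ∀ b, b ≤ n → ∃ p ∈ Pol, X b * T l = T l * X (Equiv.swap l (l + 1) b) + p

theorem WeakBase.mirror {A : Type*} [Ring A] {n : ℕ} {T X : ℕ → A} {Pol : Set A}
    (W : WeakBase n T X Pol) :
    WeakBase n (fun l => T (n - 1 - l)) (fun b => X (n - b)) Pol where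
  comm l m hl hm h := (W.comm _ _ (by omega) (by omega) (by omega)).symm
  pol l hl := W.pol _ (by omega)
  sq l hl := W.sq _ (by omega)
  braid l hl := by
    obtain ⟨p, hp, h⟩ := W.braid (n - 1 - (l + 1)) (by omega)
    refine ⟨-p, W.neg p hp, ?_⟩
    have e : n - 1 - (l + 1) + 1 = n - 1 - l := by omega
    rw [e] at h
    rw [h]; abel
  neg := W.neg
  hX l hl b hb := by
    obtain ⟨p, hp, h⟩ := W.hX (n - 1 - l) (by omega) (n - b) (by omega)
    refine ⟨p, hp, ?_⟩
    have e : Equiv.swap (n - 1 - l) (n - 1 - l + 1) (n - b) = n - Equiv.swap l (l + 1) b := by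
      simp only [Equiv.swap_apply_def]; split_ifs <;> omega
    rw [e] at h
    exact h

theorem WeakBase.weak {A V : Type*} [Ring A] [AddCommGroup V] [Module A V] {n : ℕ}
    {T X : ℕ → A} {Pol : Set A}
    (W : WeakBase n T X Pol) (G : AddSubgroup V) (gpol : ∀ p ∈ Pol, ∀ g ∈ G, p • g ∈ G)
    (gT : ∀ l, 1 ≤ l → l < n → ∀ g ∈ G, T l • g ∈ G) : WeakKLR n T Pol G :=
  ⟨W.comm, W.pol, W.sq, W.braid, gpol, gT⟩

variable {k : Type} [Field k] {I : Type} [Fintype I] [DecidableEq I] (C : CartanDatum k I)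

/-- The polynomial-type subalgebra of `R(n)` generated by all `e(ν)` and `x_a`. -/
noncomputable def polAlg (n : ℕ) : Subalgebra k (Alg C n) :=
  Algebra.adjoin k (Set.range (fun ν : Fin n → I => Ee C ν) ∪ Set.range (fun a : Fin n => Xx C a))

theorem Ee_mem {n : ℕ} (ν : Fin n → I) : Ee C ν ∈ polAlg C n :=
  Algebra.subset_adjoin (Or.inl ⟨ν, rfl⟩)

theorem Xx_mem {n : ℕ} (a : Fin n) : Xx C a ∈ polAlg C n :=
  Algebra.subset_adjoin (Or.inr ⟨a, rfl⟩)

theorem sum_mul_Ee {n : ℕ} (z : Alg C n) : z = ∑ ν, z * Ee C ν := by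
  rw [← Finset.mul_sum, sum_Ee, mul_one]

theorem mem_pol_of {n : ℕ} (z : Alg C n) (h : ∀ ν, z * Ee C ν ∈ polAlg C n) :
    z ∈ polAlg C n := by
  rw [sum_mul_Ee C z]
  exact sum_mem fun ν _ => h ν

theorem Qel_mem {A : Type} [Ring A] [Algebra k A] (S : Subalgebra k A) (i j : I) {u v : A}
    (hu : u ∈ S) (hv : v ∈ S) : Qel C i j u v ∈ S := by
  unfold Qel
  split_ifs
  · exact zero_mem S
  · refine sum_mem fun p _ => sum_mem fun q _ => ?_
    split_ifs
    · exact S.smul_mem (mul_mem (pow_mem hu _) (pow_mem hv _)) _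
    · exact zero_mem S

theorem Qdiff_mem {A : Type} [Ring A] [Algebra k A] (S : Subalgebra k A) (i j : I) {u v w : A}
    (hu : u ∈ S) (hv : v ∈ S) (hw : w ∈ S) : Qdiff C i j u v w ∈ S := by
  unfold Qdiff
  split_ifs
  · exact zero_mem S
  · refine sum_mem fun p _ => sum_mem fun q _ => ?_
    split_ifs
    · exact S.smul_mem (mul_mem (sum_mem fun c _ => mul_mem (pow_mem hu _) (pow_mem hw _))
        (pow_mem hv _)) _
    · exact zero_mem S

/-- `τ_l` extended by `0`. -/
noncomputable def tN (n : ℕ) (l : ℕ) : Alg C n := if h : l + 1 < n then Tt C l h else 0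

/-- `x_b` extended by `0`. -/
noncomputable def xN (n : ℕ) (b : ℕ) : Alg C n := if h : b < n then Xx C ⟨b, h⟩ else 0

theorem swap_mk {n : ℕ} (l : ℕ) (h : l + 1 < n) (b : ℕ) (hb : b < n)
    (hs : Equiv.swap l (l + 1) b < n) :
    Equiv.swap (⟨l, Nat.lt_of_succ_lt h⟩ : Fin n) ⟨l + 1, h⟩ ⟨b, hb⟩
      = ⟨Equiv.swap l (l + 1) b, hs⟩ := by
  ext
  simp only [Equiv.swap_apply_def, Fin.mk.injEq]
  split_ifs <;> rfl

theorem sub_mul_mem {A : Type} [Ring A] [Algebra k A] (S : Subalgebra k A) {a b e : A}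
    (h : (b - a) * e ∈ S) : (a - b) * e ∈ S := by
  have : (a - b) * e = -((b - a) * e) := by noncomm_ring
  rw [this]
  exact neg_mem h

theorem X_mul_T {n : ℕ} (l : ℕ) (h : l + 1 < n) (b : Fin n) :
    ∃ p ∈ polAlg C n, Xx C b * Tt C l h
      = Tt C l h * Xx C (Equiv.swap (⟨l, Nat.lt_of_succ_lt h⟩ : Fin n) ⟨l + 1, h⟩ b) + p := by
  refine ⟨Xx C b * Tt C l h
      - Tt C l h * Xx C (Equiv.swap (⟨l, Nat.lt_of_succ_lt h⟩ : Fin n) ⟨l + 1, h⟩ b), ?_, by abel⟩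
  refine mem_pol_of C _ fun ν => ?_
  have := Tt_Xx C l h (Equiv.swap (⟨l, Nat.lt_of_succ_lt h⟩ : Fin n) ⟨l + 1, h⟩ b) ν
  rw [Equiv.swap_apply_self] at this
  refine sub_mul_mem _ ?_
  rw [this]
  split_ifs
  · exact neg_mem (Ee_mem C ν)
  · exact Ee_mem C ν
  · exact zero_mem _

theorem E_mul_T {n : ℕ} (l : ℕ) (h : l + 1 < n) (ν : Fin n → I) :
    Ee C ν * Tt C l h
      = Tt C l h * Ee C (ν ∘ Equiv.swap (⟨l, Nat.lt_of_succ_lt h⟩ : Fin n) ⟨l + 1, h⟩) := by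
  rw [Tt_Ee]
  congr 2
  ext a
  simp

theorem pol_T {n : ℕ} (l : ℕ) (h : l + 1 < n) (p : Alg C n) (hp : p ∈ polAlg C n) :
    ∃ p' ∈ polAlg C n, ∃ p'' ∈ polAlg C n, p * Tt C l h = Tt C l h * p' + p'' := by
  unfold polAlg at hp
  induction hp using Algebra.adjoin_induction with
  | mem x hx =>
    rcases hx with ⟨ν, rfl⟩ | ⟨a, rfl⟩
    · exact ⟨_, Ee_mem C _, 0, zero_mem _, by rw [add_zero]; exact E_mul_T C l h ν⟩
    · obtain ⟨p, hp, he⟩ := X_mul_T C l h a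
      exact ⟨_, Xx_mem C _, p, hp, he⟩
  | algebraMap r =>
    exact ⟨algebraMap k _ r, Subalgebra.algebraMap_mem _ _, 0, zero_mem _,
      by rw [add_zero, Algebra.commutes]⟩
  | add x y _ _ hx hy =>
    obtain ⟨a, ha, b, hb, e1⟩ := hx
    obtain ⟨a', ha', b', hb', e2⟩ := hy
    refine ⟨a + a', add_mem ha ha', b + b', add_mem hb hb', ?_⟩
    rw [add_mul, e1, e2, mul_add]; abel
  | mul x y hxm hym hx hy =>
    obtain ⟨a, ha, b, hb, e1⟩ := hx
    obtain ⟨a', ha', b', hb', e2⟩ := hy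
    refine ⟨a * a', mul_mem ha ha', b * a' + x * b', add_mem (mul_mem hb ha') (mul_mem hxm hb'), ?_⟩
    rw [mul_assoc, e2, mul_add, ← mul_assoc, e1, add_mul, mul_assoc]; abel

theorem weakBase_alg (n : ℕ) :
    WeakBase n (tN C (n + 1)) (xN C (n + 1)) (polAlg C (n + 1) : Set (Alg C (n + 1))) where
  comm l m hl hm h := by
    rw [tN, tN, dif_pos (by omega), dif_pos (by omega)]
    exact Tt_Tt C _ _ _ _ (Or.inl h)
  pol l hl p hp := by
    rw [tN, dif_pos (by omega)]
    exact pol_T C l _ p hp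
  sq l hl := by
    rw [tN, dif_pos (by omega)]
    refine mem_pol_of C _ fun ν => ?_
    rw [Tt_sq]
    exact mul_mem (Qel_mem C _ _ _ (Xx_mem C _) (Xx_mem C _)) (Ee_mem C ν)
  braid l hl := by
    refine ⟨tN C (n + 1) l * tN C (n + 1) (l + 1) * tN C (n + 1) l
      - tN C (n + 1) (l + 1) * tN C (n + 1) l * tN C (n + 1) (l + 1), ?_, by abel⟩
    rw [tN, tN, dif_pos (by omega), dif_pos (by omega)]
    refine mem_pol_of C _ fun ν => ?_
    refine sub_mul_mem _ ?_
    rw [Tt_braid C l (by omega) ν]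
    split_ifs
    · exact mul_mem (Qdiff_mem C _ _ _ (Xx_mem C _) (Xx_mem C _) (Xx_mem C _)) (Ee_mem C ν)
    · exact zero_mem _
  neg p hp := neg_mem hp
  hX l hl b hb := by
    have hs : Equiv.swap l (l + 1) b < n + 1 := by
      rw [Equiv.swap_apply_def]; split_ifs <;> omega
    rw [tN, xN, xN, dif_pos (by omega), dif_pos (by omega), dif_pos hs]
    obtain ⟨p, hp, he⟩ := X_mul_T C l (by omega : l + 1 < n + 1) ⟨b, by omega⟩
    refine ⟨p, hp, ?_⟩
    rw [he, swap_mk l _ b _ hs]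

theorem WeakBase.map {A B : Type*} [Ring A] [Ring B] {n : ℕ} {T X : ℕ → A} {Pol : Set A}
    (W : WeakBase n T X Pol) (f : A →+* B) :
    WeakBase n (fun l => f (T l)) (fun b => f (X b)) (f '' Pol) where
  comm l m hl hm h := by rw [← map_mul, W.comm l m hl hm h, map_mul]
  pol l hl := by
    rintro _ ⟨p, hp, rfl⟩
    obtain ⟨p', hp', p'', hp'', h⟩ := W.pol l hl p hp
    exact ⟨_, ⟨p', hp', rfl⟩, _, ⟨p'', hp'', rfl⟩, by rw [← map_mul, h, map_add, map_mul]⟩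
  sq l hl := ⟨_, W.sq l hl, map_mul _ _ _⟩
  braid l hl := by
    obtain ⟨p, hp, h⟩ := W.braid l hl
    exact ⟨_, ⟨p, hp, rfl⟩, by simp only [← map_mul, h, map_add]⟩
  neg := by
    rintro _ ⟨p, hp, rfl⟩
    exact ⟨_, W.neg p hp, map_neg _ _⟩
  hX l hl b hb := by
    obtain ⟨p, hp, h⟩ := W.hX l hl b hb
    exact ⟨_, ⟨p, hp, rfl⟩, by simp only [← map_mul, h, map_add]⟩

theorem polAlg_smul_mem {n : ℕ} {A V : Type} [Ring A] [Algebra k A] [AddCommGroup V] [Module k V]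
    [Module A V] [IsScalarTower k A V] (f : Alg C n →ₐ[k] A) (G : Submodule k V)
    (hE : ∀ ν, ∀ g ∈ G, f (Ee C ν) • g ∈ G) (hX : ∀ a, ∀ g ∈ G, f (Xx C a) • g ∈ G)
    (p : Alg C n) (hp : p ∈ polAlg C n) : ∀ g ∈ G, f p • g ∈ G := by
  unfold polAlg at hp
  induction hp using Algebra.adjoin_induction with
  | mem x hx =>
    rcases hx with ⟨ν, rfl⟩ | ⟨a, rfl⟩
    · exact hE ν
    · exact hX a
  | algebraMap r =>
    intro g hg
    rw [AlgHom.commutes, algebraMap_smul]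
    exact G.smul_mem r hg
  | add x y _ _ hx hy =>
    intro g hg
    rw [map_add, add_smul]
    exact add_mem (hx g hg) (hy g hg)
  | mul x y _ _ hx hy =>
    intro g hg
    rw [map_mul, mul_smul]
    exact hx _ (hy g hg)

end Base

end KLR


namespace KLR

section QLemmas

variable {k : Type} [Field k] {I : Type} [Fintype I] [DecidableEq I] (C : CartanDatum k I)

theorem Qel_symm {A : Type} [Ring A] [Algebra k A] (i j : I) {u v : A} (h : u * v = v * u) :
    Qel C i j u v = Qel C j i v u := by
  unfold Qel
  by_cases hij : i = j
  · simp [hij]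
  · rw [if_neg hij, if_neg (Ne.symm hij), Finset.sum_comm]
    refine Finset.sum_congr rfl fun p _ => Finset.sum_congr rfl fun q _ => ?_
    have h1 := C.symmetrize i j
    have h2 : (C.d i * (q : ℤ) + C.d j * (p : ℤ) = -(C.d i * C.a i j)) ↔
        (C.d j * (p : ℤ) + C.d i * (q : ℤ) = -(C.d j * C.a j i)) := by
      rw [h1, add_comm]
    have h3 : u ^ q * v ^ p = v ^ p * u ^ q := (Commute.pow_pow (show Commute u v from h) q p).eq
    simp only [h2, C.t_symm i j q p, h3]

theorem Qdiff_mul {A : Type} [Ring A] [Algebra k A] (i j : I) {u v w : A} (huw : u * w = w * u)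
    (hvu : v * u = u * v) (hvw : v * w = w * v) :
    Qdiff C i j u v w * (u - w) = Qel C i j u v - Qel C i j w v := by
  unfold Qdiff Qel
  by_cases hij : i = j
  · simp [hij]
  · simp only [if_neg hij]
    rw [Finset.sum_mul, ← Finset.sum_sub_distrib]
    refine Finset.sum_congr rfl fun p _ => ?_
    rw [Finset.sum_mul, ← Finset.sum_sub_distrib]
    refine Finset.sum_congr rfl fun q _ => ?_
    split_ifs
    · have h1 : v ^ q * (u - w) = (u - w) * v ^ q :=
        (Commute.pow_left (show Commute v (u - w) by
          show v * (u - w) = (u - w) * v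
          rw [mul_sub, sub_mul, hvu, hvw]) q).eq
      rw [smul_mul_assoc, mul_assoc, h1, ← mul_assoc,
        (show Commute u w from huw).geom_sum₂_mul, sub_mul, smul_sub]
    · simp

theorem tau_pow {A : Type} [Ring A] {τ u w e D : A} (huw : u * w = w * u)
    (hue : u * e = e * u) (hDu : D * u = u * D)
    (h : τ * u * e = w * τ * e - D) (p : ℕ) :
    τ * u ^ p * e = w ^ p * τ * e - (∑ c ∈ Finset.range p, u ^ c * w ^ (p - 1 - c)) * D := by
  induction p with
  | zero => simp
  | succ p ih =>
    have h1 : τ * u ^ (p + 1) * e = (τ * u ^ p * e) * u := by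
      rw [pow_succ, mul_assoc, mul_assoc (u ^ p), hue]; simp only [mul_assoc]
    have h2 : ∑ c ∈ Finset.range (p + 1), u ^ c * w ^ (p + 1 - 1 - c)
        = (∑ c ∈ Finset.range p, u ^ c * w ^ (p - 1 - c)) * u + w ^ p := by
      rw [Finset.sum_range_succ', Finset.sum_mul]
      congr 1
      · refine Finset.sum_congr rfl fun c _ => ?_
        have : w ^ (p - 1 - c) * u = u * w ^ (p - 1 - c) :=
          ((show Commute u w from huw).pow_right _).eq.symm
        rw [mul_assoc, this, ← mul_assoc, ← pow_succ, show p + 1 - 1 - (c + 1) = p - 1 - c by omega]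
      · simp
    have h3 : w ^ p * τ * e * u = w ^ p * (τ * u * e) := by
      rw [mul_assoc _ e u, ← hue]; simp only [mul_assoc]
    rw [h1, ih, sub_mul, h3, h, h2, mul_sub, add_mul, mul_assoc _ D u, hDu, pow_succ]
    simp only [mul_assoc]
    abel

theorem tau_Qel {A : Type} [Ring A] [Algebra k A] {τ u w e D t : A} (j i : I)
    (huw : u * w = w * u) (hue : u * e = e * u) (hDu : D * u = u * D)
    (hte : t * e = e * t) (htτ : t * τ = τ * t) (htD : t * D = D * t)
    (h : τ * u * e = w * τ * e - D) :
    τ * Qel C j i u t * e = Qel C j i w t * τ * e - Qdiff C j i u t w * D := by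
  unfold Qel Qdiff
  by_cases hij : j = i
  · simp [hij]
  · simp only [if_neg hij]
    rw [Finset.mul_sum, Finset.sum_mul, Finset.sum_mul, Finset.sum_mul, Finset.sum_mul,
      ← Finset.sum_sub_distrib]
    refine Finset.sum_congr rfl fun p _ => ?_
    rw [Finset.mul_sum, Finset.sum_mul, Finset.sum_mul, Finset.sum_mul, Finset.sum_mul,
      ← Finset.sum_sub_distrib]
    refine Finset.sum_congr rfl fun q _ => ?_
    split_ifs
    · have h0 := tau_pow huw hue hDu h p
      have hte' : t ^ q * e = e * t ^ q := ((show Commute t e from hte).pow_left q).eq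
      have htτ' : t ^ q * τ = τ * t ^ q := ((show Commute t τ from htτ).pow_left q).eq
      have htD' : t ^ q * D = D * t ^ q := ((show Commute t D from htD).pow_left q).eq
      have e1 : τ * (u ^ p * t ^ q) * e = (τ * u ^ p * e) * t ^ q := by
        simp only [mul_assoc, hte']
      have e2 : w ^ p * t ^ q * τ * e = w ^ p * τ * e * t ^ q := by
        rw [mul_assoc (w ^ p), htτ', mul_assoc, mul_assoc τ, hte']; simp only [mul_assoc]
      rw [mul_smul_comm, smul_mul_assoc, smul_mul_assoc, smul_mul_assoc, smul_mul_assoc, ← smul_sub,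
        e1, e2, h0, sub_mul, mul_assoc _ (t ^ q) D, htD']
      simp only [mul_assoc]
    · simp

theorem tau_inv {A : Type} [Ring A] {τ u w e D t g g' : A} (hge : g * e = e * g)
    (hte : t * e = e * t) (hue : u * e = e * u) (htτ : t * τ = τ * t)
    (hgD : g * D = D * g)
    (hg : (t - u) * g = 1) (hg' : g' * (t - w) = 1)
    (h : τ * u * e = w * τ * e - D) :
    τ * g * e = g' * τ * e - g' * g * D := by
  have h1 : τ * (t - u) * e = (t - w) * τ * e + D := by
    have : τ * (t - u) * e = τ * t * e - τ * u * e := by noncomm_ring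
    rw [this, h, ← htτ]; noncomm_ring
  have h2 : g' * (τ * (t - u) * e) * g = g' * τ * e := by
    have : (t - u) * e = e * (t - u) := by rw [sub_mul, mul_sub, hte, hue]
    rw [mul_assoc τ, this]
    simp only [mul_assoc]
    rw [hg, mul_one]
  have h3 : g' * ((t - w) * τ * e + D) * g = τ * g * e + g' * g * D := by
    have : g' * ((t - w) * τ * e + D) * g = (g' * (t - w)) * τ * (e * g) + g' * (D * g) := by
      noncomm_ring
    rw [this, hg', ← hge, ← hgD]
    simp only [one_mul, mul_assoc]
  rw [h1, h3] at h2
  rw [← h2]; abel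

end QLemmas

section Rep

variable {k : Type} [Field k] {I : Type} [Fintype I] [DecidableEq I]

/-- Input data for the localized induced representation of `R(n+1)`. -/
structure RD (C : CartanDatum k I) (n : ℕ) (i : I) (E : Type) [Ring E] [Algebra k E] where
  ψ : Alg C n →ₐ[k] E
  t : E
  g : ℕ → E
  tc : ∀ z, t * ψ z = ψ z * t
  g1 : ∀ l, (t - ψ (xN C n l)) * g l = 1
  g2 : ∀ l, g l * (t - ψ (xN C n l)) = 1

/-- The `l`-th entry of `μ` with default value `i`. -/
def vl (i : I) {n : ℕ} (μ : Fin n → I) (l : ℕ) : I := if h : l < n then μ ⟨l, h⟩ else i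

/-- `μ` with the entries `l` and `l + 1` swapped. -/
def sw {n : ℕ} (l : ℕ) (μ : Fin n → I) : Fin n → I :=
  if h : l + 1 < n then μ ∘ Equiv.swap (⟨l, Nat.lt_of_succ_lt h⟩ : Fin n) ⟨l + 1, h⟩ else μ

variable {C : CartanDatum k I} {n : ℕ} {i : I} {E : Type} [Ring E] [Algebra k E]

theorem vl_sw {l : ℕ} (h : l + 1 < n) (μ : Fin n → I) (b : ℕ) (hb : b < n) :
    vl i (sw l μ) b = vl i μ (Equiv.swap l (l + 1) b) := by
  have hs : Equiv.swap l (l + 1) b < n := by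
    rw [Equiv.swap_apply_def]; split_ifs <;> omega
  rw [vl, vl, dif_pos hb, dif_pos hs, sw, dif_pos h, Function.comp, swap_mk l h b hb hs]

namespace RD

variable (R : RD C n i E)

noncomputable def zE (μ : Fin n → I) : E := R.ψ (Ee C μ)
noncomputable def zx (l : ℕ) : E := R.ψ (xN C n l)
noncomputable def zt (l : ℕ) : E := R.ψ (tN C n l)

noncomputable def zh (l : ℕ) : E := ∑ μ, (if vl i μ l = i then R.g l else 0) * R.zE μ
noncomputable def zq (l : ℕ) : E :=
  ∑ μ, (if vl i μ l = i then -(R.g l * R.g l) else Qel C (vl i μ l) i (R.zx l) R.t) * R.zE μ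

theorem zE_mul (μ μ' : Fin n → I) : R.zE μ * R.zE μ' = if μ = μ' then R.zE μ else 0 := by
  rw [zE, zE, ← map_mul, Ee_mul]; split_ifs <;> simp

theorem zE_idem (μ : Fin n → I) : R.zE μ * R.zE μ = R.zE μ := by rw [zE_mul, if_pos rfl]

theorem sum_zE : ∑ μ, R.zE μ = 1 := by
  simp only [zE, ← map_sum, sum_Ee, map_one]

theorem ext_zE {a b : E} (h : ∀ μ, a * R.zE μ = b * R.zE μ) : a = b := by
  rw [← mul_one a, ← mul_one b, ← R.sum_zE, Finset.mul_sum, Finset.mul_sum]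
  exact Finset.sum_congr rfl fun μ _ => h μ

theorem zx_zE (l : ℕ) (μ : Fin n → I) : R.zx l * R.zE μ = R.zE μ * R.zx l := by
  rw [zx, zE, ← map_mul, ← map_mul, xN]
  split_ifs
  · rw [Xx_Ee]
  · simp

theorem zx_zx (l m : ℕ) : R.zx l * R.zx m = R.zx m * R.zx l := by
  rw [zx, zx, ← map_mul, ← map_mul, xN, xN]
  split_ifs
  · rw [Xx_comm]
  all_goals simp

theorem t_zE (μ : Fin n → I) : R.t * R.zE μ = R.zE μ * R.t := R.tc _
theorem t_zx (l : ℕ) : R.t * R.zx l = R.zx l * R.t := R.tc _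
theorem t_zt (l : ℕ) : R.t * R.zt l = R.zt l * R.t := R.tc _

theorem g_comm (l : ℕ) {z : E} (h1 : R.t * z = z * R.t) (h2 : R.zx l * z = z * R.zx l) :
    R.g l * z = z * R.g l := by
  have h3 : z * (R.t - R.zx l) = (R.t - R.zx l) * z := by rw [mul_sub, sub_mul, h1, h2]
  have h4 : R.g l * (z * (R.t - R.zx l)) * R.g l = R.g l * z := by
    rw [mul_assoc, mul_assoc, zx, R.g1, mul_one]
  rw [h3, ← mul_assoc, zx, R.g2, one_mul] at h4
  exact h4.symm

/-- The commutative subalgebra of diagonal-type elements. -/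
noncomputable def cm : Subalgebra k E :=
  Algebra.adjoin k ({R.t} ∪ Set.range R.zx ∪ Set.range R.g ∪ Set.range R.zE)

theorem t_cm : R.t ∈ R.cm := Algebra.subset_adjoin (by simp)
theorem zx_cm (l : ℕ) : R.zx l ∈ R.cm := Algebra.subset_adjoin (by simp)
theorem g_cm (l : ℕ) : R.g l ∈ R.cm := Algebra.subset_adjoin (by simp)
theorem zE_cm (μ : Fin n → I) : R.zE μ ∈ R.cm := Algebra.subset_adjoin (by simp)

theorem t_g (l : ℕ) : R.t * R.g l = R.g l * R.t := (R.g_comm l rfl (R.t_zx l).symm).symm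

theorem g_zE (l : ℕ) (μ : Fin n → I) : R.g l * R.zE μ = R.zE μ * R.g l :=
  R.g_comm l (R.t_zE μ) (R.zx_zE l μ)

theorem g_zx (l m : ℕ) : R.g l * R.zx m = R.zx m * R.g l :=
  R.g_comm l (R.t_zx m) (R.zx_zx l m)

theorem g_g (l m : ℕ) : R.g l * R.g m = R.g m * R.g l :=
  R.g_comm l (R.t_g m) (R.g_zx m l).symm

theorem cm_comm {a b : E} (ha : a ∈ R.cm) (hb : b ∈ R.cm) : a * b = b * a := by
  have key : ∀ x ∈ ({R.t} ∪ Set.range R.zx ∪ Set.range R.g ∪ Set.range R.zE : Set E),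
      ∀ y ∈ ({R.t} ∪ Set.range R.zx ∪ Set.range R.g ∪ Set.range R.zE : Set E),
      x * y = y * x := by
    rintro x (((hx | ⟨l, rfl⟩) | ⟨l, rfl⟩) | ⟨l, rfl⟩) y
      (((hy | ⟨m, rfl⟩) | ⟨m, rfl⟩) | ⟨m, rfl⟩)
    · rw [Set.mem_singleton_iff.1 hx, Set.mem_singleton_iff.1 hy]
    · rw [Set.mem_singleton_iff.1 hx, R.t_zx]
    · rw [Set.mem_singleton_iff.1 hx, R.t_g]
    · rw [Set.mem_singleton_iff.1 hx, R.t_zE]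
    · rw [Set.mem_singleton_iff.1 hy, R.t_zx]
    · exact R.zx_zx _ _
    · exact (R.g_zx _ _).symm
    · exact R.zx_zE _ _
    · rw [Set.mem_singleton_iff.1 hy, R.t_g]
    · exact R.g_zx _ _
    · exact R.g_g _ _
    · exact R.g_zE _ _
    · rw [Set.mem_singleton_iff.1 hy, R.t_zE]
    · exact (R.zx_zE _ _).symm
    · exact (R.g_zE _ _).symm
    · rw [R.zE_mul, R.zE_mul]
      by_cases h : l = m
      · simp [h]
      · simp [h, Ne.symm h]
  have := Algebra.isMulCommutative_adjoin k key
  exact congrArg Subtype.val (mul_comm' (⟨a, ha⟩ : Algebra.adjoin k _) ⟨b, hb⟩)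

theorem zh_cm (l : ℕ) : R.zh l ∈ R.cm := by
  refine sum_mem fun μ _ => mul_mem ?_ (R.zE_cm μ)
  split_ifs
  exacts [R.g_cm l, zero_mem _]

theorem zq_cm (l : ℕ) : R.zq l ∈ R.cm := by
  refine sum_mem fun μ _ => mul_mem ?_ (R.zE_cm μ)
  split_ifs
  exacts [neg_mem (mul_mem (R.g_cm l) (R.g_cm l)), Qel_mem C _ _ _ (R.zx_cm l) R.t_cm]

theorem sum_zE_mul (f : (Fin n → I) → E) (μ : Fin n → I) :
    (∑ μ', f μ' * R.zE μ') * R.zE μ = f μ * R.zE μ := by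
  rw [Finset.sum_mul, Finset.sum_eq_single μ]
  · rw [mul_assoc, zE_idem]
  · intro b _ hb
    rw [mul_assoc, zE_mul, if_neg hb, mul_zero]
  · simp

theorem zh_zE (l : ℕ) (μ : Fin n → I) :
    R.zh l * R.zE μ = (if vl i μ l = i then R.g l else 0) * R.zE μ := R.sum_zE_mul _ μ

theorem zq_zE (l : ℕ) (μ : Fin n → I) :
    R.zq l * R.zE μ = (if vl i μ l = i then -(R.g l * R.g l)
      else Qel C (vl i μ l) i (R.zx l) R.t) * R.zE μ := R.sum_zE_mul _ μ

theorem zt_zE {l : ℕ} (h : l + 1 < n) (μ : Fin n → I) :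
    R.zt l * R.zE μ = R.zE (sw l μ) * R.zt l := by
  rw [zt, zE, ← map_mul, tN, dif_pos h, Tt_Ee, map_mul, sw, dif_pos h]; rfl

theorem zt_zt {l m : ℕ} (h : l + 1 < m) : R.zt l * R.zt m = R.zt m * R.zt l := by
  rw [zt, zt, ← map_mul, ← map_mul, tN, tN]
  split_ifs with h1 h2
  · rw [Tt_Tt C _ _ _ _ (Or.inl h)]
  all_goals simp

theorem zt_sq {l : ℕ} (h : l + 1 < n) (μ : Fin n → I) :
    R.zt l * R.zt l * R.zE μ
      = Qel C (vl i μ l) (vl i μ (l + 1)) (R.zx l) (R.zx (l + 1)) * R.zE μ := by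
  have := congrArg R.ψ (Tt_sq C l h μ)
  rw [map_mul, map_mul, map_mul, map_Qel] at this
  simpa only [zt, zE, zx, tN, xN, dif_pos h, dif_pos (Nat.lt_of_succ_lt h), vl] using this

theorem zt_zx {l : ℕ} (h : l + 1 < n) (b : ℕ) (μ : Fin n → I) :
    R.zt l * R.zx b * R.zE μ = R.zx (Equiv.swap l (l + 1) b) * R.zt l * R.zE μ +
      (if b = l ∧ vl i μ l = vl i μ (l + 1) then - R.zE μ else
        if b = l + 1 ∧ vl i μ l = vl i μ (l + 1) then R.zE μ else 0) := by
  by_cases hb : b < n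
  · have := congrArg R.ψ (Tt_Xx C l h ⟨b, hb⟩ μ)
    have hs : Equiv.swap l (l + 1) b < n := by
      rw [Equiv.swap_apply_def]; split_ifs <;> omega
    rw [apply_ite R.ψ, apply_ite R.ψ, map_mul, map_sub, map_mul, map_mul, swap_mk l h b hb hs,
      map_neg, map_zero] at this
    simp only [Fin.mk.injEq] at this
    simp only [zt, zE, zx, tN, xN, dif_pos h, dif_pos (Nat.lt_of_succ_lt h), vl, dif_pos hb,
      dif_pos hs]
    rw [← this, sub_mul]; abel
  · have : Equiv.swap l (l + 1) b = b := Equiv.swap_apply_of_ne_of_ne (by omega) (by omega)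
    rw [this, if_neg (by omega), if_neg (by omega), zx, xN, dif_neg hb]
    simp

theorem zt_braid {l : ℕ} (h : l + 2 < n) (μ : Fin n → I) :
    (R.zt (l + 1) * R.zt l * R.zt (l + 1) - R.zt l * R.zt (l + 1) * R.zt l) * R.zE μ =
      if vl i μ l = vl i μ (l + 2) then
        Qdiff C (vl i μ l) (vl i μ (l + 1)) (R.zx l) (R.zx (l + 1)) (R.zx (l + 2)) * R.zE μ
      else 0 := by
  have := congrArg R.ψ (Tt_braid C l h μ)
  rw [apply_ite R.ψ] at this
  simp only [map_mul, map_sub, map_Qdiff, map_zero] at this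
  simpa only [zt, zE, zx, tN, xN, dif_pos h, dif_pos (Nat.lt_of_succ_lt h),
    dif_pos (Nat.lt_of_succ_lt (Nat.lt_of_succ_lt h)), vl] using this

end RD

end Rep

end KLR


namespace KLR

section Rep

variable {k : Type} [Field k] {I : Type} [Fintype I] [DecidableEq I]
variable {C : CartanDatum k I} {n : ℕ} {i : I} {E : Type} [Ring E] [Algebra k E]

theorem Qdiff_comm (C : CartanDatum k I) {A : Type} [Ring A] [Algebra k A] (i j : I) {u v w : A}
    (huw : u * w = w * u) : Qdiff C i j u v w = Qdiff C i j w v u := by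
  unfold Qdiff
  split_ifs
  · rfl
  · refine Finset.sum_congr rfl fun p _ => Finset.sum_congr rfl fun q _ => ?_
    rw [(show Commute u w from huw).geom_sum₂_comm]

namespace RD

variable (R : RD C n i E)

theorem Qdiff_cm (a b : I) {u v w : E} (hu : u ∈ R.cm) (hv : v ∈ R.cm) (hw : w ∈ R.cm) :
    Qdiff C a b u v w ∈ R.cm := by
  unfold Qdiff
  split_ifs
  · exact zero_mem _
  · refine sum_mem fun p _ => sum_mem fun q _ => ?_
    split_ifs
    · exact Subalgebra.smul_mem _ (mul_mem (sum_mem fun c _ => mul_mem (pow_mem hu _)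
        (pow_mem hw _)) (pow_mem hv _)) _
    · exact zero_mem _

theorem mul_zt_zE {l : ℕ} (h : l + 1 < n) (μ : Fin n → I) {z c : E}
    (hz : z * R.zE (sw l μ) = c * R.zE (sw l μ)) :
    z * R.zt l * R.zE μ = c * R.zt l * R.zE μ := by
  rw [mul_assoc, mul_assoc, R.zt_zE h, ← mul_assoc, ← mul_assoc, hz]

/-- the correction term -/
noncomputable def dD (l : ℕ) (μ : Fin n → I) : E :=
  if vl i μ l = vl i μ (l + 1) then R.zE μ else 0

theorem dD_cm (l : ℕ) (μ : Fin n → I) : R.dD l μ ∈ R.cm := by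
  unfold dD; split_ifs; exacts [R.zE_cm μ, zero_mem _]

theorem zt_zx0 {l : ℕ} (h : l + 1 < n) (μ : Fin n → I) :
    R.zt l * R.zx l * R.zE μ = R.zx (l + 1) * R.zt l * R.zE μ - R.dD l μ := by
  rw [R.zt_zx h, Equiv.swap_apply_left, dD]
  by_cases h0 : vl i μ l = vl i μ (l + 1)
  · rw [if_pos ⟨rfl, h0⟩, if_pos h0, sub_eq_add_neg]
  · rw [if_neg (by tauto), if_neg (by omega), if_neg h0, sub_zero, add_zero]

theorem zt_zx1 {l : ℕ} (h : l + 1 < n) (μ : Fin n → I) :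
    R.zt l * R.zx (l + 1) * R.zE μ = R.zx l * R.zt l * R.zE μ - (- R.dD l μ) := by
  rw [R.zt_zx h, Equiv.swap_apply_right, dD, if_neg (by omega)]
  by_cases h0 : vl i μ l = vl i μ (l + 1)
  · rw [if_pos ⟨rfl, h0⟩, if_pos h0, sub_neg_eq_add]
  · rw [if_neg (by tauto), if_neg h0, neg_zero, sub_zero, add_zero]

theorem zt_zxm {l m : ℕ} (h : l + 1 < n) (h1 : m ≠ l) (h2 : m ≠ l + 1) :
    R.zt l * R.zx m = R.zx m * R.zt l := by
  refine R.ext_zE fun μ => ?_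
  rw [R.zt_zx h, Equiv.swap_apply_of_ne_of_ne h1 h2, if_neg (by tauto), if_neg (by tauto), add_zero]

theorem vl_sw0 {l : ℕ} (h : l + 1 < n) (μ : Fin n → I) : vl i (sw l μ) l = vl i μ (l + 1) := by
  rw [vl_sw h _ _ (by omega), Equiv.swap_apply_left]

theorem vl_sw1 {l : ℕ} (h : l + 1 < n) (μ : Fin n → I) : vl i (sw l μ) (l + 1) = vl i μ l := by
  rw [vl_sw h _ _ (by omega), Equiv.swap_apply_right]

theorem vl_swm {l m : ℕ} (h : l + 1 < n) (h1 : m ≠ l) (h2 : m ≠ l + 1) (μ : Fin n → I) :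
    vl i (sw l μ) m = vl i μ m := by
  by_cases hm : m < n
  · rw [vl_sw h _ _ hm, Equiv.swap_apply_of_ne_of_ne h1 h2]
  · simp [vl, hm]

theorem zh_zt_zE {l : ℕ} (h : l + 1 < n) (m : ℕ) (μ : Fin n → I) :
    R.zh m * R.zt l * R.zE μ
      = (if vl i (sw l μ) m = i then R.g m else 0) * R.zt l * R.zE μ :=
  R.mul_zt_zE h μ (R.zh_zE m _)

theorem zq_zt_zE {l : ℕ} (h : l + 1 < n) (m : ℕ) (μ : Fin n → I) :
    R.zq m * R.zt l * R.zE μ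
      = (if vl i (sw l μ) m = i then -(R.g m * R.g m)
        else Qel C (vl i (sw l μ) m) i (R.zx m) R.t) * R.zt l * R.zE μ :=
  R.mul_zt_zE h μ (R.zq_zE m _)

theorem zt_gm {l m : ℕ} (h : l + 1 < n) (h1 : m ≠ l) (h2 : m ≠ l + 1) :
    R.g m * R.zt l = R.zt l * R.g m :=
  R.g_comm m (R.t_zt l) (R.zt_zxm h h1 h2).symm

theorem zt_zhm {l m : ℕ} (h : l + 1 < n) (h1 : m ≠ l) (h2 : m ≠ l + 1) :
    R.zt l * R.zh m = R.zh m * R.zt l := by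
  refine R.ext_zE fun μ => ?_
  rw [R.zh_zt_zE h, vl_swm h h1 h2, mul_assoc, R.zh_zE]
  split_ifs
  · rw [R.zt_gm h h1 h2, mul_assoc]
  · simp

theorem Qel_comm_of {A : Type} [Ring A] [Algebra k A] (a b : I) {u v z : A}
    (hu : z * u = u * z) (hv : z * v = v * z) : z * Qel C a b u v = Qel C a b u v * z := by
  have : Qel C a b u v ∈ Subalgebra.centralizer k {z} :=
    Qel_mem C _ _ _ (by rw [Subalgebra.mem_centralizer_iff]; simpa using hu)
      (by rw [Subalgebra.mem_centralizer_iff]; simpa using hv)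
  rw [Subalgebra.mem_centralizer_iff] at this
  exact this z rfl

theorem zt_zqm {l m : ℕ} (h : l + 1 < n) (h1 : m ≠ l) (h2 : m ≠ l + 1) :
    R.zt l * R.zq m = R.zq m * R.zt l := by
  refine R.ext_zE fun μ => ?_
  rw [R.zq_zt_zE h, vl_swm h h1 h2, mul_assoc, R.zq_zE, ← mul_assoc]
  have hg := R.zt_gm h h1 h2
  split_ifs
  · congr 1
    rw [mul_neg, neg_mul, ← mul_assoc, ← hg, mul_assoc, ← hg, mul_assoc]
  · congr 1
    exact Qel_comm_of _ _ (R.zt_zxm h h1 h2) (R.t_zt l).symm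

theorem zt_g0 {l : ℕ} (h : l + 1 < n) (μ : Fin n → I) :
    R.zt l * R.g l * R.zE μ
      = R.g (l + 1) * R.zt l * R.zE μ - R.g (l + 1) * R.g l * R.dD l μ :=
  tau_inv (R.g_zE l μ) (R.t_zE μ) (R.zx_zE l μ) (R.t_zt l)
    (R.cm_comm (R.g_cm l) (R.dD_cm l μ)) (R.g1 l) (R.g2 (l + 1)) (R.zt_zx0 h μ)

theorem zt_g1 {l : ℕ} (h : l + 1 < n) (μ : Fin n → I) :
    R.zt l * R.g (l + 1) * R.zE μ
      = R.g l * R.zt l * R.zE μ + R.g l * R.g (l + 1) * R.dD l μ := by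
  have := tau_inv (R.g_zE (l + 1) μ) (R.t_zE μ) (R.zx_zE (l + 1) μ) (R.t_zt l)
    (R.cm_comm (R.g_cm (l + 1)) (neg_mem (R.dD_cm l μ))) (R.g1 (l + 1)) (R.g2 l) (R.zt_zx1 h μ)
  rw [this]; noncomm_ring

theorem zh_zh_zE (l m : ℕ) (μ : Fin n → I) : R.zh l * R.zh m * R.zE μ =
    (if vl i μ l = i then R.g l else 0) * (if vl i μ m = i then R.g m else 0) * R.zE μ := by
  have h1 : (if vl i μ m = i then R.g m else 0) ∈ R.cm := by
    split_ifs; exacts [R.g_cm m, zero_mem _]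
  rw [mul_assoc, R.zh_zE, R.cm_comm h1 (R.zE_cm μ), ← mul_assoc, R.zh_zE, mul_assoc,
    R.cm_comm (R.zE_cm μ) h1, mul_assoc]

theorem zt_zh0 {l : ℕ} (h : l + 1 < n) :
    R.zt l * R.zh l = R.zh (l + 1) * R.zt l - R.zh l * R.zh (l + 1) := by
  refine R.ext_zE fun μ => ?_
  rw [sub_mul, R.zh_zt_zE h, vl_sw1 h, R.zh_zh_zE, mul_assoc, R.zh_zE, ← mul_assoc]
  by_cases h1 : vl i μ l = i
  · rw [if_pos h1, if_pos h1, R.zt_g0 h, dD]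
    by_cases h2 : vl i μ (l + 1) = i
    · rw [if_pos h2, if_pos (h1.trans h2.symm), R.g_g (l + 1) l]
    · rw [if_neg h2, if_neg (fun e => h2 (e.symm.trans h1))]; simp
  · simp [h1]

theorem zt_zh1 {l : ℕ} (h : l + 1 < n) :
    R.zt l * R.zh (l + 1) = R.zh l * R.zt l + R.zh l * R.zh (l + 1) := by
  refine R.ext_zE fun μ => ?_
  rw [add_mul, R.zh_zt_zE h, vl_sw0 h, R.zh_zh_zE, mul_assoc, R.zh_zE, ← mul_assoc]
  by_cases h1 : vl i μ (l + 1) = i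
  · rw [if_pos h1, if_pos h1, R.zt_g1 h, dD]
    by_cases h2 : vl i μ l = i
    · rw [if_pos h2, if_pos (h2.trans h1.symm)]
    · rw [if_neg h2, if_neg (fun e => h2 (e.trans h1))]; simp
  · simp [h1]

/-- correction term for `zq` -/
noncomputable def dd (l : ℕ) (μ : Fin n → I) : E :=
  if vl i μ l = vl i μ (l + 1) then
    (if vl i μ l = i then R.g l * R.g (l + 1) * R.g (l + 1) + R.g l * R.g l * R.g (l + 1)
      else - Qdiff C (vl i μ l) i (R.zx l) R.t (R.zx (l + 1))) * R.zE μ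
  else 0

theorem dd_cm (l : ℕ) (μ : Fin n → I) : R.dd l μ ∈ R.cm := by
  have g0 := R.g_cm l
  have g1 := R.g_cm (l + 1)
  unfold dd
  split_ifs
  · exact mul_mem (add_mem (mul_mem (mul_mem g0 g1) g1) (mul_mem (mul_mem g0 g0) g1)) (R.zE_cm μ)
  · exact mul_mem (neg_mem (R.Qdiff_cm _ _ (R.zx_cm _) R.t_cm (R.zx_cm _))) (R.zE_cm μ)
  · exact zero_mem _

theorem zt_gg0 {l : ℕ} (h : l + 1 < n) (μ : Fin n → I) :
    R.zt l * (R.g l * R.g l) * R.zE μ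
      = R.g (l + 1) * R.g (l + 1) * R.zt l * R.zE μ - (R.g l * R.g (l + 1) * R.g (l + 1)
        + R.g l * R.g l * R.g (l + 1)) * R.dD l μ := by
  have e1 : R.zt l * (R.g l * R.g l) * R.zE μ = (R.zt l * R.g l * R.zE μ) * R.g l := by
    rw [mul_assoc (R.zt l * R.g l), ← R.g_zE]; simp only [mul_assoc]
  have e2 : R.g (l + 1) * R.zt l * R.zE μ * R.g l = R.g (l + 1) * (R.zt l * R.g l * R.zE μ) := by
    rw [mul_assoc _ _ (R.g l), ← R.g_zE]; simp only [mul_assoc]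
  rw [e1, R.zt_g0 h, sub_mul, e2, R.zt_g0 h, mul_assoc _ _ (R.g l),
    R.cm_comm (R.dD_cm l μ) (R.g_cm l), mul_sub, R.g_g (l + 1) l, add_mul]
  have e3 : R.g (l + 1) * (R.g l * R.g (l + 1) * R.dD l μ)
    = R.g l * R.g (l + 1) * R.g (l + 1) * R.dD l μ := by
    rw [← mul_assoc, ← mul_assoc, R.g_g (l + 1) l]
  have e4 : R.g l * R.g (l + 1) * (R.g l * R.dD l μ)
    = R.g l * R.g l * R.g (l + 1) * R.dD l μ := by
    rw [← mul_assoc, mul_assoc (R.g l), R.g_g (l + 1) l, ← mul_assoc]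
  rw [e3, e4]
  simp only [mul_assoc]
  abel

theorem zt_gg1 {l : ℕ} (h : l + 1 < n) (μ : Fin n → I) :
    R.zt l * (R.g (l + 1) * R.g (l + 1)) * R.zE μ
      = R.g l * R.g l * R.zt l * R.zE μ + (R.g l * R.g (l + 1) * R.g (l + 1)
        + R.g l * R.g l * R.g (l + 1)) * R.dD l μ := by
  have e1 : R.zt l * (R.g (l + 1) * R.g (l + 1)) * R.zE μ
      = (R.zt l * R.g (l + 1) * R.zE μ) * R.g (l + 1) := by
    rw [mul_assoc (R.zt l * R.g (l + 1)), ← R.g_zE]; simp only [mul_assoc]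
  have e2 : R.g l * R.zt l * R.zE μ * R.g (l + 1) = R.g l * (R.zt l * R.g (l + 1) * R.zE μ) := by
    rw [mul_assoc _ _ (R.g (l + 1)), ← R.g_zE]; simp only [mul_assoc]
  rw [e1, R.zt_g1 h, add_mul, e2, R.zt_g1 h, mul_assoc _ _ (R.g (l + 1)),
    R.cm_comm (R.dD_cm l μ) (R.g_cm (l + 1)), mul_add, add_mul]
  simp only [mul_assoc]
  abel

theorem zt_zq0 {l : ℕ} (h : l + 1 < n) (μ : Fin n → I) :
    R.zt l * R.zq l * R.zE μ = R.zq (l + 1) * R.zt l * R.zE μ + R.dd l μ := by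
  rw [R.zq_zt_zE h, vl_sw1 h, mul_assoc, R.zq_zE, ← mul_assoc, dd]
  split_ifs with h1 h2 h3
  · rw [mul_neg, neg_mul, R.zt_gg0 h, dD, if_pos h2]; noncomm_ring
  · rw [mul_neg, neg_mul, R.zt_gg0 h, dD, if_neg h2]; noncomm_ring
  · rw [tau_Qel C _ _ (R.zx_zx l (l + 1)) (R.zx_zE l μ) (R.cm_comm (R.dD_cm l μ) (R.zx_cm l))
      (R.t_zE μ) (R.t_zt l) (R.cm_comm R.t_cm (R.dD_cm l μ)) (R.zt_zx0 h μ), dD, if_pos h3]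
    noncomm_ring
  · rw [tau_Qel C _ _ (R.zx_zx l (l + 1)) (R.zx_zE l μ) (R.cm_comm (R.dD_cm l μ) (R.zx_cm l))
      (R.t_zE μ) (R.t_zt l) (R.cm_comm R.t_cm (R.dD_cm l μ)) (R.zt_zx0 h μ), dD, if_neg h3]
    simp

theorem zt_zq1 {l : ℕ} (h : l + 1 < n) (μ : Fin n → I) :
    R.zt l * R.zq (l + 1) * R.zE μ = R.zq l * R.zt l * R.zE μ - R.dd l μ := by
  have hc := R.cm_comm (neg_mem (R.dD_cm l μ)) (R.zx_cm (l + 1))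
  have hc' := R.cm_comm R.t_cm (neg_mem (R.dD_cm l μ))
  rw [R.zq_zt_zE h, vl_sw0 h, mul_assoc, R.zq_zE, ← mul_assoc, dd]
  by_cases h0 : vl i μ l = vl i μ (l + 1)
  · rw [if_pos h0, h0]
    split_ifs with h1
    · rw [mul_neg, neg_mul, R.zt_gg1 h, dD, if_pos h0]; noncomm_ring
    · rw [tau_Qel C _ _ (R.zx_zx (l + 1) l) (R.zx_zE (l + 1) μ) hc
        (R.t_zE μ) (R.t_zt l) hc' (R.zt_zx1 h μ), dD, if_pos h0,
        Qdiff_comm C _ _ (R.zx_zx (l + 1) l)]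
      noncomm_ring
  · rw [if_neg h0]
    split_ifs with h1
    · rw [mul_neg, neg_mul, R.zt_gg1 h, dD, if_neg h0]; noncomm_ring
    · rw [tau_Qel C _ _ (R.zx_zx (l + 1) l) (R.zx_zE (l + 1) μ) hc
        (R.t_zE μ) (R.t_zt l) hc' (R.zt_zx1 h μ), dD, if_neg h0]
      simp

theorem zq_zq (l m : ℕ) : R.zq l * R.zq m = R.zq m * R.zq l := R.cm_comm (R.zq_cm l) (R.zq_cm m)
theorem zh_zh (l m : ℕ) : R.zh l * R.zh m = R.zh m * R.zh l := R.cm_comm (R.zh_cm l) (R.zh_cm m)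
theorem zh_zq (l m : ℕ) : R.zh l * R.zq m = R.zq m * R.zh l := R.cm_comm (R.zh_cm l) (R.zq_cm m)

theorem zt_zqq {l : ℕ} (h : l + 1 < n) :
    R.zt l * (R.zq l * R.zq (l + 1)) = R.zq l * R.zq (l + 1) * R.zt l := by
  refine R.ext_zE fun μ => ?_
  have e1 : R.zt l * (R.zq l * R.zq (l + 1)) * R.zE μ
      = (R.zt l * R.zq l * R.zE μ) * R.zq (l + 1) := by
    rw [mul_assoc _ (R.zE μ), R.cm_comm (R.zE_cm μ) (R.zq_cm _)]; simp only [mul_assoc]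
  have e2 : R.zq (l + 1) * R.zt l * R.zE μ * R.zq (l + 1)
      = R.zq (l + 1) * (R.zt l * R.zq (l + 1) * R.zE μ) := by
    rw [mul_assoc _ (R.zE μ), R.cm_comm (R.zE_cm μ) (R.zq_cm _)]; simp only [mul_assoc]
  rw [e1, R.zt_zq0 h, add_mul, e2, R.zt_zq1 h, mul_sub, R.cm_comm (R.dd_cm l μ) (R.zq_cm _),
    sub_add_cancel, R.zq_zq l (l + 1)]
  simp only [mul_assoc]

end RD
end Rep
end KLR


namespace KLR

section Rep

variable {k : Type} [Field k] {I : Type} [Fintype I] [DecidableEq I]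
variable {C : CartanDatum k I} {n : ℕ} {i : I} {E : Type} [Ring E] [Algebra k E]

/-- Remove the `a`-th entry. -/
def rm (a : ℕ) (ν : Fin (n + 1) → I) : Fin n → I :=
  fun b => ν (if b.val < a then b.castSucc else b.succ)

theorem vl_ext {m : ℕ} (i : I) {μ μ' : Fin m → I} (h : ∀ b, b < m → vl i μ b = vl i μ' b) :
    μ = μ' := by
  funext b
  have := h b b.isLt
  simpa [vl] using this

theorem vl_rm (a : ℕ) (ν : Fin (n + 1) → I) (b : ℕ) (hb : b < n) :
    vl i (rm a ν) b = vl i ν (if b < a then b else b + 1) := by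
  have h2 : (if b < a then b else b + 1) < n + 1 := by split_ifs <;> omega
  rw [vl, dif_pos hb, vl, dif_pos h2, rm]
  congr 1
  ext
  simp only
  split_ifs <;> rfl

theorem rm_inj {a : ℕ} {ν ν' : Fin (n + 1) → I} (ha : a ≤ n) (h1 : vl i ν a = vl i ν' a)
    (h2 : rm a ν = rm a ν') : ν = ν' := by
  refine vl_ext i fun b hb => ?_
  rcases lt_trichotomy b a with h | h | h
  · have : vl i (rm a ν) b = vl i (rm a ν') b := by rw [h2]
    rwa [vl_rm _ _ _ (by omega), vl_rm _ _ _ (by omega), if_pos h] at this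
  · rw [h, h1]
  · have : vl i (rm a ν) (b - 1) = vl i (rm a ν') (b - 1) := by rw [h2]
    rwa [vl_rm _ _ _ (by omega), vl_rm _ _ _ (by omega), if_neg (by omega), show b - 1 + 1 = b by omega] at this

theorem rm_sw_lt {a l : ℕ} (h : l + 1 < n + 1) (ha : a < l) (ν : Fin (n + 1) → I) :
    rm a (sw l ν) = sw (l - 1) (rm a ν) := by
  obtain ⟨i⟩ : Nonempty I := ⟨ν 0⟩
  refine vl_ext i fun b hb => ?_
  rw [vl_rm _ _ _ hb, vl_sw h _ _ (by split_ifs <;> omega), vl_sw (by omega) _ _ hb,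
    vl_rm _ _ _ (by rw [Equiv.swap_apply_def]; split_ifs <;> omega)]
  congr 1
  simp only [Equiv.swap_apply_def]
  split_ifs <;> omega

theorem rm_sw_gt {a l : ℕ} (h : l + 1 < n + 1) (ha : l + 1 < a) (ha' : a ≤ n)
    (ν : Fin (n + 1) → I) : rm a (sw l ν) = sw l (rm a ν) := by
  obtain ⟨i⟩ : Nonempty I := ⟨ν 0⟩
  refine vl_ext i fun b hb => ?_
  rw [vl_rm _ _ _ hb, vl_sw h _ _ (by split_ifs <;> omega), vl_sw (by omega) _ _ hb,
    vl_rm _ _ _ (by rw [Equiv.swap_apply_def]; split_ifs <;> omega)]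
  congr 1
  simp only [Equiv.swap_apply_def]
  split_ifs <;> omega

theorem rm_sw_0 {l : ℕ} (h : l + 1 < n + 1) (ν : Fin (n + 1) → I) :
    rm l (sw l ν) = rm (l + 1) ν := by
  obtain ⟨i⟩ : Nonempty I := ⟨ν 0⟩
  refine vl_ext i fun b hb => ?_
  rw [vl_rm _ _ _ hb, vl_sw h _ _ (by split_ifs <;> omega), vl_rm _ _ _ hb]
  congr 1
  simp only [Equiv.swap_apply_def]
  split_ifs <;> omega

theorem rm_sw_1 {l : ℕ} (h : l + 1 < n + 1) (ν : Fin (n + 1) → I) :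
    rm (l + 1) (sw l ν) = rm l ν := by
  obtain ⟨i⟩ : Nonempty I := ⟨ν 0⟩
  refine vl_ext i fun b hb => ?_
  rw [vl_rm _ _ _ hb, vl_sw h _ _ (by split_ifs <;> omega), vl_rm _ _ _ hb]
  congr 1
  simp only [Equiv.swap_apply_def]
  split_ifs <;> omega

theorem rm_eq {l : ℕ} {ν : Fin (n + 1) → I} (h : vl i ν l = vl i ν (l + 1)) :
    rm l ν = rm (l + 1) ν := by
  refine vl_ext i fun b hb => ?_
  rw [vl_rm _ _ _ hb, vl_rm _ _ _ hb]
  by_cases h1 : b < l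
  · rw [if_pos h1, if_pos (by omega)]
  · by_cases h2 : b = l
    · rw [if_neg (by omega), if_pos (by omega), h2, h]
    · rw [if_neg (by omega), if_neg (by omega)]

theorem rm_fin (a : Fin (n + 1)) (ν : Fin (n + 1) → I) : rm a ν = a.removeNth ν := by
  funext b
  simp only [rm, Fin.removeNth, Fin.succAbove, Fin.lt_def, Fin.val_castSucc]

namespace RD

variable (R : RD C n i E)

noncomputable def cE (a : ℕ) (ν : Fin (n + 1) → I) : E := if vl i ν a = i then R.zE (rm a ν) else 0

noncomputable def xv (a b : ℕ) : E := if b < a then R.zx b else if b = a then R.t else R.zx (b - 1)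

noncomputable def TT (l : ℕ) (F : ℕ → E) (a : ℕ) : E :=
  if a < l then R.zt (l - 1) * F a
  else if a = l then -(R.zh l * F l) + R.zq l * F (l + 1)
  else if a = l + 1 then F l + R.zh l * F (l + 1)
  else R.zt l * F a

theorem TT_lt {l a : ℕ} (h : a < l) (F : ℕ → E) : R.TT l F a = R.zt (l - 1) * F a := if_pos h
theorem TT_0 (l : ℕ) (F : ℕ → E) : R.TT l F l = -(R.zh l * F l) + R.zq l * F (l + 1) := by
  simp [TT]
theorem TT_1 (l : ℕ) (F : ℕ → E) : R.TT l F (l + 1) = F l + R.zh l * F (l + 1) := by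
  simp [TT]
theorem TT_gt {l a : ℕ} (h : l + 1 < a) (F : ℕ → E) : R.TT l F a = R.zt l * F a := by
  rw [TT, if_neg (by omega), if_neg (by omega), if_neg (by omega)]

theorem cE_cm (a : ℕ) (ν : Fin (n + 1) → I) : R.cE a ν ∈ R.cm := by
  unfold cE; split_ifs; exacts [R.zE_cm _, zero_mem _]

theorem xv_cm (a b : ℕ) : R.xv a b ∈ R.cm := by
  unfold xv; split_ifs; exacts [R.zx_cm _, R.t_cm, R.zx_cm _]

theorem mulW {a : ℕ} {ν : Fin (n + 1) → I} {X Y : E} (f : E)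
    (h : vl i ν a = i → X * R.zE (rm a ν) = Y * R.zE (rm a ν)) :
    X * (R.cE a ν * f) = Y * (R.cE a ν * f) := by
  unfold cE
  split_ifs with h1
  · rw [← mul_assoc, h h1, mul_assoc]
  · simp

theorem cE_mul (a : ℕ) (ha : a ≤ n) (ν ν' : Fin (n + 1) → I) :
    R.cE a ν * R.cE a ν' = if ν = ν' then R.cE a ν else 0 := by
  unfold cE
  by_cases h1 : vl i ν a = i
  · by_cases h2 : vl i ν' a = i
    · rw [if_pos h1, if_pos h2, R.zE_mul]
      by_cases h3 : ν = ν'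
      · rw [if_pos h3, if_pos (by rw [h3])]
      · rw [if_neg h3, if_neg (fun e => h3 (rm_inj ha (h1.trans h2.symm) e))]
    · rw [if_pos h1, if_neg h2, if_neg (fun e => h2 (by rw [← e, h1])), mul_zero]
  · simp [h1]

theorem sum_cE (a : Fin (n + 1)) : ∑ ν, R.cE a ν = 1 := by
  rw [← R.sum_zE, ← (Fin.insertNthEquiv (fun _ => I) a).sum_comp, Fintype.sum_prod_type,
    Finset.sum_eq_single i]
  · refine Finset.sum_congr rfl fun μ _ => ?_
    rw [cE, rm_fin, if_pos (by simp [vl])]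
    exact congrArg R.zE (funext fun b => by simp [Fin.removeNth])
  · intro b _ hb
    refine Finset.sum_eq_zero fun μ _ => ?_
    rw [cE, if_neg]
    simpa [vl, Nat.le_of_lt_succ a.isLt] using hb
  · simp

theorem zh_cE (l : ℕ) (hl : l < n) (ν : Fin (n + 1) → I) :
    R.zh l * R.cE l ν = R.zh l * R.cE (l + 1) ν := by
  by_cases h : vl i ν l = vl i ν (l + 1)
  · rw [cE, cE, rm_eq h, h]
  · rw [cE, cE]
    have e1 : vl i (rm l ν) l = vl i ν (l + 1) := by rw [vl_rm _ _ _ hl, if_neg (by omega)]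
    have e2 : vl i (rm (l + 1) ν) l = vl i ν l := by rw [vl_rm _ _ _ hl, if_pos (by omega)]
    split_ifs with h1 h2 h2
    · exact absurd (h1.trans h2.symm) h
    · rw [R.zh_zE, e1, if_neg h2]; simp
    · rw [R.zh_zE, e2, if_neg h1]; simp
    · simp

theorem cE_sw0 {l : ℕ} (hl : l + 1 < n + 1) (ν : Fin (n + 1) → I) :
    R.cE l (sw l ν) = R.cE (l + 1) ν := by
  rw [cE, cE, rm_sw_0 hl, vl_sw0 hl]

theorem cE_sw1 {l : ℕ} (hl : l + 1 < n + 1) (ν : Fin (n + 1) → I) :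
    R.cE (l + 1) (sw l ν) = R.cE l ν := by
  rw [cE, cE, rm_sw_1 hl, vl_sw1 hl]

theorem cE_lt {l a : ℕ} (hl : l + 1 < n + 1) (ha : a < l) (ν : Fin (n + 1) → I) :
    R.zt (l - 1) * R.cE a ν = R.cE a (sw l ν) * R.zt (l - 1) := by
  rw [cE, cE, rm_sw_lt hl ha, vl_swm hl (by omega) (by omega)]
  split_ifs
  · rw [R.zt_zE (by omega)]
  · simp

theorem cE_gt {l a : ℕ} (hl : l + 1 < n + 1) (ha : l + 1 < a) (ha' : a ≤ n)
    (ν : Fin (n + 1) → I) : R.zt l * R.cE a ν = R.cE a (sw l ν) * R.zt l := by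
  rw [cE, cE, rm_sw_gt hl ha ha', vl_swm hl (by omega) (by omega)]
  split_ifs
  · rw [R.zt_zE (by omega)]
  · simp

theorem TT_cE {l : ℕ} (hl : l + 1 < n + 1) (a : ℕ) (ha : a ≤ n) (ν : Fin (n + 1) → I) (F : ℕ → E) :
    R.TT l (fun b => R.cE b ν * F b) a = R.cE a (sw l ν) * R.TT l F a := by
  have c1 : ∀ b, R.zq l * R.cE b ν = R.cE b ν * R.zq l := fun b => R.cm_comm (R.zq_cm l) (R.cE_cm b ν)
  have c2 : ∀ b, R.zh l * R.cE b ν = R.cE b ν * R.zh l := fun b => R.cm_comm (R.zh_cm l) (R.cE_cm b ν)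
  have h1 := R.zh_cE l (by omega) ν
  rcases lt_trichotomy a l with h | h | h
  · rw [R.TT_lt h, R.TT_lt h, ← mul_assoc, R.cE_lt hl h, mul_assoc]
  · subst h
    rw [R.TT_0, R.TT_0, R.cE_sw0 hl, ← mul_assoc, ← mul_assoc, h1, c1, c2]
    noncomm_ring
  · rcases Nat.lt_or_ge (l + 1) a with h' | h'
    · rw [R.TT_gt h', R.TT_gt h', ← mul_assoc, R.cE_gt hl h' ha, mul_assoc]
    · obtain rfl : a = l + 1 := by omega
      rw [R.TT_1, R.TT_1, R.cE_sw1 hl, ← mul_assoc, ← h1, c2]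
      noncomm_ring

theorem TT_TT {l m : ℕ} (h : l + 1 < m) (hm : m < n) (a : ℕ) (ha : a ≤ n) (F : ℕ → E) :
    R.TT l (R.TT m F) a = R.TT m (R.TT l F) a := by
  have e1 : R.zt (m - 1) * R.zh l = R.zh l * R.zt (m - 1) :=
    R.zt_zhm (by omega) (by omega) (by omega)
  have e2 : R.zt (m - 1) * R.zq l = R.zq l * R.zt (m - 1) :=
    R.zt_zqm (by omega) (by omega) (by omega)
  have e3 : R.zt l * R.zh m = R.zh m * R.zt l :=
    R.zt_zhm (by omega) (by omega) (by omega)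
  have e4 : R.zt l * R.zq m = R.zq m * R.zt l :=
    R.zt_zqm (by omega) (by omega) (by omega)
  rcases lt_trichotomy a l with h1 | rfl | h1
  · rw [R.TT_lt h1, R.TT_lt (by omega), R.TT_lt (by omega), R.TT_lt h1, ← mul_assoc, ← mul_assoc,
      R.zt_zt (by omega)]
  · rw [R.TT_0, R.TT_lt (by omega), R.TT_lt (by omega), R.TT_lt (by omega), R.TT_0,
      ← mul_assoc, ← mul_assoc, ← e1, ← e2]
    noncomm_ring
  · rcases Nat.lt_or_ge (l + 1) a with h2 | h2
    · rw [R.TT_gt h2]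
      rcases lt_trichotomy a m with h3 | rfl | h3
      · rw [R.TT_lt h3, R.TT_lt h3, R.TT_gt h2, ← mul_assoc, ← mul_assoc, R.zt_zt (by omega)]
      · rw [R.TT_0, R.TT_0, R.TT_gt (by omega), R.TT_gt (by omega), ← mul_assoc, ← mul_assoc,
          ← e3, ← e4]
        noncomm_ring
      · rcases Nat.lt_or_ge (m + 1) a with h4 | h4
        · rw [R.TT_gt h4, R.TT_gt h4, R.TT_gt h2, ← mul_assoc, ← mul_assoc, R.zt_zt (by omega)]
        · obtain rfl : a = m + 1 := by omega
          rw [R.TT_1, R.TT_1, R.TT_gt (by omega), R.TT_gt (by omega), ← mul_assoc, ← e3]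
          noncomm_ring
    · obtain rfl : a = l + 1 := by omega
      rw [R.TT_1, R.TT_lt (by omega), R.TT_lt (by omega), R.TT_lt (by omega), R.TT_1,
        ← mul_assoc, ← e1]
      noncomm_ring

theorem xv_lt {a b : ℕ} (h : b < a) : R.xv a b = R.zx b := if_pos h
theorem xv_eq (a : ℕ) : R.xv a a = R.t := by simp [xv]
theorem xv_gt {a b : ℕ} (h : a < b) : R.xv a b = R.zx (b - 1) := by
  rw [xv, if_neg (by omega), if_neg (by omega)]

theorem hhq (l : ℕ) (μ : Fin n → I) :
    (R.zh l * R.zh l + R.zq l) * R.zE μ = Qel C (vl i μ l) i (R.zx l) R.t * R.zE μ := by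
  rw [add_mul, R.zh_zh_zE, R.zq_zE]
  split_ifs with h
  · simp [h, Qel]
  · simp

theorem TT_sq {l : ℕ} (hl : l < n) (a : ℕ) (ha : a ≤ n) (ν : Fin (n + 1) → I) (F : ℕ → E) :
    R.TT l (R.TT l (fun b => R.cE b ν * F b)) a =
      Qel C (vl i ν l) (vl i ν (l + 1)) (R.xv a l) (R.xv a (l + 1)) * (R.cE a ν * F a) := by
  rcases lt_trichotomy a l with h | rfl | h
  · rw [R.TT_lt h, R.TT_lt h, ← mul_assoc]
    refine R.mulW _ fun _ => ?_
    rw [R.zt_sq (by omega), R.xv_gt h, R.xv_gt (by omega), vl_rm _ _ _ (by omega),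
      vl_rm _ _ _ (by omega), if_neg (by omega), if_neg (by omega),
      show l - 1 + 1 = l by omega, Nat.add_sub_cancel]
  · rw [R.TT_0, R.TT_0, R.TT_1, R.xv_eq, R.xv_gt (by omega), Nat.add_sub_cancel,
      show ∀ x y : E, -(R.zh a * (-(R.zh a * x) + R.zq a * y)) + R.zq a * (x + R.zh a * y)
        = (R.zh a * R.zh a + R.zq a) * x + (R.zq a * R.zh a - R.zh a * R.zq a) * y by
        intro x y; noncomm_ring, R.zh_zq, sub_self, zero_mul, add_zero]
    refine R.mulW _ fun h1 => ?_
    rw [R.hhq, h1, vl_rm _ _ _ (by omega), if_neg (by omega), Qel_symm C _ _ (R.t_zx a).symm]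
  · rcases Nat.lt_or_ge (l + 1) a with h2 | h2
    · rw [R.TT_gt h2, R.TT_gt h2, ← mul_assoc]
      refine R.mulW _ fun _ => ?_
      rw [R.zt_sq (by omega), R.xv_lt h, R.xv_lt (by omega), vl_rm _ _ _ (by omega),
        vl_rm _ _ _ (by omega), if_pos (by omega), if_pos (by omega)]
    · obtain rfl : a = l + 1 := by omega
      rw [R.TT_1, R.TT_0, R.TT_1, R.xv_eq, R.xv_lt (by omega),
        show ∀ x y : E, -(R.zh l * x) + R.zq l * y + R.zh l * (x + R.zh l * y)
          = (R.zh l * R.zh l + R.zq l) * y by intro x y; noncomm_ring]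
      refine R.mulW _ fun h1 => ?_
      rw [R.hhq, h1, vl_rm _ _ _ (by omega), if_pos (by omega)]

end RD
end Rep
end KLR


namespace KLR

section Rep

variable {k : Type} [Field k] {I : Type} [Fintype I] [DecidableEq I]
variable {C : CartanDatum k I} {n : ℕ} {i : I} {E : Type} [Ring E] [Algebra k E]

theorem braid_ring {τ h1 h2 q1 q2 : E} (hh : h1 * h2 = h2 * h1) 
    (h12 : h1 * q2 = q2 * h1) (h21 : h2 * q1 = q1 * h2) (h22 : h2 * q2 = q2 * h2)
    (h11 : h1 * q1 = q1 * h1)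
    (a1 : τ * h1 = h2 * τ - h1 * h2) (a2 : τ * h2 = h1 * τ + h1 * h2)
    (a3 : τ * (q1 * q2) = q1 * q2 * τ) :
    (-(τ * h1 * τ) - h1 * τ * h1 + q1 * h2 = -(h2 * (τ * τ)) + (h1 * h1 + q1) * h2) ∧
    (-(τ * q1 * h2) + h1 * τ * q1 + q1 * h2 * h1 = 0) ∧
    (τ * q1 * q2 - q1 * q2 * τ = 0) ∧
    (-(h2 * τ) + τ * h1 + h1 * h2 = 0) ∧
    (-(h2 * h1 * q2) + q2 * τ * h2 - h1 * q2 * τ = 0) ∧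
    (-(h1 * h2) + h2 * τ - τ * h1 = 0) ∧
    (h1 * q2 + h2 * τ * h2 - τ * h2 * τ = h1 * (h2 * h2 + q2) - h1 * (τ * τ)) := by
  refine ⟨?_, ?_, ?_, ?_, ?_, ?_, ?_⟩
  · rw [mul_assoc h1, a1, mul_sub, hh]
    have : h1 * (h2 * h1) = h1 * h1 * h2 := by rw [← hh, mul_assoc]
    rw [this, ← mul_assoc h1, hh]
    noncomm_ring
  · have : h1 * τ = τ * h2 - h1 * h2 := by rw [a2]; abel
    have e2 : h1 * h2 * q1 = q1 * h2 * h1 := by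
      rw [mul_assoc, h21, ← mul_assoc, h11, mul_assoc, hh, ← mul_assoc]
    rw [this, sub_mul, mul_assoc τ q1, ← h21, e2, mul_assoc τ, h21]
    abel
  · rw [mul_assoc, a3, sub_self]
  · rw [a1]; abel
  · rw [h12, mul_assoc q2, a2, mul_assoc h2, h12, ← mul_assoc, h22, hh]
    noncomm_ring
  · rw [a1]; abel
  · rw [mul_assoc h2, a2]
    have : h2 * (h1 * h2) = h1 * (h2 * h2) := by rw [← mul_assoc, ← hh, mul_assoc]
    rw [mul_add, this, ← mul_assoc h2, ← hh]
    noncomm_ring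

theorem braid_rows {τ h1 h2 q1 q2 : E} (hh : h1 * h2 = h2 * h1)
    (h12 : h1 * q2 = q2 * h1) (h21 : h2 * q1 = q1 * h2) (h22 : h2 * q2 = q2 * h2)
    (h11 : h1 * q1 = q1 * h1)
    (a1 : τ * h1 = h2 * τ - h1 * h2) (a2 : τ * h2 = h1 * τ + h1 * h2)
    (a3 : τ * (q1 * q2) = q1 * q2 * τ) (F0 F1 F2 : E) :
    (τ * (-(h1 * (τ * F0)) + q1 * (-(h2 * F1) + q2 * F2))
      - (-(h1 * (τ * (-(h1 * F0) + q1 * F1))) + q1 * (-(h2 * (F0 + h1 * F1)) + q2 * (τ * F2)))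
      = (-(h2 * (τ * τ)) + (h1 * h1 + q1) * h2) * F0) ∧
    (-(h2 * (τ * F0 + h1 * (-(h2 * F1) + q2 * F2))) + q2 * (τ * (F1 + h2 * F2))
      - (τ * (-(h1 * F0) + q1 * F1) + h1 * (-(h2 * (F0 + h1 * F1)) + q2 * (τ * F2)))
      = (h2 * h1 * h2 + h1 * h2 * h1 + q2 * τ - τ * q1) * F1) ∧
    (τ * F0 + h1 * (-(h2 * F1) + q2 * F2) + h2 * (τ * (F1 + h2 * F2))
      - τ * (F0 + h1 * F1 + h2 * (τ * F2)) = (h1 * (h2 * h2 + q2) - h1 * (τ * τ)) * F2) := by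
  obtain ⟨b1, b2, b3, b4, b5, b6, b7⟩ := braid_ring hh h12 h21 h22 h11 a1 a2 a3
  refine ⟨?_, ?_, ?_⟩
  · rw [← b1, ← sub_eq_zero]
    have e : (-(τ * q1 * h2) + h1 * τ * q1 + q1 * h2 * h1) * F1
      + (τ * q1 * q2 - q1 * q2 * τ) * F2 = 0 := by rw [b2, b3]; simp
    rw [← e]; noncomm_ring
  · rw [← sub_eq_zero]
    have e : (-(h2 * τ) + τ * h1 + h1 * h2) * F0
      + (-(h2 * h1 * q2) + q2 * τ * h2 - h1 * q2 * τ) * F2 = 0 := by rw [b4, b5]; simp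
    rw [← e]; noncomm_ring
  · rw [← b7, ← sub_eq_zero]
    have e : (-(h1 * h2) + h2 * τ - τ * h1) * F1 = 0 := by rw [b6]; simp
    rw [← e]; noncomm_ring

theorem vl_rm_lt {a b : ℕ} (ν : Fin (n + 1) → I) (h : b < a) (hb : b < n) :
    vl i (rm a ν) b = vl i ν b := by rw [vl_rm _ _ _ hb, if_pos h]

theorem vl_rm_ge {a b : ℕ} (ν : Fin (n + 1) → I) (h : a ≤ b) (hb : b < n) :
    vl i (rm a ν) b = vl i ν (b + 1) := by rw [vl_rm _ _ _ hb, if_neg (by omega)]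

namespace RD

variable (R : RD C n i E)

theorem g_Qdiff (l : ℕ) (a b : I) {v : E} (hv : v ∈ R.cm) :
    R.g l * (Qel C a b R.t v - Qel C a b (R.zx l) v) = Qdiff C a b R.t v (R.zx l) := by
  rw [← Qdiff_mul C a b (R.t_zx l) (R.cm_comm hv R.t_cm) (R.cm_comm hv (R.zx_cm l)),
    R.cm_comm (R.g_cm l) (mul_mem (R.Qdiff_cm _ _ R.t_cm hv (R.zx_cm l))
      (sub_mem R.t_cm (R.zx_cm l))), mul_assoc, zx, R.g1, mul_one]

theorem row0 {l : ℕ} (hl : l + 1 < n) (μ : Fin n → I) :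
    (-(R.zh (l + 1) * (R.zt l * R.zt l)) + (R.zh l * R.zh l + R.zq l) * R.zh (l + 1)) * R.zE μ =
      if vl i μ (l + 1) = i then
        Qdiff C i (vl i μ l) R.t (R.zx l) (R.zx (l + 1)) * R.zE μ else 0 := by
  have hQ : ∀ b w, w ∈ R.cm → Qel C (vl i μ l) b (R.zx l) w ∈ R.cm := fun b w hw =>
    Qel_mem C _ _ _ (R.zx_cm l) hw
  have hz := R.zh_cm (l + 1)
  have e1 : (R.zh l * R.zh l + R.zq l) * R.zh (l + 1) * R.zE μ
      = Qel C (vl i μ l) i (R.zx l) R.t * (R.zh (l + 1) * R.zE μ) := by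
    rw [mul_assoc, R.cm_comm hz (R.zE_cm μ), ← mul_assoc, R.hhq, mul_assoc]
  have e2 : R.zh (l + 1) * (R.zt l * R.zt l) * R.zE μ
      = Qel C (vl i μ l) (vl i μ (l + 1)) (R.zx l) (R.zx (l + 1)) * (R.zh (l + 1) * R.zE μ) := by
    rw [mul_assoc, R.zt_sq hl, ← mul_assoc, R.cm_comm hz (hQ _ _ (R.zx_cm _)), mul_assoc]
  rw [add_mul, neg_mul, e1, e2, R.zh_zE]
  split_ifs with h
  · rw [h, ← R.g_Qdiff (l + 1) _ _ (R.zx_cm l), Qel_symm C i _ (R.t_zx l),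
      Qel_symm C i _ (R.zx_zx (l + 1) l), ← mul_assoc, ← mul_assoc,
      ← R.cm_comm (R.g_cm _) (hQ _ _ R.t_cm), ← R.cm_comm (R.g_cm _) (hQ _ _ (R.zx_cm _))]
    noncomm_ring
  · simp

theorem row2 {l : ℕ} (hl : l + 1 < n) (μ : Fin n → I) :
    (R.zh l * (R.zh (l + 1) * R.zh (l + 1) + R.zq (l + 1)) - R.zh l * (R.zt l * R.zt l)) * R.zE μ =
      if vl i μ l = i then
        Qdiff C i (vl i μ (l + 1)) (R.zx l) (R.zx (l + 1)) R.t * R.zE μ else 0 := by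
  have hQ1 : Qel C (vl i μ (l + 1)) i (R.zx (l + 1)) R.t ∈ R.cm := 
    Qel_mem C _ _ _ (R.zx_cm _) R.t_cm
  have hQ2 : Qel C (vl i μ l) (vl i μ (l + 1)) (R.zx l) (R.zx (l + 1)) ∈ R.cm := 
    Qel_mem C _ _ _ (R.zx_cm _) (R.zx_cm _)
  have hz := R.zh_cm l
  have e1 : R.zh l * (R.zh (l + 1) * R.zh (l + 1) + R.zq (l + 1)) * R.zE μ
      = Qel C (vl i μ (l + 1)) i (R.zx (l + 1)) R.t * (R.zh l * R.zE μ) := by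
    rw [mul_assoc, R.hhq, ← mul_assoc, R.cm_comm hz hQ1, mul_assoc]
  have e2 : R.zh l * (R.zt l * R.zt l) * R.zE μ
      = Qel C (vl i μ l) (vl i μ (l + 1)) (R.zx l) (R.zx (l + 1)) * (R.zh l * R.zE μ) := by
    rw [mul_assoc, R.zt_sq hl, ← mul_assoc, R.cm_comm hz hQ2, mul_assoc]
  rw [sub_mul, e1, e2, R.zh_zE]
  split_ifs with h
  · rw [Qdiff_comm C _ _ (R.t_zx l).symm, ← R.g_Qdiff l _ _ (R.zx_cm (l + 1)), ← mul_assoc,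
      ← mul_assoc, ← R.cm_comm (R.g_cm l) hQ1, ← R.cm_comm (R.g_cm l) hQ2, h,
      Qel_symm C i _ (R.t_zx (l + 1))]
    noncomm_ring
  · simp

theorem row1 {l : ℕ} (hl : l + 1 < n) (μ : Fin n → I) :
    (R.zh (l + 1) * R.zh l * R.zh (l + 1) + R.zh l * R.zh (l + 1) * R.zh l
      + R.zq (l + 1) * R.zt l - R.zt l * R.zq l) * R.zE μ =
      if vl i μ l = vl i μ (l + 1) then
        Qdiff C (vl i μ l) i (R.zx l) R.t (R.zx (l + 1)) * R.zE μ else 0 := by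
  have e0 : ∀ a b, R.zh a * R.zh b * R.zh a * R.zE μ = 
      (if vl i μ a = i then R.g a else 0) * (if vl i μ b = i then R.g b else 0)
        * (if vl i μ a = i then R.g a else 0) * R.zE μ := by
    intro a b
    have h1 : (if vl i μ a = i then R.g a else 0) ∈ R.cm := by
      split_ifs; exacts [R.g_cm _, zero_mem _]
    rw [mul_assoc, R.zh_zE, R.cm_comm h1 (R.zE_cm μ), ← mul_assoc, R.zh_zh_zE, mul_assoc,
      R.cm_comm (R.zE_cm μ) h1, mul_assoc]
    simp only [mul_assoc]
  rw [sub_mul, R.zt_zq0 hl, add_mul, add_mul, e0, e0, dd]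
  have c1 : R.g (l + 1) * R.g l * R.g (l + 1) = R.g l * R.g (l + 1) * R.g (l + 1) := by
    rw [R.g_g (l + 1) l]
  have c2 : R.g l * R.g (l + 1) * R.g l = R.g l * R.g l * R.g (l + 1) := by
    rw [mul_assoc, R.g_g (l + 1) l, mul_assoc]
  by_cases h : vl i μ l = vl i μ (l + 1)
  · rw [if_pos h, if_pos h, ← h]
    split_ifs with h2
    · rw [c1, c2, h2, Qdiff, if_pos rfl]; noncomm_ring
    · noncomm_ring
  · rw [if_neg h, if_neg h]
    by_cases h2 : vl i μ l = i
    · rw [if_neg (fun e => h (h2.trans e.symm))]; noncomm_ring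
    · rw [if_neg h2]; noncomm_ring

theorem TT_braid {l : ℕ} (hl : l + 2 ≤ n) (a : ℕ) (ha : a ≤ n) (ν : Fin (n + 1) → I) (F : ℕ → E) :
    R.TT (l + 1) (R.TT l (R.TT (l + 1) (fun b => R.cE b ν * F b))) a
      - R.TT l (R.TT (l + 1) (R.TT l (fun b => R.cE b ν * F b))) a =
      (if vl i ν l = vl i ν (l + 2) then
        Qdiff C (vl i ν l) (vl i ν (l + 1)) (R.xv a l) (R.xv a (l + 1)) (R.xv a (l + 2)) else 0)
          * (R.cE a ν * F a) := by
  obtain ⟨r0, r1, r2⟩ := braid_rows (R.zh_zh l (l + 1)) (R.zh_zq l (l + 1)) (R.zh_zq (l + 1) l)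
    (R.zh_zq (l + 1) (l + 1)) (R.zh_zq l l) (R.zt_zh0 (l := l) (by omega))
    (R.zt_zh1 (l := l) (by omega)) (R.zt_zqq (l := l) (by omega))
    (R.cE l ν * F l) (R.cE (l + 1) ν * F (l + 1)) (R.cE (l + 2) ν * F (l + 2))
  rcases Nat.lt_or_ge a l with h | h
  · simp only [R.TT_lt h, R.TT_lt (show a < l + 1 by omega), Nat.add_sub_cancel]
    obtain ⟨m, rfl⟩ : ∃ m, l = m + 1 := ⟨l - 1, by omega⟩
    rw [Nat.add_sub_cancel,
      show ∀ x y z : E, x * (y * (x * z)) - y * (x * (y * z)) = (x * y * x - y * x * y) * z by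
        intro x y z; noncomm_ring]
    refine R.mulW _ fun _ => ?_
    rw [R.zt_braid (by omega), vl_rm_ge _ (by omega) (by omega),
      vl_rm_ge _ (by omega) (by omega), vl_rm_ge _ (by omega) (by omega), R.xv_gt (by omega), R.xv_gt (by omega), R.xv_gt (by omega), ite_mul,
      zero_mul]
    rfl
  rcases Nat.lt_or_ge (l + 2) a with h2 | h2
  · simp only [R.TT_gt h2, R.TT_gt (show l + 1 < a by omega)]
    rw [show ∀ x y z : E, x * (y * (x * z)) - y * (x * (y * z)) = (x * y * x - y * x * y) * z by
        intro x y z; noncomm_ring]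
    refine R.mulW _ fun _ => ?_
    rw [R.zt_braid (by omega), vl_rm_lt _ (by omega) (by omega),
      vl_rm_lt _ (by omega) (by omega), vl_rm_lt _ (by omega) (by omega), R.xv_lt (by omega), R.xv_lt (by omega), R.xv_lt (by omega), ite_mul,
      zero_mul]
  have t1 : ∀ G, R.TT (l + 1) G l = R.zt l * G l := fun G => R.TT_lt (by omega) G
  have t2 : ∀ G, R.TT l G (l + 2) = R.zt l * G (l + 2) := fun G => R.TT_gt (by omega) G
  have t3 : ∀ G, R.TT (l + 1) G (l + 2) = G (l + 1) + R.zh (l + 1) * G (l + 2) := R.TT_1 (l + 1)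
  have t4 : ∀ G, R.TT (l + 1) G (l + 1)
    = -(R.zh (l + 1) * G (l + 1)) + R.zq (l + 1) * G (l + 2) := R.TT_0 (l + 1)
  have ha3 : a = l ∨ a = l + 1 ∨ a = l + 2 := by omega
  rcases ha3 with rfl | rfl | rfl
  · simp only [t1, t2, t3, t4, R.TT_0, R.TT_1]
    rw [r0]
    refine R.mulW _ fun h1 => ?_
    rw [R.row0 (by omega), vl_rm_ge _ (by omega) (by omega), vl_rm_ge _ (by omega) (by omega),
      R.xv_eq, R.xv_gt (by omega), R.xv_gt (by omega), h1, ite_mul, zero_mul]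
    simp only [eq_comm (a := i), Nat.add_sub_cancel, Nat.add_assoc, Nat.reduceAdd, Nat.add_succ_sub_one]
  · simp only [t1, t2, t3, t4, R.TT_0, R.TT_1]
    rw [r1]
    refine R.mulW _ fun h1 => ?_
    rw [R.row1 (by omega), vl_rm_lt _ (by omega) (by omega), vl_rm_ge _ (by omega) (by omega),
      R.xv_eq, R.xv_lt (by omega), R.xv_gt (by omega), h1, ite_mul, zero_mul]
    simp only [Nat.add_assoc, Nat.reduceAdd, Nat.add_succ_sub_one]
  · simp only [t1, t2, t3, t4, R.TT_0, R.TT_1]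
    rw [r2]
    refine R.mulW _ fun h1 => ?_
    rw [R.row2 (by omega), vl_rm_lt _ (by omega) (by omega), vl_rm_lt _ (by omega) (by omega),
      R.xv_eq, R.xv_lt (by omega), R.xv_lt (by omega), h1, ite_mul, zero_mul]
    by_cases h5 : vl i ν l = i
    · rw [if_pos h5, if_pos h5, h5]
    · rw [if_neg h5, if_neg h5]

theorem hx (l : ℕ) (μ : Fin n → I) :
    R.zh l * (R.t - R.zx l) * R.zE μ = (if vl i μ l = i then 1 else 0) * R.zE μ := by
  rw [mul_assoc, R.cm_comm (sub_mem R.t_cm (R.zx_cm l)) (R.zE_cm μ), ← mul_assoc, R.zh_zE, mul_assoc,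
    R.cm_comm (R.zE_cm μ) (sub_mem R.t_cm (R.zx_cm l)), ← mul_assoc]
  split_ifs
  · rw [zx, R.g2]
  · simp

theorem TT_x {l : ℕ} (hl : l < n) (m : ℕ) (hm : m ≤ n) (a : ℕ) (ha : a ≤ n) (ν : Fin (n + 1) → I)
    (F : ℕ → E) :
    R.TT l (fun b => R.xv b m * (R.cE b ν * F b)) a
      - R.xv a (Equiv.swap l (l + 1) m) * R.TT l (fun b => R.cE b ν * F b) a =
      (if m = l ∧ vl i ν l = vl i ν (l + 1) then -1 else
        if m = l + 1 ∧ vl i ν l = vl i ν (l + 1) then 1 else 0) * (R.cE a ν * F a) := by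
  have cq : ∀ b c, R.zq l * R.xv b c = R.xv b c * R.zq l := fun b c =>
    R.cm_comm (R.zq_cm l) (R.xv_cm b c)
  have ch : ∀ b c, R.zh l * R.xv b c = R.xv b c * R.zh l := fun b c =>
    R.cm_comm (R.zh_cm l) (R.xv_cm b c)
  rcases Nat.lt_or_ge a l with h | h
  · rw [R.TT_lt h, R.TT_lt h,
      show ∀ x y z w : E, x * (y * w) - z * (x * w) = (x * y - z * x) * w by intros; noncomm_ring]
    refine R.mulW _ fun _ => ?_
    rw [sub_mul]
    rcases lt_trichotomy m a with h1 | rfl | h1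
    · rw [Equiv.swap_apply_of_ne_of_ne (by omega) (by omega), R.xv_lt h1, R.zt_zx (by omega),
        Equiv.swap_apply_of_ne_of_ne (by omega) (by omega), if_neg (by omega), if_neg (by omega),
        if_neg (by omega), if_neg (by omega)]
      noncomm_ring
    · rw [Equiv.swap_apply_of_ne_of_ne (by omega) (by omega), R.xv_eq, R.t_zt,
        if_neg (by omega), if_neg (by omega)]
      noncomm_ring
    · have hs : Equiv.swap l (l + 1) m > a := by
        rw [Equiv.swap_apply_def]; split_ifs <;> omega
      have hs' : Equiv.swap l (l + 1) m - 1 = Equiv.swap (l - 1) (l - 1 + 1) (m - 1) := by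
        simp only [Equiv.swap_apply_def]; split_ifs <;> omega
      rw [R.xv_gt h1, R.xv_gt hs, hs', R.zt_zx (by omega), vl_rm_ge _ (by omega) (by omega),
        vl_rm_ge _ (by omega) (by omega),
        show l - 1 + 1 = l by omega]
      simp only [show (m - 1 = l - 1) ↔ (m = l) by omega, show (m - 1 = l) ↔ (m = l + 1) by omega]
      split_ifs <;> noncomm_ring
  rcases Nat.lt_or_ge (l + 1) a with h2 | h2
  · rw [R.TT_gt h2, R.TT_gt h2,
      show ∀ x y z w : E, x * (y * w) - z * (x * w) = (x * y - z * x) * w by intros; noncomm_ring]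
    refine R.mulW _ fun _ => ?_
    rw [sub_mul]
    rcases lt_trichotomy m a with h1 | rfl | h1
    · have hs : Equiv.swap l (l + 1) m < a := by
        rw [Equiv.swap_apply_def]; split_ifs <;> omega
      rw [R.xv_lt h1, R.xv_lt hs, R.zt_zx (by omega), vl_rm_lt _ (by omega) (by omega),
        vl_rm_lt _ (by omega) (by omega)]
      split_ifs <;> noncomm_ring
    · rw [Equiv.swap_apply_of_ne_of_ne (by omega) (by omega), R.xv_eq, R.t_zt,
        if_neg (by omega), if_neg (by omega)]
      noncomm_ring
    · rw [Equiv.swap_apply_of_ne_of_ne (by omega) (by omega), R.xv_gt h1, R.zt_zx (by omega),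
        Equiv.swap_apply_of_ne_of_ne (by omega) (by omega), if_neg (by omega), if_neg (by omega),
        if_neg (by omega), if_neg (by omega)]
      noncomm_ring
  have ha2 : a = l ∨ a = l + 1 := by omega
  have key0 : R.xv (l + 1) m = R.xv l (Equiv.swap l (l + 1) m) := by
    by_cases h1 : m = l
    · rw [h1, Equiv.swap_apply_left, R.xv_lt (by omega), R.xv_gt (by omega), Nat.add_sub_cancel]
    · by_cases h2 : m = l + 1
      · rw [h2, Equiv.swap_apply_right, R.xv_eq, R.xv_eq]
      · rw [Equiv.swap_apply_of_ne_of_ne h1 h2]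
        by_cases h3 : m < l
        · rw [R.xv_lt h3, R.xv_lt (by omega)]
        · rw [R.xv_gt (by omega), R.xv_gt (by omega)]
  have key1 : R.xv l m = R.xv (l + 1) (Equiv.swap l (l + 1) m) := by
    by_cases h1 : m = l
    · rw [h1, Equiv.swap_apply_left, R.xv_eq, R.xv_eq]
    · by_cases h2 : m = l + 1
      · rw [h2, Equiv.swap_apply_right, R.xv_gt (by omega), R.xv_lt (by omega), Nat.add_sub_cancel]
      · rw [Equiv.swap_apply_of_ne_of_ne h1 h2]
        by_cases h3 : m < l
        · rw [R.xv_lt h3, R.xv_lt (by omega)]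
        · rw [R.xv_gt (by omega), R.xv_gt (by omega)]
  have key2 : R.zh l * (R.xv (l + 1) m - R.xv l m) = 
      (if m = l then -1 else if m = l + 1 then 1 else 0) * (R.zh l * (R.t - R.zx l)) := by
    by_cases h1 : m = l
    · rw [h1, R.xv_eq, R.xv_lt (by omega), if_pos rfl]; noncomm_ring
    · by_cases h2 : m = l + 1
      · rw [h2, R.xv_eq, R.xv_gt (by omega), if_neg (by omega), if_pos rfl, Nat.add_sub_cancel]
        noncomm_ring
      · rw [if_neg h1, if_neg h2]
        have : R.xv (l + 1) m = R.xv l m := by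
          rw [key0, Equiv.swap_apply_of_ne_of_ne h1 h2]
        rw [this, sub_self]; noncomm_ring
  rcases ha2 with rfl | rfl
  · rw [R.TT_0, R.TT_0, ← key0,
      show ∀ A B X Y : E, -(R.zh a * (A * X)) + R.zq a * (B * Y)
        - B * (-(R.zh a * X) + R.zq a * Y) = (B * R.zh a - R.zh a * A) * X
          + (R.zq a * B - B * R.zq a) * Y by intros; noncomm_ring, cq, ← ch, sub_self,
      zero_mul, add_zero, ← mul_sub, key2]
    refine R.mulW _ fun h1 => ?_
    rw [mul_assoc, R.hx, vl_rm_ge _ (by omega) (by omega), h1]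
    simp only [eq_comm (a := i)]
    split_ifs <;> first | (exfalso; omega) | simp_all
  · rw [R.TT_1, R.TT_1, ← key1,
      show ∀ A B X Y : E, A * X + R.zh l * (B * Y)
        - A * (X + R.zh l * Y) = (R.zh l * B - A * R.zh l) * Y by intros; noncomm_ring, ← ch,
      ← mul_sub, key2]
    refine R.mulW _ fun h1 => ?_
    rw [mul_assoc, R.hx, vl_rm_lt _ (by omega) (by omega), h1]
    split_ifs <;> first | (exfalso; omega) | simp_all

end RD
end Rep
end KLR


namespace KLR

section Rep

variable {k : Type} [Field k] {I : Type} [Fintype I] [DecidableEq I]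
variable {C : CartanDatum k I} {n : ℕ} {i : I} {E : Type} [Ring E] [Algebra k E]

/-- Values of the lift on generators. -/
def genMap {A : Type} {n : ℕ} (fe : (Fin n → I) → A) (fx : Fin n → A)
    (ft : (l : ℕ) → l + 1 < n → A) : Gen I n → A
  | .e ν => fe ν
  | .x a => fx a
  | .tau l h => ft l h

theorem alg_lift {A : Type} [Ring A] [Algebra k A] {n : ℕ} (fe : (Fin n → I) → A) (fx : Fin n → A)
    (ft : (l : ℕ) → l + 1 < n → A)
    (ee : ∀ ν ν', fe ν * fe ν' = if ν = ν' then fe ν else 0)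
    (esum : ∑ ν, fe ν = 1)
    (xx : ∀ a b, fx a * fx b = fx b * fx a)
    (xe : ∀ a ν, fx a * fe ν = fe ν * fx a)
    (te : ∀ l h ν, ft l h * fe ν = fe (sw l ν) * ft l h)
    (tt : ∀ l h l' h', l + 1 < l' → ft l h * ft l' h' = ft l' h' * ft l h)
    (tsq : ∀ l h ν, ft l h * (ft l h * fe ν) = Qel C (ν ⟨l, Nat.lt_of_succ_lt h⟩) (ν ⟨l + 1, h⟩)
      (fx ⟨l, Nat.lt_of_succ_lt h⟩) (fx ⟨l + 1, h⟩) * fe ν)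
    (tx : ∀ l h m ν, ft l h * (fx m * fe ν)
      - fx (Equiv.swap (⟨l, Nat.lt_of_succ_lt h⟩ : Fin n) ⟨l + 1, h⟩ m) * (ft l h * fe ν)
      = (if m = ⟨l, Nat.lt_of_succ_lt h⟩ ∧ ν ⟨l, Nat.lt_of_succ_lt h⟩ = ν ⟨l + 1, h⟩ then
            -1
          else if m = (⟨l + 1, h⟩ : Fin n) ∧ ν ⟨l, Nat.lt_of_succ_lt h⟩ = ν ⟨l + 1, h⟩ then
            1
          else 0) * fe ν)
    (br : ∀ l (h2 : l + 2 < n) ν,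
      ft (l + 1) h2 * (ft l (Nat.lt_of_succ_lt h2) * (ft (l + 1) h2 * fe ν))
          - ft l (Nat.lt_of_succ_lt h2) * (ft (l + 1) h2 * (ft l (Nat.lt_of_succ_lt h2) * fe ν)) =
        (if ν ⟨l, Nat.lt_of_succ_lt (Nat.lt_of_succ_lt h2)⟩ = ν ⟨l + 2, h2⟩ then
            Qdiff C (ν ⟨l, Nat.lt_of_succ_lt (Nat.lt_of_succ_lt h2)⟩)
              (ν ⟨l + 1, Nat.lt_of_succ_lt h2⟩)
              (fx ⟨l, Nat.lt_of_succ_lt (Nat.lt_of_succ_lt h2)⟩)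
              (fx ⟨l + 1, Nat.lt_of_succ_lt h2⟩)
              (fx ⟨l + 2, h2⟩)
          else 0) * fe ν) :
    ∃ Φ : Alg C n →ₐ[k] A, (∀ ν, Φ (Ee C ν) = fe ν) ∧ (∀ a, Φ (Xx C a) = fx a) ∧
      ∀ l h, Φ (Tt C l h) = ft l h := by
  let F : FA k I n →ₐ[k] A := FreeAlgebra.lift k (genMap fe fx ft)
  have Fe : ∀ ν, F (ge k ν) = fe ν := fun ν => FreeAlgebra.lift_ι_apply _ _
  have Fx : ∀ ν, F (gx k ν) = fx ν := fun ν => FreeAlgebra.lift_ι_apply _ _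
  have Ft : ∀ l h, F (gt k l h) = ft l h := fun ν _ => FreeAlgebra.lift_ι_apply _ _
  have hF : ∀ ⦃x y⦄, Rel C n x y → F x = F y := by
    intro x y h
    cases h with
    | ee ν ν' => 
      rw [map_mul, Fe, Fe, ee]; split_ifs <;> simp [Fe]
    | esum => simp only [map_sum, Fe, esum, map_one]
    | xx a b => simp only [map_mul, Fx, xx a b]
    | xe a ν => simp only [map_mul, Fx, Fe, xe a ν]
    | taue l h ν => 
      simp only [map_mul, Ft, Fe, te]
      rw [sw, dif_pos h]
    | tautau l h l' h' h1 =>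
      simp only [map_mul, Ft]
      rcases h1 with h1 | h1
      · exact tt _ _ _ _ h1
      · exact (tt _ _ _ _ h1).symm
    | tausq l h ν => 
      rw [pow_two, map_mul, map_mul, map_mul, map_Qel, Ft, Fe, Fx, Fx, mul_assoc, tsq]
    | taux l h m ν =>
      rw [map_mul, map_sub, map_mul, map_mul, Ft, Fe, Fx, Fx, sub_mul, mul_assoc, mul_assoc, tx]
      split_ifs <;> simp [Fe]
    | braid l h ν => 
      rw [map_mul, map_sub, map_mul, map_mul, map_mul, map_mul, Ft, Fe, Ft, sub_mul, mul_assoc,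
        mul_assoc, mul_assoc, mul_assoc, br]
      split_ifs
      · rw [map_mul, map_Qdiff, Fe, Fx, Fx, Fx]
      · simp
  refine ⟨RingQuot.liftAlgHom (S := k) ⟨F, hF⟩, fun ν => ?_, fun ν => ?_, fun l h => ?_⟩
  · rw [Ee, RingQuot.liftAlgHom_mkAlgHom_apply, Fe]
  · rw [Xx, RingQuot.liftAlgHom_mkAlgHom_apply, Fx]
  · rw [Tt, RingQuot.liftAlgHom_mkAlgHom_apply, Ft]

/-- Extend a vector by zero. -/
def ev (f : Fin (n + 1) → E) (b : ℕ) : E := if h : b < n + 1 then f ⟨b, h⟩ else 0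

theorem ev_fin (f : Fin (n + 1) → E) (b : Fin (n + 1)) : ev f b = f b := by
  rw [ev, dif_pos b.isLt]

theorem ev_mul (f g : Fin (n + 1) → E) (b : ℕ) : ev (f * g) b = ev f b * ev g b := by
  unfold ev; split_ifs <;> simp

namespace RD

variable (R : RD C n i E)

theorem TT_add (l : ℕ) (F G : ℕ → E) (a : ℕ) : 
    R.TT l (fun b => F b + G b) a = R.TT l F a + R.TT l G a := by
  unfold TT; split_ifs <;> noncomm_ring

theorem TT_smul (l : ℕ) (c : k) (G : ℕ → E) (a : ℕ) : 
    R.TT l (fun b => c • G b) a = c • R.TT l G a := by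
  unfold TT; split_ifs <;> simp [smul_add]

theorem TT_congr {l : ℕ} (hl : l < n) {F G : ℕ → E} (h : ∀ a, a ≤ n → F a = G a) (a : ℕ) (ha : a ≤ n) :
    R.TT l F a = R.TT l G a := by
  unfold TT; rw [h a ha, h l (by omega), h (l + 1) (by omega)]

/-- The operator of `τ_l`. -/
noncomputable def opT (l : ℕ) : Module.End k (Fin (n + 1) → E) where
  toFun f := fun a => R.TT l (ev f) a
  map_add' f g := by
    funext a
    rw [Pi.add_apply, ← TT_add]
    congr 1
    funext b
    unfold ev; split_ifs <;> simp
  map_smul' c f := by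
    funext a
    rw [Pi.smul_apply, RingHom.id_apply, ← TT_smul]
    congr 1
    funext b
    unfold ev; split_ifs <;> simp

theorem ev_opT (l : ℕ) (f : Fin (n + 1) → E) (b : ℕ) (hb : b ≤ n) :
    ev (R.opT l f) b = R.TT l (ev f) b := by
  unfold ev
  rw [dif_pos (by omega)]
  rfl

theorem vec_ext {f g : Fin (n + 1) → E} (h : ∀ a, a ≤ n → ev f a = ev g a) : f = g := by
  funext a
  rw [← ev_fin f, ← ev_fin g, h _ (by omega)]

noncomputable def vE (ν : Fin (n + 1) → I) : Fin (n + 1) → E := fun a => R.cE a ν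
noncomputable def vX (m : ℕ) : Fin (n + 1) → E := fun a => R.xv a m

theorem ev_mk {F : ℕ → E} (a : ℕ) (ha : a ≤ n) : ev (fun b : Fin (n + 1) => F b) a = F a := by
  unfold ev; rw [dif_pos (by omega)]

theorem ev_sub (f g : Fin (n + 1) → E) (a : ℕ) : ev (f - g) a = ev f a - ev g a := by
  unfold ev; split_ifs <;> simp

theorem ev_neg (f : Fin (n + 1) → E) (a : ℕ) : ev (-f) a = - ev f a := by
  unfold ev; split_ifs <;> simp

theorem ev_zero (a : ℕ) : ev (0 : Fin (n + 1) → E) a = 0 := by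
  unfold ev; split_ifs <;> simp

theorem ev_vE (ν : Fin (n + 1) → I) (a : ℕ) (ha : a ≤ n) : ev (R.vE ν) a = R.cE a ν := 
  ev_mk (F := fun a => R.cE a ν) a ha

theorem ev_vX (m : ℕ) (a : ℕ) (ha : a ≤ n) : ev (R.vX m) a = R.xv a m := 
  ev_mk (F := fun a => R.xv a m) a ha

theorem ev_evalQ (p q : I) (u v : Fin (n + 1) → E) (a : ℕ) (ha : a ≤ n) :
    ev (Qel C p q u v) a = Qel C p q (ev u a) (ev v a) := by
  unfold ev; rw [dif_pos (by omega), dif_pos (by omega), dif_pos (by omega)]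
  exact map_Qel C (Pi.evalAlgHom k (fun _ : Fin (n + 1) => E) _) p q u v

theorem ev_evalD (p q : I) (u v w : Fin (n + 1) → E) (a : ℕ) (ha : a ≤ n) :
    ev (Qdiff C p q u v w) a = Qdiff C p q (ev u a) (ev v a) (ev w a) := by
  unfold ev; rw [dif_pos (by omega), dif_pos (by omega), dif_pos (by omega), dif_pos (by omega)]
  exact map_Qdiff C (Pi.evalAlgHom k (fun _ : Fin (n + 1) => E) _) p q u v w

theorem exists_Phi : ∃ Φ : Alg C (n + 1) →ₐ[k] Module.End k (Fin (n + 1) → E),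
    (∀ ν f a, Φ (Ee C ν) f a = R.cE a ν * f a) ∧ (∀ b f a, Φ (Xx C b) f a = R.xv a b * f a) ∧
      ∀ l h f a, Φ (Tt C l h) f a = R.TT l (ev f) a := by
  have hE : ∀ ν f a, a ≤ n → ev (R.vE ν * f) a = R.cE a ν * ev f a := fun ν f a ha => by
    rw [ev_mul, ev_vE _ _ _ ha]
  have hXE : ∀ (m : Fin (n + 1)) ν f a, a ≤ n → 
      ev (R.vX m * (R.vE ν * f)) a = R.xv a m * (R.cE a ν * ev f a) := fun m ν f a ha => by
    rw [ev_mul, ev_mul, ev_vE _ _ _ ha, ev_vX _ _ _ ha]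
  obtain ⟨Φ, h1, h2, h3⟩ := alg_lift (C := C) (fun ν => Algebra.lmul k (Fin (n + 1) → E) (R.vE ν))
    (fun b => Algebra.lmul k (Fin (n + 1) → E) (R.vX b)) (fun l _ => R.opT l)
    (by
      intro ν ν'
      rw [← map_mul]
      trans Algebra.lmul k (Fin (n + 1) → E) (if ν = ν' then R.vE ν else 0)
      · congr 1
        funext a
        rw [Pi.mul_apply, vE, vE, R.cE_mul _ (by omega)]
        split_ifs <;> rfl
      · split_ifs <;> simp)
    (by
      rw [← map_sum, ← map_one (Algebra.lmul k (Fin (n + 1) → E))]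
      congr 1
      funext a
      rw [Finset.sum_apply]
      exact R.sum_cE a)
    (by
      intro a b
      rw [← map_mul, ← map_mul]
      congr 1
      funext c
      exact R.cm_comm (R.xv_cm _ _) (R.xv_cm _ _))
    (by
      intro a b
      rw [← map_mul, ← map_mul]
      congr 1
      funext c
      exact R.cm_comm (R.xv_cm _ _) (R.cE_cm _ _))
    (by
      intro l h ν
      refine LinearMap.ext fun f => vec_ext fun a ha => ?_
      simp only [Module.End.mul_apply, Algebra.coe_lmul_eq_mul, LinearMap.mul_apply', ev_mul]
      rw [R.ev_opT _ _ _ ha, R.ev_opT _ _ _ ha, ev_vE _ _ _ ha, ← R.TT_cE h a ha,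
        R.TT_congr (by omega) (hE ν f) a ha])
    (by
      intro l h l' h' h1
      refine LinearMap.ext fun f => vec_ext fun a ha => ?_
      simp only [Module.End.mul_apply]
      rw [R.ev_opT _ _ _ ha, R.ev_opT _ _ _ ha, R.TT_congr (by omega) (R.ev_opT _ _) a ha,
        R.TT_congr (by omega) (R.ev_opT _ _) a ha, R.TT_TT h1 (by omega) a ha])
    (by
      intro l h ν
      refine LinearMap.ext fun f => vec_ext fun a ha => ?_
      rw [← map_Qel]
      simp only [Module.End.mul_apply, Algebra.coe_lmul_eq_mul, LinearMap.mul_apply', ev_mul]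
      rw [R.ev_opT _ _ _ ha, R.TT_congr (by omega) (R.ev_opT _ _) a ha,
        R.TT_congr (by omega) (fun b hb => R.TT_congr (by omega) (hE ν f) b hb) a ha,
        R.TT_sq (by omega) a ha, ev_evalQ _ _ _ _ _ ha, ev_vX _ _ _ ha, ev_vX _ _ _ ha,
        ev_vE _ _ _ ha]
      simp only [vl, dif_pos h, dif_pos (Nat.lt_of_succ_lt h)])
    (by
      intro l h m ν
      refine LinearMap.ext fun f => vec_ext fun a ha => ?_
      have hs : Equiv.swap l (l + 1) m < n + 1 := by
        rw [Equiv.swap_apply_def]; split_ifs <;> omega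
      have hm : ((Equiv.swap (⟨l, Nat.lt_of_succ_lt h⟩ : Fin (n + 1)) ⟨l + 1, h⟩ m : Fin (n + 1)) : ℕ)
          = Equiv.swap l (l + 1) (m : ℕ) := by
        have := swap_mk l h m m.isLt hs
        exact congrArg Fin.val this
      have key := R.TT_x (l := l) (by omega) m (by omega) a ha ν (ev f)
      rw [← R.TT_congr (by omega) (hE ν f) a ha] at key
      rw [LinearMap.sub_apply]
      simp only [Module.End.mul_apply, Algebra.coe_lmul_eq_mul, LinearMap.mul_apply']
      rw [ev_sub, R.ev_opT _ _ _ ha, ev_mul, R.ev_opT _ _ _ ha, ev_vX _ _ _ ha, hm,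
        R.TT_congr (by omega) (hXE m ν f) a ha, key]
      simp only [vl, dif_pos h, dif_pos (Nat.lt_of_succ_lt h), Fin.ext_iff]
      split_ifs <;> simp [← hE _ _ _ ha, ev_neg, ev_zero])
    (by
      intro l h ν
      refine LinearMap.ext fun f => vec_ext fun a ha => ?_
      have key := R.TT_braid (l := l) (by omega) a ha ν (ev f)
      rw [LinearMap.sub_apply]
      simp only [Module.End.mul_apply, Algebra.coe_lmul_eq_mul, LinearMap.mul_apply']
      rw [ev_sub, R.ev_opT _ _ _ ha, R.ev_opT _ _ _ ha, 
        R.TT_congr (by omega) (R.ev_opT _ _) a ha, R.TT_congr (by omega) (R.ev_opT _ _) a ha,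
        R.TT_congr (by omega) (fun b hb => R.TT_congr (by omega) (R.ev_opT _ _) b hb) a ha,
        R.TT_congr (by omega) (fun b hb => R.TT_congr (by omega) (R.ev_opT _ _) b hb) a ha,
        R.TT_congr (by omega) (fun b hb => R.TT_congr (by omega) (fun c hc => R.TT_congr (by omega) (hE ν f) c hc) b hb) a ha,
        R.TT_congr (l := l) (by omega) (fun b hb => R.TT_congr (l := l + 1) (by omega) (fun c hc => R.TT_congr (l := l) (by omega) (hE ν f) c hc) b hb) a ha,
        key]
      simp only [vl, dif_pos h, dif_pos (Nat.lt_of_succ_lt h), 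
        dif_pos (Nat.lt_of_succ_lt (Nat.lt_of_succ_lt h))]
      split_ifs
      · rw [← Algebra.coe_lmul_eq_mul, ← map_Qdiff]
        simp only [Algebra.coe_lmul_eq_mul, LinearMap.mul_apply', ev_mul]
        rw [ev_evalD _ _ _ _ _ _ ha, ev_vX _ _ _ ha, ev_vX _ _ _ ha, ev_vX _ _ _ ha, ev_vE _ _ _ ha]
      · simp [ev_zero])
  refine ⟨Φ, fun ν f a => ?_, fun b f a => ?_, fun l h f a => ?_⟩
  · rw [h1]; rfl
  · rw [h2]; rfl
  · rw [h3]; rfl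

end RD
end Rep
end KLR


namespace KLR

section Lifts

variable {k : Type} [Field k] {I : Type} [Fintype I] [DecidableEq I]
variable (C : CartanDatum k I) {n : ℕ} 

theorem toB_mk {β : I → ℕ} (z : FA k I n) : 
    toB C (β := β) (RingQuot.mkAlgHom k (Rel C n) z) = RingQuot.mkAlgHom k (URel C n β) z := by
  rw [toB, RingQuot.liftAlgHom_mkAlgHom_apply]

theorem toC_mk {Λ β : I → ℕ} (z : FA k I n) : 
    toC C (Λ := Λ) (RingQuot.mkAlgHom k (URel C n β) z) = RingQuot.mkAlgHom k (CRel C Λ n β) z := by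
  rw [toC, RingQuot.liftAlgHom_mkAlgHom_apply]

theorem toB_surj {β : I → ℕ} (z : bAlg C n β) : ∃ y, toB C y = z := by
  obtain ⟨w, rfl⟩ := RingQuot.mkAlgHom_surjective k _ z
  exact ⟨_, toB_mk C w⟩

theorem toC_surj {Λ β : I → ℕ} (z : cAlg C Λ n β) : ∃ y, toC C y = z := by
  obtain ⟨w, rfl⟩ := RingQuot.mkAlgHom_surjective k _ z
  exact ⟨_, toC_mk C w⟩

theorem toB_lift {β : I → ℕ} {A : Type} [Ring A] [Algebra k A] (Φ : Alg C n →ₐ[k] A) 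
    (h : Φ (eIdem C n β) = 1) : ∃ Φ' : bAlg C n β →ₐ[k] A, ∀ z, Φ' (toB C z) = Φ z := by
  have hF : ∀ ⦃x y⦄, URel C n β x y → (Φ.comp (RingQuot.mkAlgHom k (Rel C n))) x
      = (Φ.comp (RingQuot.mkAlgHom k (Rel C n))) y := by
    intro x y h
    cases h with
    | base h => simp only [AlgHom.comp_apply, RingQuot.mkAlgHom_rel k h]
    | unit => 
      simp only [AlgHom.comp_apply, map_sum, map_one]
      rw [← h, eIdem, map_sum]
      rfl
  refine ⟨RingQuot.liftAlgHom (S := k) ⟨_, hF⟩, fun z => ?_⟩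
  obtain ⟨w, rfl⟩ := RingQuot.mkAlgHom_surjective k _ z
  rw [toB_mk, RingQuot.liftAlgHom_mkAlgHom_apply]
  rfl

theorem toC_lift {Λ β : I → ℕ} {A : Type} [Ring A] [Algebra k A] (Φ : bAlg C n β →ₐ[k] A) 
    (h : Φ (aLam C Λ n β) = 0) : ∃ Φ' : cAlg C Λ n β →ₐ[k] A, ∀ z, Φ' (toC C z) = Φ z := by
  have hF : ∀ ⦃x y⦄, CRel C Λ n β x y → (Φ.comp (RingQuot.mkAlgHom k (URel C n β))) x
      = (Φ.comp (RingQuot.mkAlgHom k (URel C n β))) y := by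
    intro x y h
    cases h with
    | base h => simp only [AlgHom.comp_apply, RingQuot.mkAlgHom_rel k (URel.base h)]
    | unit => 
      simp only [AlgHom.comp_apply, RingQuot.mkAlgHom_rel k URel.unit]
    | cyc =>
      rw [map_zero, ← h]
      rfl
  refine ⟨RingQuot.liftAlgHom (S := k) ⟨_, hF⟩, fun z => ?_⟩
  obtain ⟨w, rfl⟩ := RingQuot.mkAlgHom_surjective k _ z
  rw [toC_mk, RingQuot.liftAlgHom_mkAlgHom_apply]
  rfl

theorem alg_induction {p : Alg C n → Prop} (h0 : p 0) (he : ∀ ν, p (Ee C ν)) (hx : ∀ a, p (Xx C a))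
    (ht : ∀ l h, p (Tt C l h)) (hadd : ∀ a b, p a → p b → p (a + b))
    (hmul : ∀ a b, p a → p b → p (a * b)) (hs : ∀ (c : k) a, p a → p (c • a)) (z : Alg C n) : p z := by
  have h1 : p 1 := by
    rw [← sum_Ee C]
    exact Finset.sum_induction _ p hadd h0 fun ν _ => he ν
  obtain ⟨w, rfl⟩ := RingQuot.mkAlgHom_surjective k _ z
  induction w using FreeAlgebra.induction with
  | grade0 r =>
    rw [AlgHom.commutes, Algebra.algebraMap_eq_smul_one]
    exact hs _ _ h1
  | grade1 x =>
    cases x with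
    | e ν => exact he ν
    | x a => exact hx a
    | tau l h => exact ht l h
  | mul a b ha hb => rw [map_mul]; exact hmul _ _ ha hb
  | add a b ha hb => rw [map_add]; exact hadd _ _ ha hb

theorem bAlg_induction {β : I → ℕ} {p : bAlg C n β → Prop} (h0 : p 0) (he : ∀ ν, p (toB C (Ee C ν)))
    (hx : ∀ a, p (toB C (Xx C a)))
    (ht : ∀ l h, p (toB C (Tt C l h))) (hadd : ∀ a b, p a → p b → p (a + b))
    (hmul : ∀ a b, p a → p b → p (a * b)) (hs : ∀ (c : k) a, p a → p (c • a)) (z : bAlg C n β) : p z := by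
  obtain ⟨w, rfl⟩ := toB_surj C z
  refine alg_induction C (p := fun w => p (toB C w)) (by rwa [map_zero]) he hx ht (fun a b ha hb => ?_)
    (fun a b ha hb => ?_) (fun c a ha => ?_) w
  · rw [map_add]; exact hadd _ _ ha hb
  · rw [map_mul]; exact hmul _ _ ha hb
  · rw [map_smul]; exact hs _ _ ha

theorem toB_eIdem (β : I → ℕ) : toB C (β := β) (eIdem C n β) = 1 := by
  have := RingQuot.mkAlgHom_rel k (URel.unit (C := C) (n := n) (β := β))
  rw [map_one, map_sum] at this
  rw [← this, eIdem, map_sum]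
  exact Finset.sum_congr rfl fun ν _ => toB_mk C _

theorem toB_Ee_zero {β : I → ℕ} {ν : Fin n → I} (h : ν ∉ seqs β n) : toB C (β := β) (Ee C ν) = 0 := by
  rw [← mul_one (toB C (Ee C ν)), ← toB_eIdem C β, ← map_mul, eIdem, Finset.mul_sum,
    Finset.sum_eq_zero, map_zero]
  intro μ hμ
  rw [Ee_mul, if_neg]
  rintro rfl
  exact h hμ

theorem eIdem_one {A : Type} [Ring A] [Algebra k A] {β : I → ℕ} (Φ : Alg C n →ₐ[k] A)
    (h : ∀ ν, ν ∉ seqs β n → Φ (Ee C ν) = 0) : Φ (eIdem C n β) = 1 := by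
  rw [← map_one Φ, ← sum_Ee C, eIdem, map_sum, map_sum]
  exact Finset.sum_subset (Finset.subset_univ _) fun ν _ hν => h ν hν

theorem content_rm (a : Fin (n + 1)) (ν : Fin (n + 1) → I) :
    content ν = addA (content (rm a ν)) (ν a) := by
  funext j
  unfold content addA
  rw [rm_fin]
  simp only [Finset.card_filter]
  rw [Fin.sum_univ_succAbove _ a, add_comm]
  congr 1
  simp only [eq_comm]

theorem addA_inj {β γ : I → ℕ} {i : I} (h : addA β i = addA γ i) : β = γ := by
  funext j
  have := congrFun h j
  simpa [addA] using this

theorem mem_seqs_rm {β : I → ℕ} {i : I} (a : Fin (n + 1)) {ν : Fin (n + 1) → I} (h : ν a = i) :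
    ν ∈ seqs (addA β i) (n + 1) ↔ rm a ν ∈ seqs β n := by
  simp only [seqs, Finset.mem_filter, Finset.mem_univ, true_and]
  rw [content_rm a ν, h]
  exact ⟨addA_inj, fun h => by rw [h]⟩

theorem RD.exists_PhiB {i : I} {E : Type} [Ring E] [Algebra k E] {C : CartanDatum k I}
    (R : RD C n i E) {β : I → ℕ} (hψ : ∀ μ, μ ∉ seqs β n → R.ψ (Ee C μ) = 0) :
    ∃ Φ : bAlg C (n + 1) (addA β i) →ₐ[k] Module.End k (Fin (n + 1) → E),
    (∀ ν f a, Φ (toB C (Ee C ν)) f a = R.cE a ν * f a) ∧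
      (∀ b f a, Φ (toB C (Xx C b)) f a = R.xv a b * f a) ∧
      ∀ l h f a, Φ (toB C (Tt C l h)) f a = R.TT l (ev f) a := by
  obtain ⟨Φ, h1, h2, h3⟩ := R.exists_Phi
  obtain ⟨Φ', h⟩ := toB_lift C (β := addA β i) Φ (eIdem_one C Φ fun ν hν => by
    refine LinearMap.ext fun f => funext fun a => ?_
    rw [h1, RD.cE, vl, dif_pos a.isLt]
    split_ifs with h4
    · rw [RD.zE, hψ _ (fun h5 => hν ((mem_seqs_rm a h4).2 h5)), zero_mul]; rfl
    · rw [zero_mul]; rfl)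
  refine ⟨Φ', fun ν f a => ?_, fun ν f a => ?_, fun l hl f a => ?_⟩
  · rw [h, h1]
  · rw [h, h2]
  · rw [h, h3]

end Lifts
end KLR


namespace KLR

section Hahn

variable {k : Type} [Field k] {I : Type} [Fintype I] [DecidableEq I]
variable {C : CartanDatum k I} {n : ℕ} {S : Type} [Ring S] [Algebra k S]

/-- The geometric series inverse to `t - x` with `t = T⁻¹`. -/
noncomputable def geo (x : S) : HahnSeries ℤ S :=
  HahnSeries.ofSuppBddBelow (fun m : ℤ => if 1 ≤ m then x ^ (m - 1).toNat else 0)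
    ⟨1, fun m hm => by by_contra h; exact hm (if_neg h)⟩

theorem geo_coeff (x : S) (m : ℤ) : (geo x).coeff m = if 1 ≤ m then x ^ (m - 1).toNat else 0 := rfl

/-- The variable `t`. -/
noncomputable def hT (S : Type) [Ring S] : HahnSeries ℤ S := HahnSeries.single (-1) 1

theorem hT_coeff (v : HahnSeries ℤ S) (m : ℤ) : (hT S * v).coeff m = v.coeff (m + 1) := by
  rw [hT, HahnSeries.coeff_single_mul, one_mul, sub_neg_eq_add]

theorem coeff_hT (v : HahnSeries ℤ S) (m : ℤ) : (v * hT S).coeff m = v.coeff (m + 1) := by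
  rw [hT, HahnSeries.coeff_mul_single, mul_one, sub_neg_eq_add]

theorem hT_comm (v : HahnSeries ℤ S) : hT S * v = v * hT S := by
  ext m; rw [hT_coeff, coeff_hT]

theorem hC_coeff (x : S) (v : HahnSeries ℤ S) (m : ℤ) : 
    (HahnSeries.C x * v).coeff m = x * v.coeff m := by
  rw [HahnSeries.C_apply, HahnSeries.coeff_single_zero_mul]

theorem coeff_hC (x : S) (v : HahnSeries ℤ S) (m : ℤ) : 
    (v * HahnSeries.C x).coeff m = v.coeff m * x := by
  rw [HahnSeries.C_apply, HahnSeries.coeff_mul_single_zero]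

theorem geo_aux (x : S) (m : ℤ) : (geo x).coeff (m + 1) - x * (geo x).coeff m = if m = 0 then 1 else 0 := by
  rw [geo_coeff, geo_coeff]
  rcases lt_trichotomy m 0 with h | rfl | h
  · rw [if_neg (by omega), if_neg (by omega), if_neg (by omega)]; simp
  · simp
  · rw [if_pos (by omega), if_pos (by omega), if_neg (by omega), ← pow_succ',
      show (m - 1).toNat + 1 = (m + 1 - 1).toNat by omega, sub_self]

theorem geo_comm (x : S) (m : ℤ) : (geo x).coeff m * x = x * (geo x).coeff m := by
  rw [geo_coeff]; split_ifs
  · rw [← pow_succ, ← pow_succ']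
  · simp

theorem geo_left (x : S) : (hT S - HahnSeries.C x) * geo x = 1 := by
  ext m
  rw [sub_mul, HahnSeries.coeff_sub, hT_coeff, hC_coeff, geo_aux, HahnSeries.coeff_one]
  split_ifs <;> rfl

theorem geo_right (x : S) : geo x * (hT S - HahnSeries.C x) = 1 := by
  ext m
  rw [mul_sub, HahnSeries.coeff_sub, coeff_hT, coeff_hC, geo_comm, geo_aux, HahnSeries.coeff_one]
  split_ifs <;> rfl

variable (k S) in
/-- The constants as an algebra homomorphism. -/
noncomputable def hC : S →ₐ[k] HahnSeries ℤ S where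
  __ := (HahnSeries.C : S →+* HahnSeries ℤ S)
  commutes' _ := HahnSeries.algebraMap_apply.symm

theorem hC_apply (x : S) : hC k S x = HahnSeries.C x := rfl

/-- The concrete data. -/
noncomputable def hRD (i : I) (ψ : Alg C n →ₐ[k] S) : RD C n i (HahnSeries ℤ S) where
  ψ := (hC k S).comp ψ
  t := hT S
  g l := geo (ψ (xN C n l))
  tc _ := hT_comm _
  g1 _ := geo_left _
  g2 _ := geo_right _

theorem hT_pow_coeff (v : HahnSeries ℤ S) (p : ℕ) (m : ℤ) :
    (hT S ^ p * v).coeff m = v.coeff (m + p) := by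
  induction p generalizing m with
  | zero => simp
  | succ p ih =>
    rw [pow_succ', mul_assoc, hT_coeff, ih]
    congr 1
    push_cast; ring

theorem hT_pow_inj {v : HahnSeries ℤ S} {p : ℕ} (h : hT S ^ p * v = 0) : v = 0 := by
  ext m
  have := hT_pow_coeff v p (m - p)
  rw [h] at this
  simpa using this.symm

theorem Qel_inj {i j : I} (hij : i ≠ j) (x : S) {v : HahnSeries ℤ S}
    (h : Qel C i j (hT S) (HahnSeries.C x) * v = 0) : v = 0 := by
  by_contra hv
  have hm : v.coeff v.order ≠ 0 := HahnSeries.coeff_order_eq_zero.not.2 hv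
  have hlt : ∀ m, m < v.order → v.coeff m = 0 := fun m h => HahnSeries.coeff_eq_zero_of_lt_order h
  set N := (-(C.a i j)).toNat with hN
  have hNz : (N : ℤ) = -(C.a i j) := by
    have := C.a_nonpos i j hij
    omega
  have h2 := congrArg (fun w => w.coeff (v.order - N)) h
  simp only [HahnSeries.coeff_zero] at h2
  have hterm : ∀ p q : ℕ, (hT S ^ p * (HahnSeries.C x) ^ q * v).coeff (v.order - N)
      = x ^ q * v.coeff (v.order - N + p) := by
    intro p q
    rw [mul_assoc, hT_pow_coeff, ← map_pow, hC_coeff]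
  unfold Qel at h2
  rw [if_neg hij, ← hN, Finset.sum_mul] at h2
  simp only [Finset.sum_mul] at h2
  rw [HahnSeries.coeff_sum] at h2
  simp only [HahnSeries.coeff_sum] at h2
  rw [Finset.sum_eq_single N, Finset.sum_eq_single 0, if_pos (by rw [hNz]; push_cast; ring)] at h2
  · rw [smul_mul_assoc, HahnSeries.coeff_smul, hterm, pow_zero, one_mul, sub_add_cancel,
      smul_eq_zero_iff_right (C.t_lead i j hij)] at h2
    exact hm h2
  · intro q _ hq
    rw [if_neg, zero_mul, HahnSeries.coeff_zero]
    intro h3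
    rw [hNz] at h3
    have h4 : C.d j * (q : ℤ) = 0 := by linarith
    rcases mul_eq_zero.1 h4 with h5 | h5
    · exact (C.d_pos j).ne' h5
    · exact hq (by exact_mod_cast h5)
  · intro h; simp at h
  · intro p hp hpN
    refine Finset.sum_eq_zero fun q _ => ?_
    have : p < N + 1 := Finset.mem_range.1 hp
    split_ifs
    · rw [smul_mul_assoc, HahnSeries.coeff_smul, hterm, hlt _ (by omega), mul_zero, smul_zero]
    · rw [zero_mul, HahnSeries.coeff_zero]
  · intro h; simp at h

theorem zq_inj (i : I) (ψ : Alg C n →ₐ[k] S) (l : ℕ) {v : HahnSeries ℤ S}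
    (h : (hRD i ψ).zq l * v = 0) : v = 0 := by
  set R := hRD i ψ with hR
  have key : ∀ μ, R.zE μ * v = 0 := by
    intro μ
    have h2 : R.zq l * R.zE μ * v = 0 := by
      rw [R.cm_comm (R.zq_cm l) (R.zE_cm μ), mul_assoc, h, mul_zero]
    rw [R.zq_zE, mul_assoc] at h2
    split_ifs at h2 with h3
    · have h4 : R.g l * (R.g l * (R.zE μ * v)) = 0 := by
        rw [neg_mul, neg_eq_zero, mul_assoc] at h2; exact h2
      have h5 : ∀ w, R.g l * w = 0 → w = 0 := fun w hw => by
        rw [← one_mul w, ← R.g1 l, mul_assoc, hw, mul_zero]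
      exact h5 _ (h5 _ h4)
    · rw [Qel_symm] at h2
      · exact Qel_inj (fun h => h3 h.symm) _ h2
      · exact R.cm_comm (R.zx_cm l) R.t_cm
  rw [← one_mul v, ← R.sum_zE, Finset.sum_mul]
  exact Finset.sum_eq_zero fun μ _ => key μ

end Hahn
end KLR


namespace KLR

open scoped TensorProduct

section KBasic

variable {k : Type} [Field k] {I : Type} [Fintype I] [DecidableEq I]
variable {C : CartanDatum k I} {n : ℕ} {Λ β : I → ℕ} {i : I}
  (φ : bAlg C n β →ₙₐ[k] bAlg C (n + 1) (addA β i))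

theorem KK_smul (b b' : bAlg C (n + 1) (addA β i)) (m : cAlg C Λ n β) :
    b' • KKmk C Λ n β i φ b m = KKmk C Λ n β i φ (b' * b) m := rfl

theorem KK_ksmul (c : k) (b : bAlg C (n + 1) (addA β i)) (m : cAlg C Λ n β) :
    c • KKmk C Λ n β i φ b m = KKmk C Λ n β i φ (c • b) m := rfl

theorem KK_add (b : bAlg C (n + 1) (addA β i)) (m m' : cAlg C Λ n β) :
    KKmk C Λ n β i φ b (m + m') = KKmk C Λ n β i φ b m + KKmk C Λ n β i φ b m' := by
  unfold KKmk OTmk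
  rw [TensorProduct.tmul_add, Submodule.Quotient.mk_add]

theorem KK_ksmul' (c : k) (b : bAlg C (n + 1) (addA β i)) (m : cAlg C Λ n β) :
    KKmk C Λ n β i φ b (c • m) = c • KKmk C Λ n β i φ b m := by
  rw [KK_ksmul]
  unfold KKmk OTmk
  rw [TensorProduct.tmul_smul, TensorProduct.smul_tmul']

theorem KK_bal (b : bAlg C (n + 1) (addA β i)) (r : bAlg C n β) (m : cAlg C Λ n β) :
    KKmk C Λ n β i φ (b * φ r) m = KKmk C Λ n β i φ b (toC C r * m) := by
  unfold KKmk OTmk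
  rw [Submodule.Quotient.eq]
  exact Submodule.subset_span ⟨b, r, m, rfl⟩

variable (Λ) in
/-- The map `m ↦ 1 ⊗ m`. -/
noncomputable def vK : cAlg C Λ n β →ₗ[k] KK C Λ n β i φ where
  toFun m := KKmk C Λ n β i φ 1 m
  map_add' m m' := KK_add φ 1 m m'
  map_smul' c m := KK_ksmul' φ c 1 m

theorem KK_vK (b : bAlg C (n + 1) (addA β i)) (m : cAlg C Λ n β) :
    KKmk C Λ n β i φ b m = b • vK Λ φ m := by
  show _ = b • KKmk C Λ n β i φ 1 m
  rw [KK_smul, mul_one]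

theorem vK_bal (r : bAlg C n β) (m : cAlg C Λ n β) : φ r • vK Λ φ m = vK Λ φ (toC C r * m) := by
  rw [← KK_vK]
  have := KK_bal φ 1 r m
  rw [one_mul] at this
  exact this

theorem KK_induction {p : KK C Λ n β i φ → Prop} (h : ∀ (b : bAlg C (n + 1) (addA β i)) m, p (b • vK Λ φ m))
    (hadd : ∀ x y, p x → p y → p (x + y)) (z : KK C Λ n β i φ) : p z := by
  obtain ⟨w, rfl⟩ := Submodule.Quotient.mk_surjective _ z
  induction w using TensorProduct.induction_on with
  | zero =>
    have := h 0 0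
    rw [zero_smul] at this
    exact this
  | tmul b m => 
    have := h b m
    rw [← KK_vK] at this
    exact this
  | add x y hx hy => 
    rw [Submodule.Quotient.mk_add]
    exact hadd _ _ hx hy

theorem KK_lift {N : Type} [AddCommGroup N] [Module k N] [Module (bAlg C (n + 1) (addA β i)) N]
    [IsScalarTower k (bAlg C (n + 1) (addA β i)) N] (v : cAlg C Λ n β →ₗ[k] N)
    (hv : ∀ r m, φ r • v m = v (toC C r * m)) :
    ∃ f : KK C Λ n β i φ →ₗ[bAlg C (n + 1) (addA β i)] N, ∀ (b : bAlg C (n + 1) (addA β i)) m, f (b • vK Λ φ m) = b • v m := by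
  let F : (bAlg C (n + 1) (addA β i)) ⊗[k] (cAlg C Λ n β) →ₗ[bAlg C (n + 1) (addA β i)] N :=
    TensorProduct.AlgebraTensorModule.lift
      ((LinearMap.ringLmapEquivSelf (bAlg C (n + 1) (addA β i)) k (cAlg C Λ n β →ₗ[k] N)).symm v)
  have hF : ∀ b m, F (b ⊗ₜ m) = b • v m := fun b m => rfl
  refine ⟨Submodule.liftQ _ F ?_, fun b m => ?_⟩
  · refine Submodule.span_le.2 ?_
    rintro _ ⟨b, r, m, rfl⟩
    rw [SetLike.mem_coe, LinearMap.mem_ker, map_sub, hF, hF, mul_smul, hv]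
    exact sub_self _
  · rw [← KK_vK]
    exact hF b m

theorem KK_hom_ext {N : Type} [AddCommGroup N] [Module (bAlg C (n + 1) (addA β i)) N]
    {f g : KK C Λ n β i φ →ₗ[bAlg C (n + 1) (addA β i)] N}
    (h : ∀ m, f (vK Λ φ m) = g (vK Λ φ m)) : f = g := by
  refine LinearMap.ext fun z => ?_
  induction z using KK_induction φ with
  | h b m => rw [map_smul, map_smul, h]
  | hadd x y hx hy => rw [map_add, map_add, hx, hy]

end KBasic
end KLR


namespace KLR

open scoped TensorProduct

section Sides

variable {k : Type} [Field k] {I : Type} [Fintype I] [DecidableEq I]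
variable {C : CartanDatum k I} {n : ℕ} {Λ β : I → ℕ} {i : I}
  {φ : bAlg C n β →ₙₐ[k] bAlg C (n + 1) (addA β i)}

instance : IsScalarTower k (bAlg C (n + 1) (addA β i)) (KK C Λ n β i φ) := by
  infer_instance

variable (Λ φ) in
/-- The span of `x₀^j ⊗ m`. -/
noncomputable def G0 (x0 : bAlg C (n + 1) (addA β i)) : Submodule k (KK C Λ n β i φ) :=
  Submodule.span k {z | ∃ (j : ℕ) (m : cAlg C Λ n β), z = x0 ^ j • vK Λ φ m}

theorem G0_of {x0 s : bAlg C (n + 1) (addA β i)} (h : ∀ (j : ℕ) (m : cAlg C Λ n β), s • (x0 ^ j • vK Λ φ m) ∈ G0 Λ φ x0) :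
    ∀ g ∈ G0 Λ φ x0, s • g ∈ G0 Λ φ x0 := by
  intro g hg
  unfold G0 at hg
  induction hg using Submodule.span_induction with
  | mem x hx =>
    obtain ⟨j, m, rfl⟩ := hx
    exact h j m
  | zero => rw [smul_zero]; exact zero_mem _
  | add x y _ _ hx hy => rw [smul_add]; exact add_mem hx hy
  | smul c x _ hx => rw [smul_algebra_smul_comm]; exact Submodule.smul_mem _ _ hx

theorem G0_stable {x0 s : bAlg C (n + 1) (addA β i)} (hc : s * x0 = x0 * s)
    (h : ∀ m : cAlg C Λ n β, ∃ m', s • vK Λ φ m = vK Λ φ m') :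
    ∀ g ∈ G0 Λ φ x0, s • g ∈ G0 Λ φ x0 := by
  refine G0_of fun j m => ?_
  obtain ⟨m', hm⟩ := h m
  have : s * x0 ^ j = x0 ^ j * s := (Commute.pow_right (a := s) (b := x0) hc j).eq
  rw [← mul_smul, this, mul_smul, hm]
  exact Submodule.subset_span ⟨j, m', rfl⟩

theorem G0_x0 {x0 : bAlg C (n + 1) (addA β i)} :
    ∀ g ∈ G0 Λ φ x0, x0 • g ∈ G0 Λ φ x0 := by
  refine G0_of fun j m => ?_
  rw [← mul_smul, ← pow_succ']
  exact Submodule.subset_span ⟨j + 1, m, rfl⟩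

theorem G0_v {x0 : bAlg C (n + 1) (addA β i)} (m : cAlg C Λ n β) : vK Λ φ m ∈ G0 Λ φ x0 := by
  refine Submodule.subset_span ⟨0, m, ?_⟩
  rw [pow_zero, one_smul]

theorem v_one (m : cAlg C Λ n β) : φ 1 • vK Λ φ m = vK Λ φ m := by
  rw [vK_bal, map_one, one_mul]

theorem one_eq_sum (β : I → ℕ) : (1 : bAlg C n β) = ∑ ν, toB C (Ee C ν) := by
  rw [← map_sum, sum_Ee, map_one]

theorem L_one (hφ : IsUpLb C i φ) : φ 1 = toB C (eL C n β i) := by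
  rw [one_eq_sum, map_sum]
  simp only [hφ.1]
  rw [eL, map_sum, Finset.sum_subset (s₂ := Finset.univ.filter fun ν : Fin (n + 1) → I => ν 0 = i)]
  · rw [Finset.sum_filter, ← (Fin.consEquiv (fun _ => I)).sum_comp, Fintype.sum_prod_type,
      Finset.sum_eq_single i]
    · simp [Fin.consEquiv]
    · intro j _ hj
      simp [Fin.consEquiv, hj]
    · simp
  · intro ν hν
    simp only [Finset.mem_filter, Finset.mem_univ, true_and] at hν ⊢
    exact hν.2
  · intro ν hν hν'
    simp only [Finset.mem_filter, Finset.mem_univ, true_and] at hν hν'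
    exact toB_Ee_zero C fun h => hν' ⟨h, hν⟩

theorem R_one (hφ : IsUpRb C i φ) : φ 1 = toB C (eR C n β i) := by
  rw [one_eq_sum, map_sum]
  simp only [hφ.1]
  rw [eR, map_sum, Finset.sum_subset (s₂ := Finset.univ.filter fun ν : Fin (n + 1) → I => ν (Fin.last n) = i)]
  · rw [Finset.sum_filter, ← (Fin.snocEquiv (fun _ => I)).sum_comp, Fintype.sum_prod_type,
      Finset.sum_eq_single i]
    · simp [Fin.snocEquiv]
    · intro j _ hj
      simp [Fin.snocEquiv, hj]
    · simp
  · intro ν hν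
    simp only [Finset.mem_filter, Finset.mem_univ, true_and] at hν ⊢
    exact hν.2
  · intro ν hν hν'
    simp only [Finset.mem_filter, Finset.mem_univ, true_and] at hν hν'
    exact toB_Ee_zero C fun h => hν' ⟨h, hν⟩

theorem toB_Ee_mul {γ : I → ℕ} (ν ν' : Fin n → I) : toB C (β := γ) (Ee C ν) * toB C (Ee C ν')
    = if ν = ν' then toB C (Ee C ν) else 0 := by
  rw [← map_mul, Ee_mul]; split_ifs <;> simp

theorem L_E (hφ : IsUpLb C i φ) (ν : Fin (n + 1) → I) (m : cAlg C Λ n β) :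
    ∃ m', toB C (n := n + 1) (β := addA β i) (Ee C ν) • vK Λ φ m = vK Λ φ m' := by
  by_cases h : ν 0 = i
  · refine ⟨toC C (toB C (Ee C (Fin.tail ν))) * m, ?_⟩
    have : (Fin.cons i (Fin.tail ν) : Fin (n + 1) → I) = ν := by rw [← h, Fin.cons_self_tail]
    rw [← vK_bal, hφ.1, this]
  · refine ⟨0, ?_⟩
    rw [map_zero, ← v_one m, ← mul_smul, L_one hφ, eL, map_sum, Finset.mul_sum, Finset.sum_eq_zero,
      zero_smul]
    intro μ hμ
    rw [toB_Ee_mul, if_neg]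
    rintro rfl
    exact h (Finset.mem_filter.1 hμ).2

theorem R_E (hφ : IsUpRb C i φ) (ν : Fin (n + 1) → I) (m : cAlg C Λ n β) :
    ∃ m', toB C (n := n + 1) (β := addA β i) (Ee C ν) • vK Λ φ m = vK Λ φ m' := by
  by_cases h : ν (Fin.last n) = i
  · refine ⟨toC C (toB C (Ee C (Fin.init ν))) * m, ?_⟩
    have : (Fin.snoc (Fin.init ν) i : Fin (n + 1) → I) = ν := by rw [← h, Fin.snoc_init_self]
    rw [← vK_bal, hφ.1, this]
  · refine ⟨0, ?_⟩
    rw [map_zero, ← v_one m, ← mul_smul, R_one hφ, eR, map_sum, Finset.mul_sum, Finset.sum_eq_zero,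
      zero_smul]
    intro μ hμ
    rw [toB_Ee_mul, if_neg]
    rintro rfl
    exact h (Finset.mem_filter.1 hμ).2

theorem L_X (hφ : IsUpLb C i φ) (a : Fin n) (m : cAlg C Λ n β) :
    toB C (n := n + 1) (β := addA β i) (Xx C a.succ) • vK Λ φ m = vK Λ φ (toC C (toB C (Xx C a)) * m) := by
  rw [← vK_bal, hφ.2.1, map_mul, ← L_one hφ, mul_smul, v_one]

theorem L_T (hφ : IsUpLb C i φ) (l : ℕ) (h : l + 1 < n) (m : cAlg C Λ n β) :
    toB C (n := n + 1) (β := addA β i) (Tt C (l + 1) (Nat.succ_lt_succ h)) • vK Λ φ m = vK Λ φ (toC C (toB C (Tt C l h)) * m) := by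
  rw [← vK_bal, hφ.2.2, map_mul, ← L_one hφ, mul_smul, v_one]

theorem R_X (hφ : IsUpRb C i φ) (a : Fin n) (m : cAlg C Λ n β) :
    toB C (n := n + 1) (β := addA β i) (Xx C a.castSucc) • vK Λ φ m = vK Λ φ (toC C (toB C (Xx C a)) * m) := by
  rw [← vK_bal, hφ.2.1, map_mul, ← R_one hφ, mul_smul, v_one]

theorem R_T (hφ : IsUpRb C i φ) (l : ℕ) (h : l + 1 < n) (m : cAlg C Λ n β) :
    toB C (n := n + 1) (β := addA β i) (Tt C l (Nat.lt_succ_of_lt h)) • vK Λ φ m = vK Λ φ (toC C (toB C (Tt C l h)) * m) := by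
  rw [← vK_bal, hφ.2.2, map_mul, ← R_one hφ, mul_smul, v_one]

end Sides
end KLR


namespace KLR

open scoped TensorProduct

section Weak

variable {k : Type} [Field k] {I : Type} [Fintype I] [DecidableEq I]
variable {C : CartanDatum k I} {n : ℕ} {Λ β : I → ℕ} {i : I}
  {φ : bAlg C n β →ₙₐ[k] bAlg C (n + 1) (addA β i)}

variable (C) in
/-- The image of `τ_l` (extended by zero) in `R(γ)`. -/
noncomputable def bT (n : ℕ) (γ : I → ℕ) (l : ℕ) : bAlg C (n + 1) γ := toB C (tN C (n + 1) l)

variable (C) in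
/-- The image of `x_b` (extended by zero) in `R(γ)`. -/
noncomputable def bX (n : ℕ) (γ : I → ℕ) (b : ℕ) : bAlg C (n + 1) γ := toB C (xN C (n + 1) b)

theorem bT_eq {γ : I → ℕ} {l : ℕ} (h : l + 1 < n + 1) : bT C n γ l = toB C (Tt C l h) := by
  rw [bT, tN, dif_pos h]

theorem bX_eq {γ : I → ℕ} {b : ℕ} (h : b < n + 1) : bX C n γ b = toB C (Xx C ⟨b, h⟩) := by
  rw [bX, xN, dif_pos h]

variable (C) in
/-- The image of the polynomial subalgebra. -/
def bPol (n : ℕ) (γ : I → ℕ) : Set (bAlg C (n + 1) γ) :=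
  (toB C (n := n + 1) (β := γ)).toRingHom '' (polAlg C (n + 1) : Set (Alg C (n + 1)))

theorem weakB (n : ℕ) (γ : I → ℕ) : WeakBase n (bT C n γ) (bX C n γ) (bPol C n γ) :=
  (weakBase_alg C n).map (toB C (n := n + 1) (β := γ)).toRingHom

theorem XX_comm {γ : I → ℕ} (a b : Fin (n + 1)) : toB C (β := γ) (Xx C a) * toB C (Xx C b)
    = toB C (Xx C b) * toB C (Xx C a) := by
  rw [← map_mul, Xx_comm, map_mul]

theorem EX_comm {γ : I → ℕ} (ν : Fin (n + 1) → I) (b : Fin (n + 1)) : toB C (β := γ) (Ee C ν) * toB C (Xx C b)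
    = toB C (Xx C b) * toB C (Ee C ν) := by
  rw [← map_mul, ← Xx_Ee, map_mul]

theorem TX_comm_alg {n : ℕ} (l : ℕ) (h : l + 1 < n) (b : Fin n) (h1 : (b : ℕ) ≠ l) (h2 : (b : ℕ) ≠ l + 1) :
    Tt C l h * Xx C b = Xx C b * Tt C l h := by
  rw [← sub_eq_zero, sum_mul_Ee C (_ - _)]
  refine Finset.sum_eq_zero fun ν _ => ?_
  have := Tt_Xx C l h b ν
  rw [Equiv.swap_apply_of_ne_of_ne (by simpa [Fin.ext_iff] using h1) (by simpa [Fin.ext_iff] using h2),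
    if_neg (fun hh => h1 (by rw [hh.1])), if_neg (fun hh => h2 (by rw [hh.1]))] at this
  exact this

theorem TX_comm {γ : I → ℕ} (l : ℕ) (h : l + 1 < n + 1) (b : Fin (n + 1)) (h1 : (b : ℕ) ≠ l) (h2 : (b : ℕ) ≠ l + 1) :
    toB C (β := γ) (Tt C l h) * toB C (Xx C b) = toB C (Xx C b) * toB C (Tt C l h) := by
  rw [← map_mul, TX_comm_alg l h b h1 h2, map_mul]

theorem weakL (hφ : IsUpLb C i φ) : WeakKLR n (bT C n (addA β i)) (bPol C n (addA β i))
    (G0 Λ φ (toB C (Xx C 0))).toAddSubgroup := by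
  refine (weakB n (addA β i)).weak _ ?_ ?_
  · rintro _ ⟨p, hp, rfl⟩
    refine polAlg_smul_mem C (toB C) (G0 Λ φ (toB C (Xx C 0))) ?_ ?_ p hp
    · intro ν
      exact G0_stable (EX_comm ν 0) (L_E hφ ν)
    · intro a
      refine Fin.cases ?_ (fun a => ?_) a
      · exact G0_x0
      · exact G0_stable (XX_comm _ _) fun m => ⟨_, L_X hφ a m⟩
  · intro l h1 hl
    obtain ⟨l, rfl⟩ := Nat.exists_eq_add_of_le' h1
    rw [bT_eq (by omega)]
    exact G0_stable (TX_comm _ _ _ (by simp) (by simp)) fun m => ⟨_, L_T hφ l (by omega) m⟩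

theorem weakR (hφ : IsUpRb C i φ) : WeakKLR n (fun l => bT C n (addA β i) (n - 1 - l)) (bPol C n (addA β i))
    (G0 Λ φ (toB C (Xx C (Fin.last n)))).toAddSubgroup := by
  refine (weakB n (addA β i)).mirror.weak _ ?_ ?_
  · rintro _ ⟨p, hp, rfl⟩
    refine polAlg_smul_mem C (toB C) (G0 Λ φ (toB C (Xx C (Fin.last n)))) ?_ ?_ p hp
    · intro ν
      exact G0_stable (EX_comm ν _) (R_E hφ ν)
    · intro a
      refine Fin.lastCases ?_ (fun a => ?_) a
      · exact G0_x0
      · exact G0_stable (XX_comm _ _) fun m => ⟨_, R_X hφ a m⟩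
  · intro l h1 hl
    rw [bT_eq (by omega)]
    exact G0_stable (TX_comm _ _ _ (by simp; omega) (by simp; omega))
      fun m => ⟨_, R_T hφ (n - 1 - l) (by omega) m⟩

theorem bPol_E {γ : I → ℕ} (ν : Fin (n + 1) → I) : toB C (Ee C ν) ∈ bPol C n γ := ⟨_, Ee_mem C ν, rfl⟩

theorem bPol_X {γ : I → ℕ} (b : Fin (n + 1)) : toB C (Xx C b) ∈ bPol C n γ := ⟨_, Xx_mem C b, rfl⟩

theorem bPol_alg {γ : I → ℕ} (c : k) : algebraMap k _ c ∈ bPol C n γ :=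
  ⟨algebraMap k _ c, Subalgebra.algebraMap_mem _ c, AlgHom.commutes _ _⟩

/-- A subgroup stable under generators is stable. -/
theorem stab_all {γ : I → ℕ} {V : Type} [AddCommGroup V] [Module (bAlg C (n + 1) γ) V] (H : AddSubgroup V)
    (hp : ∀ p ∈ bPol C n γ, ∀ v ∈ H, p • v ∈ H)
    (ht : ∀ l (h : l + 1 < n + 1), ∀ v ∈ H, toB C (β := γ) (Tt C l h) • v ∈ H)
    (b : bAlg C (n + 1) γ) : ∀ v ∈ H, b • v ∈ H := by
  refine bAlg_induction C (p := fun b => ∀ v ∈ H, b • v ∈ H) ?_ ?_ ?_ ?_ ?_ ?_ ?_ b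
  · intro v hv; rw [zero_smul]; exact zero_mem _
  · intro ν; exact hp _ (bPol_E ν)
  · intro a; exact hp _ (bPol_X a)
  · intro l h; exact ht l h
  · intro x y hx hy v hv; rw [add_smul]; exact add_mem (hx v hv) (hy v hv)
  · intro x y hx hy v hv; rw [mul_smul]; exact hx _ (hy v hv)
  · intro c x hx v hv; rw [Algebra.smul_def, mul_smul]; exact hp _ (bPol_alg c) _ (hx v hv)

theorem spanL (hφ : IsUpLb C i φ) (z : KK C Λ n β i φ) :
    z ∈ wSub (bT C n (addA β i)) (G0 Λ φ (toB C (Xx C 0))).toAddSubgroup (n + 1) := by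
  have W := weakL (Λ := Λ) hφ
  induction z using KK_induction φ with
  | h b m =>
    refine stab_all _ (fun p hp v hv => W.pol_stable le_rfl hp hv)
      (fun l h v hv => ?_) b _ ?_
    · rw [← bT_eq]; exact W.stable (by omega) hv
    · have := mem_wSub (T := bT C n (addA β i)) (Nat.zero_lt_succ n)
        (show vK Λ φ m ∈ (G0 Λ φ (toB C (Xx C 0))).toAddSubgroup from G0_v m)
      rwa [wProd, one_smul] at this
  | hadd x y hx hy => exact add_mem hx hy

theorem spanR (hφ : IsUpRb C i φ) (z : KK C Λ n β i φ) :
    z ∈ wSub (fun l => bT C n (addA β i) (n - 1 - l)) (G0 Λ φ (toB C (Xx C (Fin.last n)))).toAddSubgroup (n + 1) := by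
  have W := weakR (Λ := Λ) hφ
  induction z using KK_induction φ with
  | h b m =>
    refine stab_all _ (fun p hp v hv => W.pol_stable le_rfl hp hv)
      (fun l h v hv => ?_) b _ ?_
    · have := W.stable (l := n - 1 - l) (by omega) hv
      have e : n - 1 - (n - 1 - l) = l := by omega
      rwa [e, bT_eq h] at this
    · have := mem_wSub (T := fun l => bT C n (addA β i) (n - 1 - l)) (Nat.zero_lt_succ n)
        (show vK Λ φ m ∈ (G0 Λ φ (toB C (Xx C (Fin.last n)))).toAddSubgroup from G0_v m)
      rwa [wProd, one_smul] at this
  | hadd x y hx hy => exact add_mem hx hy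

end Weak
end KLR


namespace KLR

open scoped TensorProduct

section ALam

variable {k : Type} [Field k] {I : Type} [Fintype I] [DecidableEq I]
variable {C : CartanDatum k I} {n : ℕ} {Λ β : I → ℕ} {i : I}
  {φ : bAlg C n β →ₙₐ[k] bAlg C (n + 1) (addA β i)}

theorem aLam_eq (Λ γ : I → ℕ) : aLam C Λ (n + 1) γ
    = ∑ ν : Fin (n + 1) → I, toB C (Xx C 0) ^ Λ (ν 0) * toB C (Ee C ν) := by
  have h1 : aLam C Λ (n + 1) γ
      = ∑ ν ∈ seqs γ (n + 1), toB C (Xx C 0) ^ Λ (ν 0) * toB C (Ee C ν) := by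
    unfold aLam aLamF
    rw [dif_pos (Nat.succ_pos n), map_sum]
    refine Finset.sum_congr rfl fun ν _ => ?_
    rw [map_mul, map_pow, ← toB_mk, ← toB_mk]
    rfl
  rw [h1]
  refine Finset.sum_subset (Finset.subset_univ _) fun ν _ hν => ?_
  rw [toB_Ee_zero C hν, mul_zero]

theorem aLam_comm_X (Λ γ : I → ℕ) (b : Fin (n + 1)) :
    aLam C Λ (n + 1) γ * toB C (Xx C b) = toB C (Xx C b) * aLam C Λ (n + 1) γ := by
  rw [aLam_eq, Finset.sum_mul, Finset.mul_sum]
  refine Finset.sum_congr rfl fun ν _ => ?_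
  have : toB C (β := γ) (Xx C 0) ^ Λ (ν 0) * toB C (Xx C b) = toB C (Xx C b) * toB C (Xx C 0) ^ Λ (ν 0) :=
    (Commute.pow_left (XX_comm 0 b) _).eq
  rw [mul_assoc, EX_comm, ← mul_assoc, this, mul_assoc]

theorem aLam_comm_E (Λ γ : I → ℕ) (μ : Fin (n + 1) → I) :
    aLam C Λ (n + 1) γ * toB C (Ee C μ) = toB C (Ee C μ) * aLam C Λ (n + 1) γ := by
  rw [aLam_eq, Finset.sum_mul, Finset.mul_sum]
  refine Finset.sum_congr rfl fun ν _ => ?_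
  have : toB C (β := γ) (Ee C μ) * toB C (Xx C 0) ^ Λ (ν 0) = toB C (Xx C 0) ^ Λ (ν 0) * toB C (Ee C μ) :=
    (Commute.pow_right (EX_comm μ 0) _).eq
  rw [mul_assoc, ← mul_assoc _ _ (toB C (Ee C ν)), this, mul_assoc, toB_Ee_mul, toB_Ee_mul]
  by_cases h : ν = μ
  · subst h; simp
  · rw [if_neg h, if_neg (Ne.symm h)]

theorem aLam_comm_T (Λ γ : I → ℕ) (l : ℕ) (hl : 1 ≤ l) (h : l + 1 < n + 1) :
    aLam C Λ (n + 1) γ * toB C (Tt C l h) = toB C (Tt C l h) * aLam C Λ (n + 1) γ := by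
  rw [aLam_eq, Finset.sum_mul, Finset.mul_sum]
  have e : ∀ ν : Fin (n + 1) → I, toB C (β := γ) (Ee C ν) * toB C (Tt C l h) = toB C (Tt C l h)
      * toB C (Ee C (ν ∘ Equiv.swap (⟨l, Nat.lt_of_succ_lt h⟩ : Fin (n + 1)) ⟨l + 1, h⟩)) := by
    intro ν
    rw [← map_mul, E_mul_T, map_mul]
  rw [← (Equiv.arrowCongr (Equiv.swap (⟨l, Nat.lt_of_succ_lt h⟩ : Fin (n + 1)) ⟨l + 1, h⟩)
    (Equiv.refl I)).sum_comp]
  refine Finset.sum_congr rfl fun ν _ => ?_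
  have h0 : Equiv.swap (⟨l, Nat.lt_of_succ_lt h⟩ : Fin (n + 1)) ⟨l + 1, h⟩ 0 = 0 := by
    apply Equiv.swap_apply_of_ne_of_ne <;> simp [Fin.ext_iff]; omega
  have e1 : (Equiv.arrowCongr (Equiv.swap (⟨l, Nat.lt_of_succ_lt h⟩ : Fin (n + 1)) ⟨l + 1, h⟩)
    (Equiv.refl I)) ν = ν ∘ Equiv.swap (⟨l, Nat.lt_of_succ_lt h⟩ : Fin (n + 1)) ⟨l + 1, h⟩ := by
    ext a; simp
  have e2 : (ν ∘ Equiv.swap (⟨l, Nat.lt_of_succ_lt h⟩ : Fin (n + 1)) ⟨l + 1, h⟩) ∘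
      Equiv.swap (⟨l, Nat.lt_of_succ_lt h⟩ : Fin (n + 1)) ⟨l + 1, h⟩ = ν := by
    ext a; simp
  have e3 : ∀ j, toB C (β := γ) (Xx C 0) ^ j * toB C (Tt C l h) = toB C (Tt C l h) * toB C (Xx C 0) ^ j := fun j =>
    (Commute.pow_left (a := toB C (β := γ) (Xx C 0)) (TX_comm l h 0 (by simp; omega) (by simp)).symm j).eq
  rw [e1, mul_assoc, e, e2, Function.comp, h0, ← mul_assoc, e3, mul_assoc]

theorem R_E_snoc (hφ : IsUpRb C i φ) (μ : Fin n → I) (m : cAlg C Λ n β) :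
    toB C (n := n + 1) (β := addA β i) (Ee C (Fin.snoc μ i)) • vK Λ φ m = vK Λ φ (toC C (toB C (Ee C μ)) * m) := by
  rw [← vK_bal, hφ.1]

theorem R_E_ne (hφ : IsUpRb C i φ) (ν : Fin (n + 1) → I) (h : ν (Fin.last n) ≠ i) (m : cAlg C Λ n β) :
    toB C (n := n + 1) (β := addA β i) (Ee C ν) • vK Λ φ m = 0 := by
  rw [← v_one m, ← mul_smul, R_one hφ, eR, map_sum, Finset.mul_sum, Finset.sum_eq_zero,
      zero_smul]
  intro μ hμ
  rw [toB_Ee_mul, if_neg]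
  rintro rfl
  exact h (Finset.mem_filter.1 hμ).2

theorem R_X_pow (hφ : IsUpRb C i φ) (a : Fin n) (j : ℕ) (m : cAlg C Λ n β) :
    toB C (n := n + 1) (β := addA β i) (Xx C a.castSucc) ^ j • vK Λ φ m = vK Λ φ (toC C (toB C (Xx C a)) ^ j * m) := by
  induction j generalizing m with
  | zero => rw [pow_zero, pow_zero, one_smul, one_mul]
  | succ j ih => rw [pow_succ, mul_smul, R_X hφ, ih, pow_succ, mul_assoc]

theorem toC_aLam : toC C (Λ := Λ) (aLam C Λ n β) = 0 := by
  unfold aLam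
  rw [toC_mk, RingQuot.mkAlgHom_rel k CRel.cyc, map_zero]

theorem aLam_v (hφ : IsUpRb C i φ) (hn : 0 < n) (m : cAlg C Λ n β) :
    aLam C Λ (n + 1) (addA β i) • vK Λ φ m = 0 := by
  obtain ⟨n, rfl⟩ := Nat.exists_eq_add_of_le' hn
  have h0 : vK Λ φ (toC C (aLam C Λ (n + 1) β) * m) = 0 := by
    rw [toC_aLam, zero_mul, map_zero]
  rw [← h0, aLam_eq, aLam_eq, Finset.sum_smul, map_sum, Finset.sum_mul, map_sum,
    ← (Fin.snocEquiv (fun _ => I)).sum_comp, Fintype.sum_prod_type, Finset.sum_eq_single i]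
  · refine Finset.sum_congr rfl fun μ _ => ?_
    have e : (Fin.snocEquiv (fun _ : Fin (n + 1 + 1) => I)) (i, μ) = (Fin.snoc μ i : Fin (n + 1 + 1) → I) := rfl
    have e0 : (Fin.snoc μ i : Fin (n + 1 + 1) → I) 0 = μ 0 := by
      rw [← Fin.castSucc_zero, Fin.snoc_castSucc (α := fun _ => I)]
    rw [e, e0, mul_smul, R_E_snoc hφ, ← Fin.castSucc_zero, R_X_pow hφ, ← mul_assoc, ← map_pow (toC C), ← map_mul (toC C)]
  · intro j _ hj
    refine Finset.sum_eq_zero fun μ _ => ?_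
    rw [mul_smul, R_E_ne hφ, smul_zero]
    simpa [Fin.snocEquiv] using hj
  · simp

theorem aLam_G0 (hφ : IsUpRb C i φ) (hn : 0 < n) :
    ∀ g ∈ G0 Λ φ (toB C (Xx C (Fin.last n))), aLam C Λ (n + 1) (addA β i) • g = 0 := by
  intro g hg
  unfold G0 at hg
  induction hg using Submodule.span_induction with
  | mem x hx =>
    obtain ⟨j, m, rfl⟩ := hx
    have := (Commute.pow_right (aLam_comm_X Λ (addA β i) (Fin.last n) : Commute (aLam C Λ (n + 1) (addA β i)) _) j).eq
    rw [← mul_smul, this, mul_smul, aLam_v hφ hn, smul_zero]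
  | zero => rw [smul_zero]
  | add x y _ _ hx hy => rw [smul_add, hx, hy, add_zero]
  | smul c x _ hx => rw [smul_algebra_smul_comm, hx, smul_zero]

theorem aLam_wSub (hφ : IsUpRb C i φ) {v : KK C Λ n β i φ}
    (hv : v ∈ wSub (fun l => bT C n (addA β i) (n - 1 - l)) (G0 Λ φ (toB C (Xx C (Fin.last n)))).toAddSubgroup n) :
    aLam C Λ (n + 1) (addA β i) • v = 0 := by
  suffices h : ∀ b, b < n → aLam C Λ (n + 1) (addA β i) * wProd (fun l => bT C n (addA β i) (n - 1 - l)) b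
      = wProd (fun l => bT C n (addA β i) (n - 1 - l)) b * aLam C Λ (n + 1) (addA β i) by
    rw [← AddSubgroup.mem_bot]
    refine wSub_smul _ (fun b hb g hg => ?_) hv
    rw [AddSubgroup.mem_bot, ← mul_smul, h b hb, mul_smul, aLam_G0 hφ (by omega) g hg, smul_zero]
  intro b hb
  induction b with
  | zero => rw [wProd, one_mul, mul_one]
  | succ b ih =>
    rw [wProd, ← mul_assoc, bT_eq (by omega), aLam_comm_T _ _ _ (by omega), mul_assoc, ih (by omega), mul_assoc]

/-- The sequence obtained from `μ` by inserting `i` in position `l`. -/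
def ins (i : I) (μ : Fin n → I) (l : ℕ) : Fin (n + 1) → I := fun a =>
  if a.1 < l then vl i μ a else if a.1 = l then i else vl i μ (a - 1)

theorem ins_last (μ : Fin n → I) : ins i μ n = Fin.snoc μ i := by
  ext a
  refine Fin.lastCases ?_ (fun a => ?_) a
  · simp [ins]
  · simp [ins, vl]

theorem ins_zero (μ : Fin n → I) : ins i μ 0 = Fin.cons i μ := by
  ext a
  refine Fin.cases ?_ (fun a => ?_) a
  · simp [ins]
  · simp [ins, vl]

theorem ins_swap (μ : Fin n → I) (l : ℕ) (h : l + 1 < n + 1) :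
    ins i μ (l + 1) ∘ Equiv.swap (⟨l, Nat.lt_of_succ_lt h⟩ : Fin (n + 1)) ⟨l + 1, h⟩ = ins i μ l := by
  ext ⟨a, ha⟩
  simp only [Function.comp, Equiv.swap_apply_def, Fin.mk.injEq]
  split_ifs with h1 h2
  · subst h1; simp [ins]
  · subst h2; simp [ins]
  · simp only [ins]
    split_ifs <;> first | rfl | omega

theorem w_E (γ : I → ℕ) (μ : Fin n → I) (a : ℕ) (ha : a ≤ n) :
    toB C (Ee C (ins i μ (n - a))) * wProd (fun l => bT C n γ (n - 1 - l)) a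
      = wProd (fun l => bT C n γ (n - 1 - l)) a * toB C (Ee C (Fin.snoc μ i)) := by
  induction a with
  | zero => rw [wProd, mul_one, one_mul, Nat.sub_zero, ins_last]
  | succ a ih =>
    have hl : n - 1 - a + 1 < n + 1 := by omega
    rw [wProd, mul_assoc, ← ih (by omega), bT_eq hl, ← mul_assoc, ← mul_assoc, ← map_mul, ← map_mul,
      Tt_Ee]
    have e : n - a = n - 1 - a + 1 := by omega
    have e' : n - (a + 1) = n - 1 - a := by omega
    rw [e, ins_swap, e']

theorem tauProd_eq (γ : I → ℕ) : tauProd C n γ = wProd (fun l => bT C n γ (n - 1 - l)) n := by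
  suffices h : ∀ a (ha : a ≤ n), wProd (fun l => bT C n γ (n - 1 - l)) a
      = (List.ofFn (fun l : Fin a => toB C (Tt C (n - a + l.val) (by omega)))).prod by
    rw [h n le_rfl, tauProd]
    congr 3
    ext l
    congr 2
    omega
  intro a ha
  induction a with
  | zero => simp [wProd]
  | succ a ih =>
    rw [wProd, ih (by omega), List.ofFn_succ, List.prod_cons, bT_eq (by omega)]
    congr 2
    · congr 1
      simp; omega
    · congr 2
      ext l
      congr 2
      simp; omega

end ALam
end KLR


namespace KLR

open scoped TensorProduct

section PMap

variable {k : Type} [Field k] {I : Type} [Fintype I] [DecidableEq I]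
variable {C : CartanDatum k I} {n : ℕ} {Λ β : I → ℕ} {i : I}
  {φ0 φ1 : bAlg C n β →ₙₐ[k] bAlg C (n + 1) (addA β i)}

theorem ksc {φ : bAlg C n β →ₙₐ[k] bAlg C (n + 1) (addA β i)} (c : k) (b : bAlg C (n + 1) (addA β i))
    (z : KK C Λ n β i φ) : b • c • z = c • b • z := smul_algebra_smul_comm c b z

theorem cc_of_sub (hφ0 : IsUpRb C i φ0) {s s' : bAlg C (n + 1) (addA β i)} {g : KK C Λ n β i φ0}
    (hs : aLam C Λ (n + 1) (addA β i) * s = s * aLam C Λ (n + 1) (addA β i))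
    (h : s • wProd (fun l => bT C n (addA β i) (n - 1 - l)) n • g
      - wProd (fun l => bT C n (addA β i) (n - 1 - l)) n • s' • g
      ∈ wSub (fun l => bT C n (addA β i) (n - 1 - l)) (G0 Λ φ0 (toB C (Xx C (Fin.last n)))).toAddSubgroup n) :
    s • ccElt C Λ n β i • g = ccElt C Λ n β i • s' • g := by
  have h1 := aLam_wSub hφ0 h
  rw [smul_sub, sub_eq_zero, ← mul_smul, hs, mul_smul] at h1
  rw [ccElt, tauProd_eq, mul_smul, mul_smul]
  exact h1

theorem cc_X (hφ0 : IsUpRb C i φ0) (b : ℕ) (hb : b ≤ n) {g : KK C Λ n β i φ0}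
    (hg : g ∈ G0 Λ φ0 (toB C (Xx C (Fin.last n)))) :
    bX C n (addA β i) (n - b) • ccElt C Λ n β i • g
      = ccElt C Λ n β i • bX C n (addA β i) (n - if b < n then b + 1 else if b = n then 0 else b) • g := by
  refine cc_of_sub hφ0 ?_ ?_
  · rw [bX_eq (by omega)]; exact aLam_comm_X _ _ _
  · exact (weakR hφ0).shiftX (fun b => bX C n (addA β i) (n - b)) (weakB n (addA β i)).mirror.hX le_rfl hb hg

theorem cc_X_succ (hφ0 : IsUpRb C i φ0) (a : Fin n) {g : KK C Λ n β i φ0}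
    (hg : g ∈ G0 Λ φ0 (toB C (Xx C (Fin.last n)))) :
    toB C (n := n + 1) (β := addA β i) (Xx C a.succ) • ccElt C Λ n β i • g
      = ccElt C Λ n β i • toB C (n := n + 1) (β := addA β i) (Xx C a.castSucc) • g := by
  have h := cc_X hφ0 (n - 1 - a) (by omega) hg
  have e : n - (n - 1 - a) = a + 1 := by omega
  have e' : (n - if n - 1 - a < n then n - 1 - a + 1 else if n - 1 - a = n then 0 else n - 1 - a) = (a : ℕ) := by
    rw [if_pos (by omega)]; omega
  rw [e, e', bX_eq (by omega), bX_eq (by omega)] at h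
  exact h

theorem cc_X_zero (hφ0 : IsUpRb C i φ0) {g : KK C Λ n β i φ0}
    (hg : g ∈ G0 Λ φ0 (toB C (Xx C (Fin.last n)))) :
    toB C (n := n + 1) (β := addA β i) (Xx C 0) • ccElt C Λ n β i • g
      = ccElt C Λ n β i • toB C (n := n + 1) (β := addA β i) (Xx C (Fin.last n)) • g := by
  have h := cc_X hφ0 n le_rfl hg
  have e' : (n - if n < n then n + 1 else if n = n then 0 else n) = n := by simp
  rw [e', Nat.sub_self, bX_eq (by omega), bX_eq (by omega)] at h
  exact h

theorem cc_T (hφ0 : IsUpRb C i φ0) (l : ℕ) (h : l + 1 < n) {g : KK C Λ n β i φ0}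
    (hg : g ∈ G0 Λ φ0 (toB C (Xx C (Fin.last n)))) :
    toB C (n := n + 1) (β := addA β i) (Tt C (l + 1) (Nat.succ_lt_succ h)) • ccElt C Λ n β i • g
      = ccElt C Λ n β i • toB C (n := n + 1) (β := addA β i) (Tt C l (Nat.lt_succ_of_lt h)) • g := by
  refine cc_of_sub hφ0 (aLam_comm_T _ _ _ (by omega) _) ?_
  have := (weakR hφ0).shift (l := n - 2 - l) (by omega) le_rfl hg
  have e1 : n - 1 - (n - 2 - l) = l + 1 := by omega
  have e2 : n - 1 - (n - 2 - l + 1) = l := by omega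
  rw [e1, e2, bT_eq (Nat.succ_lt_succ h), bT_eq (Nat.lt_succ_of_lt h)] at this
  exact wSub_mono (by omega) this

theorem cc_E (μ : Fin n → I) : toB C (Ee C (Fin.cons i μ)) * ccElt C Λ n β i
    = ccElt C Λ n β i * toB C (Ee C (Fin.snoc μ i)) := by
  have := w_E (C := C) (i := i) (addA β i) μ n le_rfl
  rw [Nat.sub_self, ins_zero] at this
  rw [ccElt, tauProd_eq, ← mul_assoc, ← aLam_comm_E, mul_assoc, this, mul_assoc]

theorem cc_bal_E (hφ0 : IsUpRb C i φ0) (hφ1 : IsUpLb C i φ1) (μ : Fin n → I) (m : cAlg C Λ n β) :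
    φ1 (toB C (Ee C μ)) • ccElt C Λ n β i • vK Λ φ0 m
      = ccElt C Λ n β i • vK Λ φ0 (toC C (toB C (Ee C μ)) * m) := by
  rw [hφ1.1, ← mul_smul, cc_E, mul_smul, R_E_snoc hφ0]

theorem cc_bal_one (hφ0 : IsUpRb C i φ0) (hφ1 : IsUpLb C i φ1) (m : cAlg C Λ n β) :
    φ1 1 • ccElt C Λ n β i • vK Λ φ0 m = ccElt C Λ n β i • vK Λ φ0 m := by
  rw [one_eq_sum, map_sum, Finset.sum_smul, Finset.sum_congr rfl fun μ _ => cc_bal_E hφ0 hφ1 μ m,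
    ← Finset.smul_sum, ← map_sum, ← Finset.sum_mul, ← map_sum, ← one_eq_sum, map_one, one_mul]

theorem cc_bal (hφ0 : IsUpRb C i φ0) (hφ1 : IsUpLb C i φ1) (r : bAlg C n β) : ∀ (m : cAlg C Λ n β),
    φ1 r • ccElt C Λ n β i • vK Λ φ0 m = ccElt C Λ n β i • vK Λ φ0 (toC C r * m) := by
  refine bAlg_induction C (p := fun r => ∀ m : cAlg C Λ n β,
    φ1 r • ccElt C Λ n β i • vK Λ φ0 m = ccElt C Λ n β i • vK Λ φ0 (toC C r * m)) ?_ ?_ ?_ ?_ ?_ ?_ ?_ r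
  · intro m; rw [map_zero, map_zero, zero_smul, zero_mul, map_zero, smul_zero]
  · intro μ m; exact cc_bal_E hφ0 hφ1 μ m
  · intro a m
    rw [hφ1.2.1, map_mul, ← L_one hφ1, mul_smul, cc_bal_one hφ0 hφ1, cc_X_succ hφ0 a (G0_v m), R_X hφ0]
  · intro l h m
    rw [hφ1.2.2, map_mul, ← L_one hφ1, mul_smul, cc_bal_one hφ0 hφ1, cc_T hφ0 l h (G0_v m), R_T hφ0]
  · intro a b ha hb m
    rw [map_add, map_add, add_smul, ha, hb, add_mul, map_add, smul_add]
  · intro a b ha hb m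
    rw [map_mul, map_mul (toC C), mul_smul, hb, ha, mul_assoc]
  · intro c a ha m
    rw [map_smul, map_smul, smul_assoc, ha, smul_mul_assoc, map_smul]
    exact (ksc c _ _).symm

theorem exists_P (hφ0 : IsUpRb C i φ0) (hφ1 : IsUpLb C i φ1) :
    ∃ P : KK C Λ n β i φ1 →ₗ[bAlg C (n + 1) (addA β i)] KK C Λ n β i φ0,
      ∀ (b : bAlg C (n + 1) (addA β i)) m, P (b • vK Λ φ1 m) = b • ccElt C Λ n β i • vK Λ φ0 m := by
  refine KK_lift φ1 (N := KK C Λ n β i φ0)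
    ⟨⟨fun m => ccElt C Λ n β i • vK Λ φ0 m, fun a b => ?_⟩, fun c m => ?_⟩ (cc_bal hφ0 hφ1)
  · rw [map_add, smul_add]
  · simp only [map_smul]
    exact ksc c _ _

end PMap
end KLR


namespace KLR

open scoped TensorProduct

section PiMap

variable {k : Type} [Field k] {I : Type} [Fintype I] [DecidableEq I]
variable {C : CartanDatum k I} {n : ℕ} {Λ β : I → ℕ} {i : I}
  {φ0 φ1 : bAlg C n β →ₙₐ[k] bAlg C (n + 1) (addA β i)}
  {φc : cAlg C Λ n β →ₙₐ[k] cAlg C Λ (n + 1) (addA β i)}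

theorem phi_compat (hφ0 : IsUpRb C i φ0) (hφc : IsUpRc C Λ i φc) (r : bAlg C n β) :
    toC C (φ0 r) = φc (toC C r) := by
  refine bAlg_induction C (p := fun r => toC C (φ0 r) = φc (toC C r)) ?_ ?_ ?_ ?_ ?_ ?_ ?_ r
  · simp only [map_zero]
  · intro ν; rw [hφ0.1]; exact (hφc.1 ν).symm
  · intro a; rw [hφ0.2.1]; exact (hφc.2.1 a).symm
  · intro l h; rw [hφ0.2.2]; exact (hφc.2.2 l h).symm
  · intro a b ha hb; simp only [map_add, ha, hb]
  · intro a b ha hb; simp only [map_mul, ha, hb]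
  · intro c a ha; simp only [map_smul, ha]

theorem phic_one (hφ0 : IsUpRb C i φ0) (hφc : IsUpRc C Λ i φc) : φc 1 = eRc C Λ n β i := by
  rw [← map_one (toC C), ← phi_compat hφ0 hφc, R_one hφ0]; rfl

theorem exists_pi (hφ0 : IsUpRb C i φ0) (hφc : IsUpRc C Λ i φc) :
    ∃ pi : KK C Λ n β i φ0 →ₗ[bAlg C (n + 1) (addA β i)] cAlg C Λ (n + 1) (addA β i),
      ∀ (b : bAlg C (n + 1) (addA β i)) m, pi (b • vK Λ φ0 m) = toC C b * φc m := by
  refine KK_lift φ0 (N := cAlg C Λ (n + 1) (addA β i))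
    ⟨⟨fun m => φc m, fun a b => map_add _ _ _⟩, fun c m => map_smul _ _ _⟩ ?_
  intro r m
  show toC C (φ0 r) * φc m = φc (toC C r * m)
  rw [phi_compat hφ0 hφc, map_mul]

theorem K_form (z : KK C Λ n β i φ0) : ∃ b : bAlg C (n + 1) (addA β i), z = b • vK Λ φ0 1 := by
  induction z using KK_induction φ0 with
  | h b m =>
    obtain ⟨r, rfl⟩ := toC_surj C m
    exact ⟨b * φ0 r, by rw [mul_smul, vK_bal, mul_one]⟩
  | hadd x y hx hy =>
    obtain ⟨b, rfl⟩ := hx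
    obtain ⟨b', rfl⟩ := hy
    exact ⟨b + b', by rw [add_smul]⟩

theorem X_pow_G0 (j : ℕ) (m : cAlg C Λ n β) : toB C (n := n + 1) (β := addA β i) (Xx C (Fin.last n)) ^ j • vK Λ φ0 m
    ∈ G0 Λ φ0 (toB C (Xx C (Fin.last n))) := Submodule.subset_span ⟨j, m, rfl⟩

theorem cc_X_pow (hφ0 : IsUpRb C i φ0) (j : ℕ) (m : cAlg C Λ n β) :
    toB C (n := n + 1) (β := addA β i) (Xx C 0) ^ j • ccElt C Λ n β i • vK Λ φ0 m
      = ccElt C Λ n β i • toB C (n := n + 1) (β := addA β i) (Xx C (Fin.last n)) ^ j • vK Λ φ0 m := by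
  induction j with
  | zero => rw [pow_zero, pow_zero, one_smul, one_smul]
  | succ j ih =>
    rw [pow_succ', mul_smul, ih, cc_X_zero hφ0 (X_pow_G0 j m), pow_succ', mul_smul]

theorem ksa {φ : bAlg C n β →ₙₐ[k] bAlg C (n + 1) (addA β i)} (c : k) (z : KK C Λ n β i φ) :
    c • z = algebraMap k (bAlg C (n + 1) (addA β i)) c • z := (algebraMap_smul _ c z).symm

theorem aLam_range (hφ0 : IsUpRb C i φ0)
    (P : KK C Λ n β i φ1 →ₗ[bAlg C (n + 1) (addA β i)] KK C Λ n β i φ0)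
    (hP : ∀ (b : bAlg C (n + 1) (addA β i)) m, P (b • vK Λ φ1 m) = b • ccElt C Λ n β i • vK Λ φ0 m)
    (z : KK C Λ n β i φ0) : aLam C Λ (n + 1) (addA β i) • z ∈ LinearMap.range P := by
  refine wSub_smul (H := (LinearMap.range P).toAddSubgroup) _ (fun b hb g hg => ?_) (spanR hφ0 z)
  rcases Nat.lt_succ_iff_lt_or_eq.1 hb with h | h
  · rw [aLam_wSub hφ0 (mem_wSub h hg)]
    exact zero_mem _
  · subst h
    rw [← mul_smul, ← tauProd_eq]
    change ccElt C Λ b β i • g ∈ LinearMap.range P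
    have hg' : g ∈ G0 Λ φ0 (toB C (Xx C (Fin.last b))) := hg
    clear hg
    unfold G0 at hg'
    induction hg' using Submodule.span_induction with
    | mem x hx =>
      obtain ⟨j, m, rfl⟩ := hx
      rw [← cc_X_pow hφ0, ← hP]
      exact ⟨_, rfl⟩
    | zero => rw [smul_zero]; exact zero_mem _
    | add x y _ _ hx hy => rw [smul_add]; exact add_mem hx hy
    | smul c x _ hx =>
      rw [ksc, ksa]
      exact Submodule.smul_mem _ _ hx

theorem ker_range (hφ0 : IsUpRb C i φ0)
    (P : KK C Λ n β i φ1 →ₗ[bAlg C (n + 1) (addA β i)] KK C Λ n β i φ0)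
    (hP : ∀ (b : bAlg C (n + 1) (addA β i)) m, P (b • vK Λ φ1 m) = b • ccElt C Λ n β i • vK Λ φ0 m)
    (b : bAlg C (n + 1) (addA β i)) (hb : toC C (Λ := Λ) b = 0)
    (z : KK C Λ n β i φ0) : b • z ∈ LinearMap.range P := by
  obtain ⟨Φ, hΦ⟩ := toC_lift C (Λ := Λ) (Algebra.lsmul k k (KK C Λ n β i φ0 ⧸ LinearMap.range P) :
      bAlg C (n + 1) (addA β i) →ₐ[k] Module.End k (KK C Λ n β i φ0 ⧸ LinearMap.range P)) (by
    refine LinearMap.ext fun q => ?_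
    obtain ⟨z, rfl⟩ := Submodule.Quotient.mk_surjective _ q
    show aLam C Λ (n + 1) (addA β i) • (Submodule.Quotient.mk z : KK C Λ n β i φ0 ⧸ LinearMap.range P) = 0
    rw [← Submodule.Quotient.mk_smul, Submodule.Quotient.mk_eq_zero]
    exact aLam_range hφ0 P hP z)
  have h := hΦ b
  rw [hb, map_zero] at h
  have h2 := LinearMap.congr_fun h (Submodule.Quotient.mk z : KK C Λ n β i φ0 ⧸ LinearMap.range P)
  have h3 : b • (Submodule.Quotient.mk z : KK C Λ n β i φ0 ⧸ LinearMap.range P) = 0 := h2.symm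
  rwa [← Submodule.Quotient.mk_smul, Submodule.Quotient.mk_eq_zero] at h3

theorem exact_mid (hφ0 : IsUpRb C i φ0) (hφc : IsUpRc C Λ i φc)
    (P : KK C Λ n β i φ1 →ₗ[bAlg C (n + 1) (addA β i)] KK C Λ n β i φ0)
    (hP : ∀ (b : bAlg C (n + 1) (addA β i)) m, P (b • vK Λ φ1 m) = b • ccElt C Λ n β i • vK Λ φ0 m)
    (pi : KK C Λ n β i φ0 →ₗ[bAlg C (n + 1) (addA β i)] cAlg C Λ (n + 1) (addA β i))
    (hpi : ∀ (b : bAlg C (n + 1) (addA β i)) m, pi (b • vK Λ φ0 m) = toC C b * φc m)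
    (z : KK C Λ n β i φ0) : pi z = 0 ↔ z ∈ Set.range ⇑P := by
  constructor
  · intro hz
    obtain ⟨b, rfl⟩ := K_form z
    rw [hpi, ← map_one (toC C), ← phi_compat hφ0 hφc, ← map_mul] at hz
    have h := ker_range hφ0 P hP _ hz (vK Λ φ0 1)
    rw [mul_smul, v_one] at h
    exact h
  · rintro ⟨y, rfl⟩
    induction y using KK_induction φ1 with
    | h b m =>
      rw [hP, ← mul_smul, hpi, map_mul, ccElt, map_mul, toC_aLam, zero_mul, mul_zero, zero_mul]
    | hadd x y hx hy => rw [map_add, map_add, hx, hy, add_zero]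

theorem range_pi (hφ0 : IsUpRb C i φ0) (hφc : IsUpRc C Λ i φc)
    (pi : KK C Λ n β i φ0 →ₗ[bAlg C (n + 1) (addA β i)] cAlg C Λ (n + 1) (addA β i))
    (hpi : ∀ (b : bAlg C (n + 1) (addA β i)) m, pi (b • vK Λ φ0 m) = toC C b * φc m) :
    Set.range ⇑pi = {x : cAlg C Λ (n + 1) (addA β i) |
          ∃ y : cAlg C Λ (n + 1) (addA β i), x = y * eRc C Λ n β i} := by
  ext x
  constructor
  · rintro ⟨z, rfl⟩
    obtain ⟨b, rfl⟩ := K_form z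
    exact ⟨toC C b, by rw [hpi, phic_one hφ0 hφc]⟩
  · rintro ⟨y, rfl⟩
    obtain ⟨b, rfl⟩ := toC_surj C y
    exact ⟨b • vK Λ φ0 1, by rw [hpi, phic_one hφ0 hφc]⟩

end PiMap
end KLR


namespace KLR

open scoped TensorProduct

section PhiAct

variable {k : Type} [Field k] {I : Type} [Fintype I] [DecidableEq I]
variable {C : CartanDatum k I} {n : ℕ} {Λ β : I → ℕ} {i : I}
variable {E : Type} [Ring E] [Algebra k E]

/-- The defining properties of the action on `E^{n+1}`. -/
structure IsPhi (R : RD C n i E) {γ : I → ℕ} (Φ : bAlg C (n + 1) γ →ₐ[k] Module.End k (Fin (n + 1) → E)) : Prop where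
  hE : ∀ ν f a, Φ (toB C (Ee C ν)) f a = R.cE a ν * f a
  hX : ∀ (b : Fin (n + 1)) f (a : Fin (n + 1)), Φ (toB C (Xx C b)) f a = R.xv a b * f a
  hT : ∀ l h f (a : Fin (n + 1)), Φ (toB C (Tt C l h)) f a = R.TT l (ev f) a

variable {R : RD C n i E} {γ : I → ℕ} {Φ : bAlg C (n + 1) γ →ₐ[k] Module.End k (Fin (n + 1) → E)}

theorem ev_zero_of {f : Fin (n + 1) → E} {b : ℕ} (h : ∀ c : Fin (n + 1), c.1 = b → f c = 0) : ev f b = 0 := by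
  unfold ev; split_ifs with hb
  · exact h _ rfl
  · rfl

theorem ev_mk' {f : Fin (n + 1) → E} {b : ℕ} (h : b < n + 1) : ev f b = f ⟨b, h⟩ := dif_pos h

/-- Support of `T_{a-1} ⋯ T_0` applied to a vector in position `0`. -/
theorem IsPhi.up (H : IsPhi R Φ) (x : E) (a : ℕ) (ha : a ≤ n) :
    (∀ c : Fin (n + 1), c.1 = a → Φ (wProd (bT C n γ) a) (Pi.single 0 x) c = x) ∧
    (∀ c : Fin (n + 1), a < c.1 → Φ (wProd (bT C n γ) a) (Pi.single 0 x) c = 0) := by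
  induction a with
  | zero =>
    rw [wProd, map_one]
    constructor
    · intro c hc
      obtain rfl : c = 0 := Fin.ext hc
      simp
    · intro c hc
      have : c ≠ 0 := by rintro rfl; simp at hc
      simp [this]
  | succ a ih =>
    obtain ⟨h1, h2⟩ := ih (by omega)
    rw [wProd, map_mul, bT_eq (by omega)]
    constructor
    · intro c hc
      rw [Module.End.mul_apply, H.hT, hc, RD.TT_1, ev_zero_of (b := a + 1) (fun c hc => h2 c (by omega)), mul_zero, add_zero,
        ev_mk' (by omega), h1 _ rfl]
    · intro c hc
      rw [Module.End.mul_apply, H.hT, RD.TT_gt _ hc, ev_fin, h2 _ (by omega), mul_zero]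

/-- The product of the `zq`. -/
noncomputable def zqP (R : RD C n i E) : ℕ → E
  | 0 => 1
  | a + 1 => R.zq (n - 1 - a) * zqP R a

theorem IsPhi.down (H : IsPhi R Φ) (x : E) (a : ℕ) (ha : a ≤ n) :
    (∀ c : Fin (n + 1), c.1 = n - a → Φ (wProd (fun l => bT C n γ (n - 1 - l)) a) (Pi.single (Fin.last n) x) c = zqP R a * x) ∧
    (∀ c : Fin (n + 1), c.1 < n - a → Φ (wProd (fun l => bT C n γ (n - 1 - l)) a) (Pi.single (Fin.last n) x) c = 0) := by
  induction a with
  | zero =>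
    rw [wProd, map_one, zqP]
    constructor
    · intro c hc
      obtain rfl : c = Fin.last n := Fin.ext hc
      simp
    · intro c hc
      have : c ≠ Fin.last n := by rintro rfl; simp at hc
      simp [this]
  | succ a ih =>
    obtain ⟨h1, h2⟩ := ih (by omega)
    rw [wProd, map_mul, bT_eq (by omega), zqP]
    have e : n - (a + 1) = n - 1 - a := by omega
    rw [e]
    constructor
    · intro c hc
      rw [Module.End.mul_apply, H.hT, hc, RD.TT_0, ev_zero_of (fun c hc => h2 c (by omega)), mul_zero, neg_zero,
        zero_add, ev_mk' (by omega), h1 _ (by simp only; omega), mul_assoc]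
    · intro c hc
      rw [Module.End.mul_apply, H.hT, RD.TT_lt _ hc, ev_fin, h2 _ (by omega), mul_zero]

theorem IsPhi.Xpow (H : IsPhi R Φ) (b : Fin (n + 1)) (j : ℕ) (f : Fin (n + 1) → E) (a : Fin (n + 1)) :
    Φ (toB C (Xx C b) ^ j) f a = R.xv a b ^ j * f a := by
  induction j generalizing f with
  | zero => rw [pow_zero, map_one, pow_zero, one_mul]; rfl
  | succ j ih => rw [pow_succ, map_mul, Module.End.mul_apply, ih, H.hX, pow_succ, mul_assoc]

theorem IsPhi.aLam_act (H : IsPhi R Φ) (f : Fin (n + 1) → E) (a : Fin (n + 1)) :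
    Φ (aLam C Λ (n + 1) γ) f a
      = ∑ μ : Fin n → I, R.xv a 0 ^ Λ ((a.insertNth i μ : Fin (n + 1) → I) 0) * (R.zE μ * f a) := by
  rw [aLam_eq, map_sum, LinearMap.sum_apply, Finset.sum_apply,
    ← (Fin.insertNthEquiv (fun _ => I) a).sum_comp, Fintype.sum_prod_type, Finset.sum_eq_single i]
  · refine Finset.sum_congr rfl fun μ _ => ?_
    have e : (Fin.insertNthEquiv (fun _ => I) a) (i, μ) = (a.insertNth i μ : Fin (n + 1) → I) := rfl
    rw [map_mul, Module.End.mul_apply, H.Xpow, H.hE, e, RD.cE, rm_fin, Fin.removeNth_insertNth, if_pos]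
    · rfl
    · rw [vl, dif_pos a.isLt]; simp
  · intro j _ hj
    refine Finset.sum_eq_zero fun μ _ => ?_
    have e : (Fin.insertNthEquiv (fun _ => I) a) (j, μ) = (a.insertNth j μ : Fin (n + 1) → I) := rfl
    rw [map_mul, Module.End.mul_apply, H.Xpow, H.hE, e, RD.cE, if_neg, zero_mul, mul_zero]
    rw [vl, dif_pos a.isLt]; simpa using hj
  · simp

theorem IsPhi.aLam_zero (H : IsPhi R Φ) (f : Fin (n + 1) → E) :
    Φ (aLam C Λ (n + 1) γ) f 0 = R.t ^ Λ i * f 0 := by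
  rw [H.aLam_act]
  have : ∀ μ : Fin n → I, ((0 : Fin (n + 1)).insertNth i μ : Fin (n + 1) → I) 0 = i := fun μ => by
    simp
  simp only [this]
  rw [← Finset.mul_sum, ← Finset.sum_mul, R.sum_zE, one_mul]
  congr 2

theorem IsPhi.aLam_pos (H : IsPhi R Φ)
    (hc : ∀ h : 0 < n, ∑ μ : Fin n → I, R.zx 0 ^ Λ (μ ⟨0, h⟩) * R.zE μ = 0)
    (f : Fin (n + 1) → E) (a : Fin (n + 1)) (ha : a ≠ 0) :
    Φ (aLam C Λ (n + 1) γ) f a = 0 := by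
  have hpos : 0 < a.1 := Fin.pos_of_ne_zero ha
  have hn : 0 < n := by have := a.2; omega
  rw [H.aLam_act]
  have : ∀ μ : Fin n → I, (a.insertNth i μ : Fin (n + 1) → I) 0 = μ ⟨0, hn⟩ := fun μ => by
    have h1 : a.succAbove ⟨0, hn⟩ = 0 := by
      rw [Fin.succAbove_of_castSucc_lt _ _ (by rw [Fin.lt_def]; exact hpos)]; rfl
    conv_lhs => rw [← h1]
    rw [Fin.insertNth_apply_succAbove]
  simp only [this, ← mul_assoc]
  rw [← Finset.sum_mul, R.xv_lt hpos, hc hn, zero_mul]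

end PhiAct
end KLR


namespace KLR

open scoped TensorProduct

section Inj

variable {k : Type} [Field k] {I : Type} [Fintype I] [DecidableEq I]
variable {C : CartanDatum k I} {n : ℕ} {Λ β : I → ℕ} {i : I}

section Gen
variable {E : Type} [Ring E] [Algebra k E]
variable {R : RD C n i E} {Φ : bAlg C (n + 1) (addA β i) →ₐ[k] Module.End k (Fin (n + 1) → E)}

theorem single_ext {f : Fin (n + 1) → E} {b : Fin (n + 1)} {x : E} (h1 : f b = x)
    (h2 : ∀ c, c ≠ b → f c = 0) : f = Pi.single b x := by
  funext c
  by_cases h : c = b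
  · subst h; rw [h1, Pi.single_eq_same]
  · rw [h2 c h, Pi.single_eq_of_ne h]

/-- The linear map `m ↦ (0, …, 0, h m)`. -/
def sglMap {S : Type} [Ring S] [Algebra k S] (n : ℕ) (h : S →ₗ[k] E) : S →ₗ[k] (Fin (n + 1) → E) where
  toFun m := Pi.single (Fin.last n) (h m)
  map_add' a b := by rw [map_add, Pi.single_add]
  map_smul' c a := by rw [map_smul, Pi.single_smul]; rfl

theorem IsPhi.E_last (H : IsPhi R Φ) (μ : Fin n → I) (x : E) :
    Φ (toB C (Ee C (Fin.snoc μ i))) (Pi.single (Fin.last n) x) = Pi.single (Fin.last n) (R.zE μ * x) := by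
  refine single_ext ?_ fun c hc => ?_
  · rw [H.hE, Pi.single_eq_same, RD.cE, rm_fin, if_pos]
    · congr 2
      funext a
      simp [Fin.removeNth]
    · rw [vl, dif_pos (Fin.isLt _)]
      show (Fin.snoc μ i : Fin (n + 1) → I) (Fin.last n) = i
      simp
  · rw [H.hE, Pi.single_eq_of_ne hc, mul_zero]

theorem IsPhi.R_last (H : IsPhi R Φ) {φ0 : bAlg C n β →ₙₐ[k] bAlg C (n + 1) (addA β i)} (hφ0 : IsUpRb C i φ0)
    (ψB : bAlg C n β →ₐ[k] E) (hψ : ∀ y, ψB (toB C y) = R.ψ y) (r : bAlg C n β) :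
    ∀ x, Φ (φ0 r) (Pi.single (Fin.last n) x) = Pi.single (Fin.last n) (ψB r * x) := by
  have h1 : ∀ x, Φ (φ0 1) (Pi.single (Fin.last n) x) = Pi.single (Fin.last n) x := by
    intro x
    rw [one_eq_sum, map_sum, map_sum, LinearMap.sum_apply]
    simp only [hφ0.1, H.E_last]
    have : ∀ μ : Fin n → I, (Pi.single (Fin.last n) (R.zE μ * x) : Fin (n + 1) → E)
        = (AddMonoidHom.single (fun _ : Fin (n + 1) => E) (Fin.last n)) (R.zE μ * x) := fun μ => rfl
    simp only [this]
    rw [← map_sum, ← Finset.sum_mul, R.sum_zE, one_mul]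
    rfl
  refine bAlg_induction C (p := fun r => ∀ x, Φ (φ0 r) (Pi.single (Fin.last n) x) = Pi.single (Fin.last n) (ψB r * x))
    ?_ ?_ ?_ ?_ ?_ ?_ ?_ r
  · intro x; rw [map_zero, map_zero, map_zero, zero_mul]; simp
  · intro ν x; rw [hφ0.1, H.E_last, hψ]; rfl
  · intro a x
    rw [hφ0.2.1, map_mul (toB C), ← R_one hφ0, map_mul, Module.End.mul_apply, h1]
    refine single_ext ?_ fun c hc => ?_
    · rw [H.hX, Pi.single_eq_same, hψ]
      congr 1
      rw [RD.xv_lt _ (by simp), RD.zx, xN, dif_pos (by simp)]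
      rfl
    · rw [H.hX, Pi.single_eq_of_ne hc, mul_zero]
  · intro l h x
    rw [hφ0.2.2, map_mul (toB C), ← R_one hφ0, map_mul, Module.End.mul_apply, h1]
    refine single_ext ?_ fun c hc => ?_
    · rw [H.hT, RD.TT_gt _ (by simpa using h), ev_fin, Pi.single_eq_same, hψ]
      congr 1
      rw [RD.zt, tN, dif_pos h]
    · have hcn : c.1 < n := lt_of_le_of_ne (Nat.lt_succ_iff.1 c.2) fun h => hc (Fin.ext h)
      have hz : ∀ b, b < n → ev (Pi.single (Fin.last n) x : Fin (n + 1) → E) b = 0 := fun b hb =>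
        ev_zero_of fun c hc => Pi.single_eq_of_ne (by rintro rfl; simp at hc; omega) _
      rw [H.hT, RD.TT, hz _ hcn, hz l (by omega), hz (l + 1) (by omega)]
      split_ifs <;> simp
  · intro a b ha hb x
    rw [map_add, map_add, LinearMap.add_apply, ha, hb, map_add, add_mul, Pi.single_add]
  · intro a b ha hb x
    rw [map_mul, map_mul, Module.End.mul_apply, hb, ha, map_mul, mul_assoc]
  · intro c a ha x
    rw [map_smul, map_smul, LinearMap.smul_apply, ha, map_smul, smul_mul_assoc, Pi.single_smul]

theorem IsPhi.cc_last (H : IsPhi R Φ)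
    (hc : ∀ h : 0 < n, ∑ μ : Fin n → I, R.zx 0 ^ Λ (μ ⟨0, h⟩) * R.zE μ = 0) (x : E) :
    Φ (ccElt C Λ n β i) (Pi.single (Fin.last n) x) = Pi.single 0 (R.t ^ Λ i * zqP R n * x) := by
  unfold ccElt
  rw [map_mul, Module.End.mul_apply, tauProd_eq]
  refine single_ext ?_ fun c hc' => ?_
  · rw [H.aLam_zero, (H.down x n le_rfl).1 _ (by simp), mul_assoc]
  · rw [H.aLam_pos hc _ _ hc']

theorem IsPhi.X0 (H : IsPhi R Φ) (j : ℕ) (x : E) :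
    Φ (toB C (Xx C 0) ^ j) (Pi.single 0 x) = Pi.single 0 (R.t ^ j * x) := by
  refine single_ext ?_ fun c hc' => ?_
  · rw [H.Xpow, Pi.single_eq_same]
    have : R.xv ((0 : Fin (n + 1)) : ℕ) ((0 : Fin (n + 1)) : ℕ) = R.t := R.xv_eq 0
    rw [this]
  · rw [H.Xpow, Pi.single_eq_of_ne hc', mul_zero]

theorem zqP_cm (R : RD C n i E) (a : ℕ) : zqP R a ∈ R.cm := by
  induction a with
  | zero => exact one_mem _
  | succ a ih => exact mul_mem (R.zq_cm _) ih

end Gen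

theorem zqP_inj (S : Type) [Ring S] [Algebra k S] (ψ : Alg C n →ₐ[k] S) (a : ℕ) {v : HahnSeries ℤ S}
    (h : zqP (hRD i ψ) a * v = 0) : v = 0 := by
  induction a with
  | zero => rw [zqP, one_mul] at h; exact h
  | succ a ih =>
    rw [zqP, mul_assoc] at h
    exact ih (zq_inj i ψ _ h)

/-- The polynomial map into Laurent series. -/
noncomputable def hD (k S : Type) [Field k] [Ring S] [Algebra k S] : (ℕ →₀ S) →ₗ[k] HahnSeries ℤ S :=
  Finsupp.lsum k fun j => (LinearMap.mulLeft k (hT S ^ j)) ∘ₗ (hC k S).toLinearMap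

theorem hD_single (S : Type) [Ring S] [Algebra k S] (j : ℕ) (m : S) :
    hD k S (Finsupp.single j m) = hT S ^ j * hC k S m := by
  rw [hD, Finsupp.lsum_single]; rfl

theorem hD_coeff (S : Type) [Ring S] [Algebra k S] (f : ℕ →₀ S) (j : ℕ) :
    (hD k S f).coeff (-(j : ℤ)) = f j := by
  induction f using Finsupp.induction_linear with
  | zero => simp
  | add f g hf hg => rw [map_add, HahnSeries.coeff_add, hf, hg]; rfl
  | single l m =>
    rw [hD_single, hT_pow_coeff, hC_apply, HahnSeries.C_apply, HahnSeries.coeff_single, Finsupp.single_apply]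
    by_cases h : l = j
    · subst h; simp
    · rw [if_neg h, if_neg (by omega)]

theorem hD_inj (S : Type) [Ring S] [Algebra k S] (f : ℕ →₀ S) (h : hD k S f = 0) : f = 0 := by
  ext j
  rw [← hD_coeff (k := k), h]; rfl

variable {φ0 φ1 : bAlg C n β →ₙₐ[k] bAlg C (n + 1) (addA β i)}

/-- The polynomial part of `K_1`. -/
noncomputable def hG (Λ : I → ℕ) (φ1 : bAlg C n β →ₙₐ[k] bAlg C (n + 1) (addA β i)) :
    (ℕ →₀ cAlg C Λ n β) →ₗ[k] KK C Λ n β i φ1 :=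
  Finsupp.lsum k fun j =>
    (Module.toModuleEnd k (S := bAlg C (n + 1) (addA β i)) (KK C Λ n β i φ1) (toB C (Xx C 0) ^ j)) ∘ₗ vK Λ φ1

theorem hG_single (j : ℕ) (m : cAlg C Λ n β) :
    hG Λ φ1 (Finsupp.single j m)
      = ((toB C (Xx C 0) : bAlg C (n + 1) (addA β i)) ^ j) • vK Λ φ1 m := by
  rw [hG, Finsupp.lsum_single]; rfl

theorem G0_range (g : KK C Λ n β i φ1) (hg : g ∈ G0 Λ φ1 (toB C (Xx C 0))) : ∃ f, hG Λ φ1 f = g := by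
  have : G0 Λ φ1 (toB C (Xx C 0)) ≤ LinearMap.range (hG Λ φ1) := by
    refine Submodule.span_le.2 ?_
    rintro _ ⟨j, m, rfl⟩
    exact ⟨_, hG_single j m⟩
  exact this hg

theorem P_inj (hφ0 : IsUpRb C i φ0) (hφ1 : IsUpLb C i φ1)
    (P : KK C Λ n β i φ1 →ₗ[bAlg C (n + 1) (addA β i)] KK C Λ n β i φ0)
    (hP : ∀ (b : bAlg C (n + 1) (addA β i)) m, P (b • vK Λ φ1 m) = b • ccElt C Λ n β i • vK Λ φ0 m) :
    Function.Injective P := by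
  set S := cAlg C Λ n β with hS
  set R : RD C n i (HahnSeries ℤ S) := hRD i (toCB C Λ (n := n) (β := β)) with hR
  have hψ : ∀ μ, μ ∉ seqs β n → R.ψ (Ee C μ) = 0 := by
    intro μ hμ
    show hC k S (toC C (toB C (Ee C μ))) = 0
    rw [toB_Ee_zero C hμ, map_zero, map_zero]
  obtain ⟨Φ, e1, e2, e3⟩ := R.exists_PhiB hψ
  have H : IsPhi R Φ := ⟨e1, e2, e3⟩
  have hc : ∀ h : 0 < n, ∑ μ : Fin n → I, R.zx 0 ^ Λ (μ ⟨0, h⟩) * R.zE μ = 0 := by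
    intro h
    obtain ⟨n', rfl⟩ := Nat.exists_eq_succ_of_ne_zero h.ne'
    have h1 := toC_aLam (C := C) (Λ := Λ) (n := n' + 1) (β := β)
    rw [aLam_eq, map_sum] at h1
    have h2 := congrArg (hC k S) h1
    rw [map_zero, map_sum] at h2
    rw [← h2]
    refine Finset.sum_congr rfl fun μ _ => ?_
    rw [map_mul (toC C), map_pow (toC C), map_mul, map_pow]
    rw [RD.zx, xN, dif_pos h]
    rfl
  let ψB : bAlg C n β →ₐ[k] HahnSeries ℤ S := (hC k S).comp (toC C)
  have hRl := H.R_last hφ0 ψB (fun y => rfl)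
  let iM : Module (bAlg C (n + 1) (addA β i)) (Fin (n + 1) → HahnSeries ℤ S) :=
    Module.compHom _ Φ.toRingHom
  have hsm : ∀ (b : bAlg C (n + 1) (addA β i)) (f : Fin (n + 1) → HahnSeries ℤ S), iM.toSMul.smul b f = Φ b f := fun _ _ => rfl
  have : IsScalarTower k (bAlg C (n + 1) (addA β i)) (Fin (n + 1) → HahnSeries ℤ S) := by
    refine ⟨fun c b f => ?_⟩
    show Φ (c • b) f = c • Φ b f
    rw [map_smul]; rfl
  let vv : S →ₗ[k] (Fin (n + 1) → HahnSeries ℤ S) :=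
    sglMap n (hC k S).toLinearMap
  obtain ⟨Ψ, hΨ⟩ := KK_lift φ0 (N := Fin (n + 1) → HahnSeries ℤ S) vv
    (by
      intro r m
      show Φ (φ0 r) (Pi.single (Fin.last n) (hC k S m)) = Pi.single (Fin.last n) (hC k S (toC C r * m))
      rw [hRl, map_mul]; rfl)
  obtain ⟨u, hu⟩ : ∃ u, u = R.t ^ Λ i * zqP R n := ⟨_, rfl⟩
  have hcm : u ∈ R.cm := hu ▸ mul_mem (pow_mem R.t_cm _) (zqP_cm R n)
  have hui : ∀ v, u * v = 0 → v = 0 := fun v hv => by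
    rw [hu, mul_assoc] at hv
    exact zqP_inj S _ n (hT_pow_inj hv)
  let θ : KK C Λ n β i φ1 →ₗ[bAlg C (n + 1) (addA β i)] (Fin (n + 1) → HahnSeries ℤ S) := Ψ ∘ₗ P
  have hθs : ∀ (b : bAlg C (n + 1) (addA β i)) z, θ (b • z) = Φ b (θ z) := fun b z => map_smul θ b z
  have hθv : ∀ m, θ (vK Λ φ1 m) = Pi.single 0 (u * hC k S m) := by
    intro m
    have h1 := hP 1 m
    rw [one_smul, one_smul] at h1
    show Ψ (P _) = _
    rw [h1, hΨ, hu]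
    exact H.cc_last hc _
  have hθG : ∀ f, θ (hG Λ φ1 f) = Pi.single 0 (u * hD k S f) := by
    intro f
    induction f using Finsupp.induction_linear with
    | zero => simp
    | add f g hf hg => rw [map_add, map_add, hf, hg, map_add, mul_add, Pi.single_add]
    | single j m =>
      rw [hG_single, hθs, hθv, H.X0, hD_single]
      have e : R.t ^ j * u = u * R.t ^ j := R.cm_comm (pow_mem R.t_cm j) hcm
      rw [← mul_assoc, e, mul_assoc]
      rfl
  have hTop : ∀ a, a ≤ n + 1 → ∀ z ∈ wSub (bT C n (addA β i)) (G0 Λ φ1 (toB C (Xx C 0))).toAddSubgroup a,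
      (∀ c : Fin (n + 1), a ≤ c.1 → θ z c = 0) ∧ (θ z = 0 → z = 0) := by
    intro a
    induction a with
    | zero =>
      intro _ z hz
      obtain rfl : z = 0 := hz
      refine ⟨fun c _ => ?_, fun _ => rfl⟩
      rw [map_zero]; rfl
    | succ a ih =>
      intro ha z hz
      obtain ⟨y, hy, w, ⟨g, hg, rfl⟩, rfl⟩ := AddSubgroup.mem_sup.1 hz
      obtain ⟨f, rfl⟩ := G0_range g hg
      obtain ⟨h1, h2⟩ := ih (by omega) y hy
      have e : θ (DistribSMul.toAddMonoidHom _ (wProd (bT C n (addA β i)) a) (hG Λ φ1 f))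
          = Φ (wProd (bT C n (addA β i)) a) (Pi.single 0 (u * hD k S f)) := by
        rw [← hθG]; exact hθs _ _
      obtain ⟨h3, h4⟩ := H.up (u * hD k S f) a (by omega)
      refine ⟨fun c hc => ?_, fun h0 => ?_⟩
      · rw [map_add, e, Pi.add_apply, h1 c (by omega), h4 c (by omega), add_zero]
      · have h5 := congrFun h0 ⟨a, by omega⟩
        rw [map_add, e, Pi.add_apply, h1 _ le_rfl, h3 _ rfl, zero_add] at h5
        have h6 := hD_inj S f (hui _ h5)
        subst h6
        rw [map_zero, map_zero, add_zero] at h0 ⊢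
        exact h2 h0
  rw [injective_iff_map_eq_zero]
  intro z hz
  refine (hTop (n + 1) le_rfl z (spanL hφ1 z)).2 ?_
  show Ψ (P z) = 0
  rw [hz, map_zero]

end Inj
end KLR


namespace KLR

open scoped TensorProduct
open MulOpposite

section ModGen

variable {k : Type} [Field k] {S K : Type} [Ring S] [Algebra k S] [AddCommGroup K] [Module k K]

theorem exists_mod (ρ : S →ₐ[k] (Module.End k K)ᵐᵒᵖ) (ξ : Module.End k K)
    (h : ∀ r, Commute (ρ r) (op ξ)) :
    ∃ inst : Module (S ⊗[k] Polynomial k)ᵐᵒᵖ K,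
      letI := inst
      (∀ (r : S) (z : K), op (r ⊗ₜ[k] (1 : Polynomial k)) • z = unop (ρ r) z) ∧
      (∀ z : K, op ((1 : S) ⊗ₜ[k] (Polynomial.X : Polynomial k)) • z = ξ z) := by
  have hc : ∀ (r : S) (p : Polynomial k), Commute (ρ r) (Polynomial.aeval (op ξ) p) := by
    intro r p
    induction p using Polynomial.induction_on' with
    | add p q hp hq => rw [map_add]; exact hp.add_right hq
    | monomial j a =>
      rw [Polynomial.aeval_monomial]
      exact Commute.mul_right (Algebra.commutes a (ρ r)).symm ((h r).pow_right j)
  let F : S ⊗[k] Polynomial k →ₐ[k] (Module.End k K)ᵐᵒᵖ :=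
    Algebra.TensorProduct.lift ρ (Polynomial.aeval (op ξ)) hc
  let Fo : (S ⊗[k] Polynomial k)ᵐᵒᵖ →+* Module.End k K :=
    (RingEquiv.opOp (Module.End k K)).symm.toRingHom.comp (RingHom.op F.toRingHom)
  have hF : ∀ s, Fo (op s) = unop (F s) := fun _ => rfl
  refine ⟨Module.compHom K Fo, fun r z => ?_, fun z => ?_⟩
  · show Fo (op _) z = _
    rw [hF, Algebra.TensorProduct.lift_tmul, map_one, mul_one]
  · show Fo (op _) z = _
    rw [hF, Algebra.TensorProduct.lift_tmul, map_one, one_mul, Polynomial.aeval_X]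
    rfl

theorem equiv_gen {K' : Type} [AddCommGroup K'] [Module (S ⊗[k] Polynomial k)ᵐᵒᵖ K]
    [Module (S ⊗[k] Polynomial k)ᵐᵒᵖ K'] (P : K →+ K')
    (h1 : ∀ (r : S) z, P (op (r ⊗ₜ[k] (1 : Polynomial k)) • z) = op (r ⊗ₜ[k] (1 : Polynomial k)) • P z)
    (h2 : ∀ z, P (op ((1 : S) ⊗ₜ[k] (Polynomial.X : Polynomial k)) • z)
      = op ((1 : S) ⊗ₜ[k] (Polynomial.X : Polynomial k)) • P z)
    (s : S ⊗[k] Polynomial k) : ∀ z, P (op s • z) = op s • P z := by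
  have hadd : ∀ s t : S ⊗[k] Polynomial k, (∀ z, P (op s • z) = op s • P z) → (∀ z, P (op t • z) = op t • P z) →
      ∀ z, P (op (s + t) • z) = op (s + t) • P z := by
    intro s t hs ht z
    rw [op_add, add_smul, add_smul, map_add, hs, ht]
  have hmul : ∀ s t : S ⊗[k] Polynomial k, (∀ z, P (op s • z) = op s • P z) → (∀ z, P (op t • z) = op t • P z) →
      ∀ z, P (op (s * t) • z) = op (s * t) • P z := by
    intro s t hs ht z
    rw [op_mul, mul_smul, mul_smul, ht, hs]
  have hp : ∀ j : ℕ, ∀ z, P (op ((1 : S) ⊗ₜ[k] (Polynomial.X ^ j : Polynomial k)) • z)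
      = op ((1 : S) ⊗ₜ[k] (Polynomial.X ^ j : Polynomial k)) • P z := by
    intro j
    induction j with
    | zero => rw [pow_zero]; exact h1 1
    | succ j ih =>
      have : (1 : S) ⊗ₜ[k] (Polynomial.X ^ (j + 1) : Polynomial k)
          = ((1 : S) ⊗ₜ[k] (Polynomial.X ^ j : Polynomial k)) * ((1 : S) ⊗ₜ[k] (Polynomial.X : Polynomial k)) := by
        rw [Algebra.TensorProduct.tmul_mul_tmul, one_mul, pow_succ]
      rw [this]
      exact hmul _ _ ih h2
  induction s using TensorProduct.induction_on with
  | zero => 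
    intro z
    have := h1 0 z
    rw [TensorProduct.zero_tmul] at this
    exact this
  | add s t hs ht => exact hadd _ _ hs ht
  | tmul r p =>
    induction p using Polynomial.induction_on' with
    | add p q hp hq => rw [TensorProduct.tmul_add]; exact hadd _ _ hp hq
    | monomial j a =>
      have : r ⊗ₜ[k] (Polynomial.monomial j a)
          = ((a • r) ⊗ₜ[k] (1 : Polynomial k)) * ((1 : S) ⊗ₜ[k] (Polynomial.X ^ j : Polynomial k)) := by
        rw [Algebra.TensorProduct.tmul_mul_tmul, mul_one, one_mul, TensorProduct.smul_tmul,
          Polynomial.smul_X_eq_monomial]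
      rw [this]
      exact hmul _ _ (h1 _) (hp j)

end ModGen

section ModK

variable {k : Type} [Field k] {I : Type} [Fintype I] [DecidableEq I]
variable {C : CartanDatum k I} {n : ℕ} {Λ β : I → ℕ} {i : I}
variable {φ : bAlg C n β →ₙₐ[k] bAlg C (n + 1) (addA β i)}

theorem right_mul (r : cAlg C Λ n β) : ∃ f : KK C Λ n β i φ →ₗ[bAlg C (n + 1) (addA β i)] KK C Λ n β i φ,
    ∀ (b : bAlg C (n + 1) (addA β i)) m, f (b • vK Λ φ m) = b • vK Λ φ (m * r) := by
  refine KK_lift φ (N := KK C Λ n β i φ) ((vK Λ φ) ∘ₗ LinearMap.mulRight k r) fun s m => ?_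
  show φ s • vK Λ φ (m * r) = vK Λ φ (toC C s * m * r)
  rw [vK_bal, mul_assoc]

theorem right_x {x : bAlg C (n + 1) (addA β i)} (hx : ∀ r, φ r * x = x * φ r) :
    ∃ f : KK C Λ n β i φ →ₗ[bAlg C (n + 1) (addA β i)] KK C Λ n β i φ,
    ∀ (b : bAlg C (n + 1) (addA β i)) m, f (b • vK Λ φ m) = b • x • vK Λ φ m := by
  refine KK_lift φ (N := KK C Λ n β i φ)
    ((Module.toModuleEnd k (S := bAlg C (n + 1) (addA β i)) (KK C Λ n β i φ) x) ∘ₗ vK Λ φ) fun s m => ?_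
  show φ s • x • vK Λ φ m = x • vK Λ φ (toC C s * m)
  rw [← mul_smul, hx, mul_smul, vK_bal]

theorem exists_modK {x : bAlg C (n + 1) (addA β i)} (hx : ∀ r, φ r * x = x * φ r) :
    ∃ inst : Module (cAlg C Λ n β ⊗[k] Polynomial k)ᵐᵒᵖ (KK C Λ n β i φ),
      letI := inst
      (∀ (r : cAlg C Λ n β) (b : bAlg C (n + 1) (addA β i)) (m : cAlg C Λ n β),
        op (r ⊗ₜ[k] (1 : Polynomial k)) • (b • vK Λ φ m) = b • vK Λ φ (m * r)) ∧
      (∀ (b : bAlg C (n + 1) (addA β i)) (m : cAlg C Λ n β),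
        op ((1 : cAlg C Λ n β) ⊗ₜ[k] (Polynomial.X : Polynomial k)) • (b • vK Λ φ m)
          = b • x • vK Λ φ m) := by
  choose f hf using right_mul (Λ := Λ) (φ := φ)
  obtain ⟨g, hg⟩ := right_x (Λ := Λ) hx
  let fr : cAlg C Λ n β → Module.End k (KK C Λ n β i φ) := fun r => (f r).restrictScalars k
  let gr : Module.End k (KK C Λ n β i φ) := g.restrictScalars k
  have hfr : ∀ r (b : bAlg C (n + 1) (addA β i)) m, fr r (b • vK Λ φ m) = b • vK Λ φ (m * r) := hf
  have hgr : ∀ (b : bAlg C (n + 1) (addA β i)) m, gr (b • vK Λ φ m) = b • x • vK Λ φ m := hg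
  have hext : ∀ F G : Module.End k (KK C Λ n β i φ),
      (∀ (b : bAlg C (n + 1) (addA β i)) m, F (b • vK Λ φ m) = G (b • vK Λ φ m)) → F = G := by
    intro F G h
    refine LinearMap.ext fun z => ?_
    induction z using KK_induction φ with
    | h b m => exact h b m
    | hadd x y hx hy => rw [map_add, map_add, hx, hy]
  let ρl : cAlg C Λ n β →ₗ[k] (Module.End k (KK C Λ n β i φ))ᵐᵒᵖ :=
    { toFun := fun r => op (fr r)
      map_add' := fun r s => by
        rw [← op_add]
        refine congrArg op (hext _ _ fun b m => ?_)
        rw [LinearMap.add_apply, hfr, hfr, hfr, mul_add, map_add, smul_add]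
      map_smul' := fun c s => by
        rw [RingHom.id_apply, ← op_smul]
        refine congrArg op (hext _ _ fun b m => ?_)
        rw [LinearMap.smul_apply, hfr, hfr, mul_smul_comm, map_smul, ksc] }
  let ρ : cAlg C Λ n β →ₐ[k] (Module.End k (KK C Λ n β i φ))ᵐᵒᵖ :=
    AlgHom.ofLinearMap ρl (by
      show op (fr 1) = op 1
      refine congrArg op (hext _ _ fun b m => ?_)
      rw [hfr, mul_one]; rfl) (by
      intro r s
      show op (fr (r * s)) = op (fr r) * op (fr s)
      rw [← op_mul]
      refine congrArg op (hext _ _ fun b m => ?_)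
      rw [Module.End.mul_apply, hfr, hfr, hfr, mul_assoc])
  have hcom : ∀ r, Commute (ρ r) (op gr) := by
    intro r
    show op (fr r) * op gr = op gr * op (fr r)
    rw [← op_mul, ← op_mul]
    refine congrArg op (hext _ _ fun b m => ?_)
    rw [Module.End.mul_apply, Module.End.mul_apply, hfr, hgr, hgr, ← mul_smul, ← mul_smul, hfr]
  obtain ⟨inst, h1, h2⟩ := exists_mod ρ gr hcom
  refine ⟨inst, fun r b m => ?_, fun b m => ?_⟩
  · rw [h1]; exact hfr r b m
  · rw [h2]; exact hgr b m

theorem comm_of {x0 : bAlg C (n + 1) (addA β i)} (hx : ∀ r, φ r * x0 = x0 * φ r) (r : bAlg C n β) :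
    φ r * (x0 * φ 1) = x0 * φ 1 * φ r := by
  rw [← mul_assoc, hx, mul_assoc, mul_assoc, ← map_mul, ← map_mul, one_mul, mul_one]

theorem mul_comm3 {A : Type} [Ring A] {a b c : A} (h1 : a * c = c * a) (h2 : b * c = c * b) :
    a * b * c = c * (a * b) := by
  rw [mul_assoc, h2, ← mul_assoc, h1, mul_assoc]

theorem x0_comm (hφ : IsUpLb C i φ) (r : bAlg C n β) : φ r * toB C (Xx C 0) = toB C (Xx C 0) * φ r := by
  have h1 : φ 1 * toB C (Xx C 0) = toB C (Xx C 0) * φ 1 := by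
    rw [one_eq_sum, map_sum, Finset.sum_mul, Finset.mul_sum]
    refine Finset.sum_congr rfl fun μ _ => ?_
    rw [hφ.1, EX_comm]
  refine bAlg_induction C (p := fun r => φ r * toB C (Xx C 0) = toB C (Xx C 0) * φ r) ?_ ?_ ?_ ?_ ?_ ?_ ?_ r
  · rw [map_zero, zero_mul, mul_zero]
  · intro ν; rw [hφ.1, EX_comm]
  · intro a; rw [hφ.2.1, map_mul (toB C), ← L_one hφ]; exact mul_comm3 (XX_comm _ _) h1
  · intro l h; rw [hφ.2.2, map_mul (toB C), ← L_one hφ]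
    exact mul_comm3 (TX_comm _ _ _ (by simp) (by simp)) h1
  · intro a b ha hb; rw [map_add, add_mul, mul_add, ha, hb]
  · intro a b ha hb; rw [map_mul]; exact mul_comm3 ha hb
  · intro c a ha; rw [map_smul, smul_mul_assoc, ha, mul_smul_comm]

theorem xn_comm (hφ : IsUpRb C i φ) (r : bAlg C n β) :
    φ r * toB C (Xx C (Fin.last n)) = toB C (Xx C (Fin.last n)) * φ r := by
  have h1 : φ 1 * toB C (Xx C (Fin.last n)) = toB C (Xx C (Fin.last n)) * φ 1 := by
    rw [one_eq_sum, map_sum, Finset.sum_mul, Finset.mul_sum]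
    refine Finset.sum_congr rfl fun μ _ => ?_
    rw [hφ.1, EX_comm]
  refine bAlg_induction C
    (p := fun r => φ r * toB C (Xx C (Fin.last n)) = toB C (Xx C (Fin.last n)) * φ r) ?_ ?_ ?_ ?_ ?_ ?_ ?_ r
  · rw [map_zero, zero_mul, mul_zero]
  · intro ν; rw [hφ.1, EX_comm]
  · intro a; rw [hφ.2.1, map_mul (toB C), ← R_one hφ]; exact mul_comm3 (XX_comm _ _) h1
  · intro l h; rw [hφ.2.2, map_mul (toB C), ← R_one hφ]
    exact mul_comm3 (TX_comm _ _ _ (by simp; omega) (by simp; omega)) h1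
  · intro a b ha hb; rw [map_add, add_mul, mul_add, ha, hb]
  · intro a b ha hb; rw [map_mul]; exact mul_comm3 ha hb
  · intro c a ha; rw [map_smul, smul_mul_assoc, ha, mul_smul_comm]

end ModK
end KLR

open KLR MulOpposite TensorProduct in
set_option maxHeartbeats 1000000 in
/-- Right multiplication by `a^Λ(x_1)τ_1⋯τ_n` induces a well-defined map `P : K₁ → K₀`,
the identity of `R(β+α_i)e(β,α_i)` induces a well-defined surjection `π : K₀ → F^Λ`,
both are homomorphisms of `(R(β+α_i), R^Λ(β) ⊗ k[t_i])`-bimodules, and the sequence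
`0 → K₁ → K₀ → F^Λ → 0` is exact. -/
theorem K1_K0_FLambda_exact {k : Type} [Field k] {I : Type} [Fintype I]
    [DecidableEq I] (C : CartanDatum k I) (Λ : I → ℕ) (β : I → ℕ) (i : I) (n : ℕ)
    (hn : ht I β = n)
    (φ0 : bAlg C n β →ₙₐ[k] bAlg C (n + 1) (addA β i)) (hφ0 : IsUpRb C i φ0)
    (φ1 : bAlg C n β →ₙₐ[k] bAlg C (n + 1) (addA β i)) (hφ1 : IsUpLb C i φ1)
    (φc : cAlg C Λ n β →ₙₐ[k] cAlg C Λ (n + 1) (addA β i)) (hφc : IsUpRc C Λ i φc) :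
    ∃ (inst1 : Module (cAlg C Λ n β ⊗[k] Polynomial k)ᵐᵒᵖ (KK C Λ n β i φ1))
      (inst0 : Module (cAlg C Λ n β ⊗[k] Polynomial k)ᵐᵒᵖ (KK C Λ n β i φ0)),
      letI := inst1
      letI := inst0
      -- the right `R^Λ(β) ⊗ k[t_i]`-module structure on `K₁`
      (∀ (r : cAlg C Λ n β) (b : bAlg C (n + 1) (addA β i)) (m : cAlg C Λ n β),
        op (r ⊗ₜ[k] (1 : Polynomial k)) • KKmk C Λ n β i φ1 b m
          = KKmk C Λ n β i φ1 b (m * r)) ∧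
      (∀ (b : bAlg C (n + 1) (addA β i)) (m : cAlg C Λ n β),
        op ((1 : cAlg C Λ n β) ⊗ₜ[k] (Polynomial.X : Polynomial k)) • KKmk C Λ n β i φ1 b m
          = KKmk C Λ n β i φ1 (b * toB C (Xx C 0 * eL C n β i)) m) ∧
      -- the right `R^Λ(β) ⊗ k[t_i]`-module structure on `K₀`
      (∀ (r : cAlg C Λ n β) (b : bAlg C (n + 1) (addA β i)) (m : cAlg C Λ n β),
        op (r ⊗ₜ[k] (1 : Polynomial k)) • KKmk C Λ n β i φ0 b m
          = KKmk C Λ n β i φ0 b (m * r)) ∧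
      (∀ (b : bAlg C (n + 1) (addA β i)) (m : cAlg C Λ n β),
        op ((1 : cAlg C Λ n β) ⊗ₜ[k] (Polynomial.X : Polynomial k)) • KKmk C Λ n β i φ0 b m
          = KKmk C Λ n β i φ0 (b * toB C (Xx C (Fin.last n) * eR C n β i)) m) ∧
      ∃ (P : KK C Λ n β i φ1 →ₗ[bAlg C (n + 1) (addA β i)] KK C Λ n β i φ0)
        (pi : KK C Λ n β i φ0 →ₗ[bAlg C (n + 1) (addA β i)]
          cAlg C Λ (n + 1) (addA β i)),
        -- `P` is induced by right multiplication by `a^Λ(x_1)τ_1⋯τ_n`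
        (∀ (b : bAlg C (n + 1) (addA β i)) (m : cAlg C Λ n β),
          P (KKmk C Λ n β i φ1 b m) = KKmk C Λ n β i φ0 (b * ccElt C Λ n β i) m) ∧
        -- `π` is induced by the identity of `R(β+α_i)e(β,α_i)`
        (∀ (b : bAlg C (n + 1) (addA β i)) (m : cAlg C Λ n β),
          pi (KKmk C Λ n β i φ0 b m) = toC C b * φc m) ∧
        -- `P` and `π` are right `R^Λ(β) ⊗ k[t_i]`-equivariant
        (∀ (s : cAlg C Λ n β ⊗[k] Polynomial k) (z : KK C Λ n β i φ1),
          P (op s • z) = op s • P z) ∧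
        (∀ (r : cAlg C Λ n β) (z : KK C Λ n β i φ0),
          pi (op (r ⊗ₜ[k] (1 : Polynomial k)) • z) = pi z * φc r) ∧
        (∀ z : KK C Λ n β i φ0,
          pi (op ((1 : cAlg C Λ n β) ⊗ₜ[k] (Polynomial.X : Polynomial k)) • z)
            = pi z * toCB C Λ (Xx C (Fin.last n) * eR C n β i)) ∧
        -- exactness of `0 → K₁ → K₀ → F^Λ → 0`
        Function.Injective ⇑P ∧
        (∀ z : KK C Λ n β i φ0, pi z = 0 ↔ z ∈ Set.range ⇑P) ∧
        Set.range ⇑pi = {x : cAlg C Λ (n + 1) (addA β i) |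
          ∃ y : cAlg C Λ (n + 1) (addA β i), x = y * eRc C Λ n β i} := by
  have hx1 : ∀ r, φ1 r * toB C (Xx C 0 * eL C n β i) = toB C (Xx C 0 * eL C n β i) * φ1 r := by
    intro r
    rw [map_mul (toB C), ← L_one hφ1]
    exact comm_of (x0_comm hφ1) r
  have hx0 : ∀ r, φ0 r * toB C (Xx C (Fin.last n) * eR C n β i)
      = toB C (Xx C (Fin.last n) * eR C n β i) * φ0 r := by
    intro r
    rw [map_mul (toB C), ← R_one hφ0]
    exact comm_of (xn_comm hφ0) r
  obtain ⟨inst1, h11, h12⟩ := exists_modK (Λ := Λ) hx1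
  obtain ⟨inst0, h01, h02⟩ := exists_modK (Λ := Λ) hx0
  obtain ⟨P, hP⟩ := exists_P (Λ := Λ) hφ0 hφ1
  obtain ⟨pi, hpi⟩ := exists_pi (Λ := Λ) hφ0 hφc
  refine ⟨inst1, inst0, ?_, ?_, ?_, ?_, P, pi, ?_, ?_, ?_, ?_, ?_, P_inj hφ0 hφ1 P hP,
    exact_mid hφ0 hφc P hP pi hpi, range_pi hφ0 hφc pi hpi⟩
  · intro r b m
    rw [KK_vK, KK_vK, h11]
  · intro b m
    rw [KK_vK, KK_vK, h12, mul_smul]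
  · intro r b m
    rw [KK_vK, KK_vK, h01]
  · intro b m
    rw [KK_vK, KK_vK, h02, mul_smul]
  · intro b m
    rw [KK_vK, KK_vK, hP, mul_smul]
  · intro b m
    rw [KK_vK, hpi]
  · refine equiv_gen P.toAddMonoidHom (fun r z => ?_) (fun z => ?_)
    · show P _ = op _ • P z
      induction z using KK_induction φ1 with
      | h b m => rw [h11, hP, hP, ← mul_smul, ← mul_smul, h01]
      | hadd x y hx hy => rw [smul_add, map_add, map_add, smul_add, hx, hy]
    · show P _ = op _ • P z
      induction z using KK_induction φ1 with
      | h b m =>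
        rw [h12, ← mul_smul, hP, hP, ← mul_smul b, h02, map_mul (toB C), map_mul (toB C), ← L_one hφ1, ← R_one hφ0,
          mul_smul, mul_smul, mul_smul, mul_smul, cc_bal_one hφ0 hφ1, v_one, cc_X_zero hφ0 (G0_v m)]
      | hadd x y hx hy => rw [smul_add, map_add, map_add, smul_add, hx, hy]
  · intro r z
    induction z using KK_induction φ0 with
    | h b m => rw [h01, hpi, hpi, map_mul, mul_assoc]
    | hadd x y hx hy => rw [smul_add, map_add, map_add, add_mul, hx, hy]
  · intro z
    induction z using KK_induction φ0 with
    | h b m =>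
      obtain ⟨r, rfl⟩ := toC_surj C m
      rw [h02, ← mul_smul, hpi, hpi, map_mul (toC C), mul_assoc, mul_assoc, ← phi_compat hφ0 hφc]
      have e := congrArg (toC C (Λ := Λ)) (hx0 r)
      rw [map_mul (toC C), map_mul (toC C)] at e
      rw [← e]
      rfl
    | hadd x y hx hy => rw [smul_add, map_add, map_add, add_mul, hx, hy]
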